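/- arXiv:1711.05358 — 2 statements merged into one kernel-verified Lean document; each statement's English description precedes it below -/
import Mathlib

section
/- Let c > 0 be a constant. For every ε > 0 there exists a constant C = C(ε, q) such that the following holds for every n ≥ 1. Let r be an integer with 0 ≤ r ≤ cn, let F : F_q^r → ℂ satisfy |F(a)| ≤ 1 for all a ∈ F_q^r, and let ℓ_1, …, ℓ_r be F_q-linear forms on F_q^n. Then |∑_{f ∈ F_q[t], deg f < n} μ(f) · F(ℓ_1(x(f)), …, ℓ_r(x(f)))| ≤ C · q^{(3/4 + c + ε)n}. -/
open Polynomial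

/- The Möbius function on `F_q[t]`. -/
open scoped Classical in
noncomputable def polyMu {F : Type*} [Field F] (f : Polynomial F) : ℤ :=
  if Squarefree f then (-1) ^ (UniqueFactorizationMonoid.normalizedFactors f).card else 0

/-- The polynomial of degree `< n` with coefficient vector `x ∈ F_q^n`. -/
noncomputable def lowPoly (F : Type*) [Field F] (n : ℕ) (x : Fin n → F) : Polynomial F :=
  ∑ i : Fin n, C (x i) * X ^ (i : ℕ)

section CoordinateDegree

variable {k : Type*} [Field k] {A : Type*} [CommRing A] [Algebra k[X] A] {e : ℕ}

/-- Elements whose coordinates in the basis `w` are polynomials of degree at most `N`. -/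
def degLE (w : Module.Basis (Fin e) k[X] A) (N : ℕ) : AddSubgroup A where
  carrier := {f | ∀ i, (w.repr f i).natDegree ≤ N}
  zero_mem' := by simp
  add_mem' := by
    intro a b ha hb i
    simp only [map_add, Finsupp.add_apply]
    exact (natDegree_add_le _ _).trans (max_le (ha i) (hb i))
  neg_mem' := by
    intro a ha i
    simpa using ha i

variable (w : Module.Basis (Fin e) k[X] A)

theorem degLE_mono {N N' : ℕ} (h : N ≤ N') : degLE w N ≤ degLE w N' :=
  fun _ hf i => (hf i).trans h

theorem smul_mem_degLE {p : k[X]} {a N : ℕ} (hp : p.natDegree ≤ a) {f : A} (hf : f ∈ degLE w N) :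
    p • f ∈ degLE w (a + N) := by
  intro i
  simp only [map_smul, Finsupp.smul_apply, smul_eq_mul]
  exact natDegree_mul_le.trans (add_le_add hp (hf i))

theorem exists_mem_degLE {ι : Type*} [Finite ι] (f : ι → A) : ∃ N, ∀ i, f i ∈ degLE w N := by
  cases nonempty_fintype ι
  refine ⟨∑ i, ∑ j, (w.repr (f i) j).natDegree, fun i j => ?_⟩
  refine (Finset.single_le_sum (f := fun j => (w.repr (f i) j).natDegree)
    (fun _ _ => Nat.zero_le _) (Finset.mem_univ j)).trans ?_
  exact Finset.single_le_sum (f := fun i => ∑ j, (w.repr (f i) j).natDegree)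
    (fun _ _ => Nat.zero_le _) (Finset.mem_univ i)

theorem exists_linearMap_mem_degLE (g : A →ₗ[k[X]] A) :
    ∃ c, ∀ N, ∀ f ∈ degLE w N, g f ∈ degLE w (N + c) := by
  obtain ⟨c, hc⟩ := exists_mem_degLE w (fun i => g (w i))
  refine ⟨c, fun N f hf => ?_⟩
  rw [← w.sum_repr f, map_sum]
  refine AddSubgroup.sum_mem _ fun i _ => ?_
  rw [map_smul]
  exact smul_mem_degLE w (hf i) (hc i)

theorem exists_mul_mem_degLE :
    ∃ c, ∀ N N', ∀ f ∈ degLE w N, ∀ f' ∈ degLE w N', f * f' ∈ degLE w (N + N' + c) := by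
  obtain ⟨c, hc⟩ := exists_mem_degLE w (fun i : Fin e × Fin e => w i.1 * w i.2)
  refine ⟨c, fun N N' f hf f' hf' => ?_⟩
  rw [← w.sum_repr f, ← w.sum_repr f', Finset.sum_mul_sum]
  refine AddSubgroup.sum_mem _ fun i _ => AddSubgroup.sum_mem _ fun j _ => ?_
  rw [smul_mul_smul_comm]
  exact smul_mem_degLE w (natDegree_mul_le.trans (add_le_add (hf i) (hf' j))) (hc (i, j))

theorem pow_mem_degLE {c : ℕ}
    (hc : ∀ N N', ∀ f ∈ degLE w N, ∀ f' ∈ degLE w N', f * f' ∈ degLE w (N + N' + c))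
    {N : ℕ} {f : A} (hf : f ∈ degLE w N) {r : ℕ} (hr : r ≠ 0) : f ^ r ∈ degLE w (r * (N + c)) := by
  obtain ⟨r, rfl⟩ := Nat.exists_eq_succ_of_ne_zero hr
  clear hr
  induction r with
  | zero => simpa using degLE_mono w (by simp) hf
  | succ r ih =>
    rw [pow_succ]
    exact degLE_mono w (by simp only [Nat.succ_eq_add_one]; ring_nf; omega) (hc _ _ _ ih _ hf)

theorem natDegree_det_le_of_entries (M : Matrix (Fin e) (Fin e) k[X]) {N : ℕ}
    (h : ∀ i j, (M i j).natDegree ≤ N) : M.det.natDegree ≤ e * N := by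
  rw [Matrix.det_apply]
  refine natDegree_sum_le_of_forall_le _ _ fun σ _ => ?_
  refine (natDegree_smul_le _ _).trans ?_
  refine (natDegree_prod_le _ _).trans ?_
  refine (Finset.sum_le_sum fun i _ => h (σ i) i).trans ?_
  simp

theorem dvd_algebraMap_norm (w : Module.Basis (Fin e) k[X] A) (f : A) :
    f ∣ algebraMap k[X] A (Algebra.norm k[X] f) := by
  classical
  set M := Algebra.leftMulMatrix w f with hM
  refine ⟨w.equivFun.symm (M.adjugate.mulVec (w.equivFun 1)), ?_⟩
  apply w.equivFun.injective
  have h1 : ∀ v : A, w.equivFun (f * v) = M.mulVec (w.equivFun v) := by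
    intro v
    ext1 i
    have := congrFun (Algebra.leftMulMatrix_mulVec_repr w f v) i
    simpa [hM] using this.symm
  rw [h1, LinearEquiv.apply_symm_apply, Matrix.mulVec_mulVec, Matrix.mul_adjugate,
    Algebra.norm_eq_matrix_det w, Algebra.algebraMap_eq_smul_one, map_smul, Matrix.smul_mulVec,
    Matrix.one_mulVec]

theorem exists_natDegree_norm_le :
    ∃ c, ∀ N, ∀ f ∈ degLE w N, (Algebra.norm k[X] f).natDegree ≤ e * (N + c) := by
  obtain ⟨c, hc⟩ := exists_mul_mem_degLE w
  obtain ⟨c', hc'⟩ := exists_mem_degLE w w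
  refine ⟨c' + c, fun N f hf => ?_⟩
  rw [Algebra.norm_eq_matrix_det w]
  refine natDegree_det_le_of_entries _ fun i j => ?_
  rw [Algebra.leftMulMatrix_eq_repr_mul, ← add_assoc]
  exact hc _ _ _ hf _ (hc' j) i

theorem order_le_natDegree_norm [IsDomain A] (w : Module.Basis (Fin e) k[X] A)
    (ι : A →ₐ[k[X]] PowerSeries k)
    {f : A} (hf : f ≠ 0) : (ι f).order ≤ (Algebra.norm k[X] f).natDegree := by
  have hfree : Module.Free k[X] A := Module.Free.of_basis w
  have hfin : Module.Finite k[X] A := Module.Finite.of_basis w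
  obtain ⟨s, hs⟩ := dvd_algebraMap_norm w f
  have h0 : Algebra.norm k[X] f ≠ 0 := Algebra.norm_ne_zero_iff.mpr hf
  have h1 : ((Algebra.norm k[X] f : k[X]) : PowerSeries k) = ι f * ι s := by
    rw [← map_mul, ← hs, AlgHom.commutes]; rfl
  have h2 : (((Algebra.norm k[X] f : k[X]) : PowerSeries k)).order ≤
      (Algebra.norm k[X] f).natDegree := by
    apply PowerSeries.order_le
    rw [Polynomial.coeff_coe]
    simpa using h0
  rw [h1, PowerSeries.order_mul] at h2
  exact le_self_add.trans h2

theorem natDegree_le_of_algebraMap_dvd {D : k[X]} {h : A} {N : ℕ}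
    (hh : h ≠ 0) (hN : h ∈ degLE w N) (hD : algebraMap k[X] A D ∣ h) : D.natDegree ≤ N := by
  obtain ⟨v, rfl⟩ := hD
  obtain ⟨i, hi⟩ : ∃ i, w.repr (algebraMap k[X] A D * v) i ≠ 0 := by
    by_contra! hcon
    exact hh (w.repr.map_eq_zero_iff.mp (Finsupp.ext hcon))
  refine le_trans ?_ (hN i)
  rw [← Algebra.smul_def, map_smul, Finsupp.smul_apply, smul_eq_mul] at hi ⊢
  exact Polynomial.natDegree_le_of_dvd (Dvd.intro _ rfl) hi

end CoordinateDegree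

section Stepanov

theorem exists_frobenius_ringHom {k : Type*} [Field k] [Fintype k] {A : Type*} [CommRing A]
    (φ : k →+* A) (μ : ℕ) : ∃ Fr : A →+* A, ∀ x, Fr x = x ^ (Fintype.card k ^ μ) := by
  rcases subsingleton_or_nontrivial A with h | h
  · exact ⟨RingHom.id A, fun x => Subsingleton.elim _ _⟩
  · obtain ⟨p, hp⟩ := CharP.exists k
    obtain ⟨n, hprime, hn⟩ := FiniteField.card k p
    have : Fact p.Prime := ⟨hprime⟩
    have : CharP A p := charP_of_injective_ringHom φ.injective p
    refine ⟨iterateFrobenius A p (n * μ), fun x => ?_⟩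
    rw [iterateFrobenius_def, hn, pow_mul]

theorem sum_mul_pow_ne_zero {k : Type*} [Field k] {n R : ℕ} (F S : Fin n → PowerSeries k)
    (hF0 : ∀ i, F i ≠ 0) (hF : Function.Injective fun i => (F i).order)
    (hS : ∀ i, S i ≠ 0 → (S i).order < R) (hne : ∃ i, S i ≠ 0) :
    ∑ i, S i * F i ^ R ≠ 0 := by
  classical
  set T := Finset.univ.filter fun i => S i ≠ 0 with hT
  have hTne : T.Nonempty := by
    obtain ⟨i, hi⟩ := hne
    exact ⟨i, by simpa [hT] using hi⟩
  obtain ⟨i, hiT, hi⟩ := T.exists_min_image (fun i => (F i).order) hTne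
  have hSi : S i ≠ 0 := by simpa [hT] using hiT
  obtain ⟨a, ha⟩ := ENat.ne_top_iff_exists.mp (mt PowerSeries.order_eq_top.mp (hF0 i))
  obtain ⟨b, hb⟩ := ENat.ne_top_iff_exists.mp (mt PowerSeries.order_eq_top.mp hSi)
  have hterm : (S i * F i ^ R).order = ((b + R * a : ℕ) : ℕ∞) := by
    rw [PowerSeries.order_mul, PowerSeries.order_pow, ← ha, ← hb]
    simp
  have hbR : b < R := by
    have := hS i hSi
    rw [← hb] at this
    exact_mod_cast this
  have hother : ∀ j, j ≠ i → PowerSeries.coeff (b + R * a) (S j * F j ^ R) = 0 := by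
    intro j hj
    by_cases hSj : S j = 0
    · simp [hSj]
    apply PowerSeries.coeff_of_lt_order
    obtain ⟨a', ha'⟩ := ENat.ne_top_iff_exists.mp (mt PowerSeries.order_eq_top.mp (hF0 j))
    obtain ⟨b', hb'⟩ := ENat.ne_top_iff_exists.mp (mt PowerSeries.order_eq_top.mp hSj)
    have h1 : (F i).order ≤ (F j).order := hi j (by simpa [hT] using hSj)
    have h2 : (F i).order ≠ (F j).order := fun h => hj (hF h).symm
    rw [← ha, ← ha'] at h1 h2
    have h1' : a ≤ a' := by exact_mod_cast h1
    have h2' : a ≠ a' := by exact_mod_cast h2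
    have h3 : a + 1 ≤ a' := by omega
    have h4 : R * (a + 1) ≤ R * a' := Nat.mul_le_mul_left R h3
    rw [PowerSeries.order_mul, PowerSeries.order_pow, ← ha', ← hb']
    have : b + R * a < b' + R * a' := by rw [mul_add] at h4; omega
    simpa using (by exact_mod_cast this : ((b + R * a : ℕ) : ℕ∞) < ((b' + R * a' : ℕ) : ℕ∞))
  intro hsum
  have h5 := congrArg (PowerSeries.coeff (b + R * a)) hsum
  rw [map_sum, Finset.sum_eq_single i (fun j _ hj => hother j hj) (by simp), map_zero] at h5
  have h6 : S i * F i ^ R ≠ 0 := mul_ne_zero hSi (pow_ne_zero _ (hF0 i))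
  refine PowerSeries.coeff_order h6 ?_
  rw [hterm, ENat.toNat_natCast]
  exact h5

variable {k : Type*} [Field k] [Fintype k] {A : Type*} [CommRing A] [Algebra k[X] A] {e : ℕ}

theorem card_degLE (w : Module.Basis (Fin e) k[X] A) (N : ℕ) :
    Nat.card (degLE w N) = Fintype.card k ^ (e * (N + 1)) := by
  have hmem : ∀ p : k[X], p ∈ degreeLT k (N + 1) ↔ p.natDegree ≤ N := by
    intro p
    rw [mem_degreeLT]
    constructor
    · intro h
      by_cases hp : p = 0
      · simp [hp]
      · exact Nat.lt_succ_iff.mp ((natDegree_lt_iff_degree_lt hp).mpr h)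
    · intro h
      exact degree_le_natDegree.trans_lt (by exact_mod_cast Nat.lt_succ_of_le h)
  let E : degLE w N ≃ (Fin e → degreeLT k (N + 1)) :=
    { toFun := fun f i => ⟨w.repr f.1 i, (hmem _).mpr (f.2 i)⟩
      invFun := fun c => ⟨w.equivFun.symm fun i => (c i).1, fun i => by
        have := congrFun (w.equivFun.apply_symm_apply fun i => (c i).1) i
        rw [Module.Basis.equivFun_apply] at this
        rw [this]
        exact (hmem _).mp (c i).2⟩
      left_inv := fun f => by
        ext1
        exact w.equivFun.symm_apply_apply f.1
      right_inv := fun c => by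
        ext1 i
        ext1
        exact congrFun (w.equivFun.apply_symm_apply fun i => (c i).1) i }
  rw [Nat.card_congr E, Nat.card_congr
    (Equiv.piCongrRight fun _ => (degreeLTEquiv k (N + 1)).toEquiv)]
  rw [Nat.card_eq_fintype_card]
  simp only [Fintype.card_fun, Fintype.card_fin]
  rw [← pow_mul, mul_comm]

theorem finite_degLE (w : Module.Basis (Fin e) k[X] A) (N : ℕ) : Finite (degLE w N) :=
  Nat.finite_of_card_ne_zero (by rw [card_degLE]; exact pow_ne_zero _ Fintype.card_ne_zero)

theorem exists_distinct_orders (w : Module.Basis (Fin e) k[X] A) (ι : A →ₐ[k[X]] PowerSeries k)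
    (hι : Function.Injective ι) (m : ℕ) :
    ∃ f : Fin (e * (m + 1)) → A, (∀ i, f i ∈ degLE w m) ∧ (∀ i, f i ≠ 0) ∧
      Function.Injective fun i => (ι (f i)).order := by
  classical
  have := finite_degLE w m
  have := Fintype.ofFinite (degLE w m)
  set O : Finset ℕ∞ := (Finset.univ.filter fun v : degLE w m => v ≠ 0).image
    fun v => (ι v.1).order with hO
  have hinj : Function.Injective fun (v : degLE w m) (o : O) =>
      PowerSeries.coeff o.1.toNat (ι v.1) := by
    intro v v' h
    by_contra hne
    have hne' : v - v' ≠ 0 := sub_ne_zero.mpr hne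
    have h0 : ι (v - v').1 ≠ 0 := by
      rw [Ne, map_eq_zero_iff ι hι]
      exact fun h => hne' (Subtype.ext h)
    have hmem : (ι (v - v').1).order ∈ O :=
      Finset.mem_image.mpr ⟨v - v', by simpa using hne', rfl⟩
    have h1 := congrFun h ⟨_, hmem⟩
    refine PowerSeries.coeff_order h0 ?_
    have key : ∀ n, PowerSeries.coeff n (ι (v - v').1) =
        PowerSeries.coeff n (ι v.1) - PowerSeries.coeff n (ι v'.1) := fun n => by
      rw [AddSubgroup.coe_sub, map_sub, map_sub]
    rw [key, sub_eq_zero]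
    exact h1
  have hcard := Fintype.card_le_of_injective _ hinj
  rw [← Nat.card_eq_fintype_card, card_degLE, Fintype.card_fun, Fintype.card_coe] at hcard
  have hle : e * (m + 1) ≤ O.card := (Nat.pow_le_pow_iff_right Fintype.one_lt_card).mp hcard
  obtain ⟨emb⟩ : Nonempty (Fin (e * (m + 1)) ↪ O) := by
    apply Function.Embedding.nonempty_of_card_le
    simpa using hle
  have hex : ∀ o : O, ∃ v : degLE w m, v ≠ 0 ∧ (ι v.1).order = o.1 := by
    intro o
    obtain ⟨v, hv, hv'⟩ := Finset.mem_image.mp o.2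
    exact ⟨v, by simpa using hv, hv'⟩
  choose v hv0 hv using hex
  refine ⟨fun i => (v (emb i)).1, fun i => (v (emb i)).2, fun i => ?_, fun i j hij => ?_⟩
  · simpa using hv0 (emb i)
  · simp only [hv] at hij
    exact emb.injective (Subtype.ext hij)

theorem stepanov_bound [IsDomain A] (w : Module.Basis (Fin e) k[X] A)
    (ι : A →ₐ[k[X]] PowerSeries k) (hι : Function.Injective ι) (g g' : A →ₐ[k[X]] A)
    (hg : ∀ f, g' (g f) = f) :
    ∃ C : ℕ, ∀ μ : ℕ, ∀ D : k[X], D.natDegree ≤ Fintype.card k ^ (2 * μ) →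
      (∀ f, algebraMap k[X] A D ∣ f ^ (Fintype.card k ^ (2 * μ)) - g f) →
      D.natDegree * e ≤ Fintype.card k ^ (2 * μ) + C * Fintype.card k ^ μ := by
  obtain ⟨c₁, hc₁⟩ := exists_mul_mem_degLE w
  obtain ⟨c₂, hc₂⟩ := exists_natDegree_norm_le w
  obtain ⟨c₃, hc₃⟩ := exists_linearMap_mem_degLE w g.toLinearMap
  obtain ⟨c, h1, h2, h3⟩ : ∃ c, c₁ ≤ c ∧ c₂ ≤ c ∧ c₃ ≤ c :=
    ⟨c₁ + c₂ + c₃, by omega, by omega, by omega⟩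
  replace hc₁ : ∀ N N', ∀ f ∈ degLE w N, ∀ f' ∈ degLE w N', f * f' ∈ degLE w (N + N' + c) :=
    fun N N' f hf f' hf' => degLE_mono w (by omega) (hc₁ N N' f hf f' hf')
  replace hc₂ : ∀ N, ∀ f ∈ degLE w N, (Algebra.norm k[X] f).natDegree ≤ e * (N + c) :=
    fun N f hf => (hc₂ N f hf).trans (Nat.mul_le_mul_left _ (by omega))
  replace hc₃ : ∀ N, ∀ f ∈ degLE w N, g f ∈ degLE w (N + c) :=
    fun N f hf => degLE_mono w (by omega) (hc₃ N f hf)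
  have he : 0 < e := by
    rcases Nat.eq_zero_or_pos e with rfl | h
    · have := w.index_nonempty
      exact (IsEmpty.false this.some).elim
    · exact h
  set K := 2 * c + 5 with hK
  refine ⟨1 + e * K + 2 * e * c + e * e * K, fun μ D hDQ hD => ?_⟩
  set R := Fintype.card k ^ μ with hR
  have hQ : Fintype.card k ^ (2 * μ) = R * R := by rw [hR, ← pow_add, two_mul]
  have hRpos : 0 < R := pow_pos Fintype.card_pos _
  rw [hQ] at hDQ hD ⊢
  obtain ⟨t, ht1, ht2⟩ : ∃ t, e * t < R ∧ R ≤ e * (t + 1) := by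
    refine ⟨(R - 1) / e, ?_, ?_⟩
    · have := Nat.mul_div_le (R - 1) e
      omega
    · have := Nat.lt_mul_div_succ (R - 1) he
      omega
  rcases lt_or_ge t K with htK | htK
  · have : R ≤ e * K := ht2.trans (Nat.mul_le_mul_left _ htK)
    calc D.natDegree * e ≤ R * R * e := Nat.mul_le_mul_right _ hDQ
      _ ≤ R * (e * K) * e := by gcongr
      _ ≤ R * R + (1 + e * K + 2 * e * c + e * e * K) * R := by
          nlinarith [Nat.zero_le (R * R), Nat.zero_le (e * K * R), Nat.zero_le (e * c * R)]
  obtain ⟨l, rfl⟩ : ∃ l, t = l + c := ⟨t - c, by omega⟩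
  have hl : l + c + 1 ≤ 2 * (l + 1) := by omega
  set m := l + c + K with hm
  obtain ⟨f, hf, hf0, hford⟩ := exists_distinct_orders w ι hι m
  obtain ⟨Fr, hFr⟩ := exists_frobenius_ringHom
    ((algebraMap k[X] A).comp (C : k →+* k[X])) μ
  rw [← hR] at hFr
  set N := R * (l + c) + (m + c) + c with hN
  let Θ : (Fin (e * (m + 1)) → degLE w l) → degLE w N := fun s =>
    ⟨∑ i, (s i).1 ^ R * g (f i), AddSubgroup.sum_mem _ fun i _ =>
      hc₁ _ _ _ (pow_mem_degLE w hc₁ (s i).2 hRpos.ne') _ (hc₃ _ _ (hf i))⟩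
  have := finite_degLE w l
  have := finite_degLE w N
  have := Fintype.ofFinite (degLE w l)
  have := Fintype.ofFinite (degLE w N)
  have hcards : Fintype.card (degLE w N) < Fintype.card (Fin (e * (m + 1)) → degLE w l) := by
    rw [Fintype.card_fun, ← Nat.card_eq_fintype_card (α := degLE w N),
      ← Nat.card_eq_fintype_card (α := degLE w l), card_degLE, card_degLE, ← pow_mul,
      Fintype.card_fin]
    apply Nat.pow_lt_pow_right Fintype.one_lt_card
    rw [mul_assoc]
    apply Nat.mul_lt_mul_of_pos_left _ he
    have e1 : R * c ≤ 2 * (l + 1) * e * c := by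
      calc R * c ≤ e * (l + c + 1) * c := by gcongr
        _ ≤ e * (2 * (l + 1)) * c := by gcongr
        _ = _ := by ring
    have e2 : K < R := by
      calc K ≤ l + c := htK
        _ ≤ e * (l + c) := Nat.le_mul_of_pos_left _ he
        _ < R := ht1
    have e3 : (l + 1) * R + (l + 1) * (e * K) ≤ (l + 1) * (e * (m + 1)) := by
      rw [← mul_add]
      apply Nat.mul_le_mul_left
      calc R + e * K ≤ e * (l + c + 1) + e * K := by gcongr
        _ = e * (m + 1) := by rw [hm]; ring
    have e4 : (l + 1) * 5 ≤ (l + 1) * e * 5 := by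
      apply Nat.mul_le_mul_right
      exact Nat.le_mul_of_pos_right _ he
    have e5 : (l + 1) * (e * K) = 2 * (l + 1) * e * c + (l + 1) * e * 5 := by rw [hK]; ring
    have e6 : N = R * l + R * c + l + 3 * c + K := by rw [hN, hm]; ring
    have e7 : (l + 1) * R = R * l + R := by ring
    omega
  obtain ⟨s₁, s₂, hne, heq⟩ := Fintype.exists_ne_map_eq_of_card_lt Θ hcards
  set s : Fin (e * (m + 1)) → degLE w l := s₁ - s₂ with hs
  have hs0 : ∃ i, (s i).1 ≠ 0 := by
    by_contra! hcon
    apply hne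
    funext i
    have := hcon i
    rw [hs, Pi.sub_apply, AddSubgroup.coe_sub, sub_eq_zero] at this
    exact Subtype.ext this
  have hker : ∑ i, (s i).1 ^ R * g (f i) = 0 := by
    have h4 := congrArg Subtype.val heq
    simp only [Θ] at h4
    rw [← sub_eq_zero, ← Finset.sum_sub_distrib] at h4
    rw [← h4]
    refine Finset.sum_congr rfl fun i _ => ?_
    rw [hs, Pi.sub_apply, AddSubgroup.coe_sub, ← hFr, map_sub, hFr, hFr, sub_mul]
  set h0 := ∑ i, (s i).1 * f i ^ R with hh0
  have hh0ne : h0 ≠ 0 := by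
    intro hz
    have hz' : ∑ i, ι (s i).1 * ι (f i) ^ R = 0 := by
      rw [← map_zero ι, ← hz, hh0, map_sum]
      simp
    refine sum_mul_pow_ne_zero (fun i => ι (f i)) (fun i => ι (s i).1)
      (fun i => (map_ne_zero_iff ι hι).mpr (hf0 i)) hford (fun i hi => ?_) ?_ hz'
    · have hi' : (s i).1 ≠ 0 := (map_ne_zero_iff ι hι).mp hi
      refine (order_le_natDegree_norm w ι hi').trans_lt ?_
      exact_mod_cast (hc₂ _ _ (s i).2).trans_lt ht1
    · obtain ⟨i, hi⟩ := hs0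
      exact ⟨i, (map_ne_zero_iff ι hι).mpr hi⟩
  have hdvdpow : algebraMap k[X] A D ∣ h0 ^ R := by
    have h5 : h0 ^ R = ∑ i, (s i).1 ^ R * (f i ^ (R * R) - g (f i)) := by
      simp only [mul_sub]
      rw [Finset.sum_sub_distrib, hker, sub_zero, ← hFr, hh0, map_sum]
      refine Finset.sum_congr rfl fun i _ => ?_
      rw [map_mul, hFr, hFr, ← pow_mul]
    rw [h5]
    exact Finset.dvd_sum fun i _ => Dvd.dvd.mul_left (hD _) _
  have hdvdg : algebraMap k[X] A D ∣ g h0 := by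
    have h6 : algebraMap k[X] A D ∣ h0 ^ (R * R) := by
      rw [pow_mul]
      exact dvd_pow hdvdpow hRpos.ne'
    have h7 := dvd_sub h6 (hD h0)
    simpa using h7
  have hdvd : algebraMap k[X] A D ∣ h0 := by
    have h8 := map_dvd g' hdvdg
    rwa [hg, AlgHom.commutes] at h8
  have hdeg : h0 ∈ degLE w (l + R * (m + c) + c) :=
    AddSubgroup.sum_mem _ fun i _ => hc₁ _ _ _ (s i).2 _ (pow_mem_degLE w hc₁ (hf i) hRpos.ne')
  have hfin := natDegree_le_of_algebraMap_dvd w hh0ne hdeg hdvd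
  have e1 : e * l ≤ R := by
    have : e * l ≤ e * (l + c) := Nat.mul_le_mul_left _ (by omega)
    omega
  have e2 : R * (e * (l + c)) ≤ R * R := Nat.mul_le_mul_left _ ht1.le
  have e3 : e * c ≤ e * c * R := Nat.le_mul_of_pos_right _ hRpos
  calc D.natDegree * e ≤ (l + R * (m + c) + c) * e := Nat.mul_le_mul_right _ hfin
    _ = e * l + R * (e * (l + c)) + R * (e * K) + e * c * R + e * c := by rw [hm]; ring
    _ ≤ R + R * R + R * (e * K) + e * c * R + e * c * R := by omega
    _ ≤ R * R + (1 + e * K + 2 * e * c + e * e * K) * R := by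
      nlinarith [Nat.zero_le (e * e * K * R)]

end Stepanov

section PowerSeriesLemmas

theorem PowerSeries.pow_card_eq_expand {k : Type*} [Field k] [Fintype k] (f : PowerSeries k) :
    f ^ Fintype.card k = PowerSeries.expand (Fintype.card k) Fintype.card_ne_zero f := by
  obtain ⟨p, hp⟩ := CharP.exists k
  obtain ⟨n, hprime, hn⟩ := FiniteField.card k p
  have : Fact p.Prime := ⟨hprime⟩
  have h := MvPowerSeries.map_iterateFrobenius_expand p hprime.ne_zero (σ := Unit) f n
  have hid : iterateFrobenius k p n = RingHom.id k := by
    ext x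
    rw [iterateFrobenius_def, ← hn, FiniteField.pow_card, RingHom.id_apply]
  rw [hid] at h
  have h' : (MvPowerSeries.expand (p ^ (n : ℕ)) (pow_ne_zero _ hprime.ne_zero)) f
      = f ^ p ^ (n : ℕ) := by
    rw [← h, MvPowerSeries.map_id]; rfl
  simp only [hn]
  exact h'.symm

/-- Coefficients of the solution `y` of `y(X ^ q) = U * y` with constant coefficient one. -/
noncomputable def expandSolCoeff {R : Type*} [CommRing R] (U : PowerSeries R) (q : ℕ) : ℕ → R
  | n => if _hn : n = 0 ∨ q ≤ 1 then 1 else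
      (if q ∣ n then expandSolCoeff U q (n / q) else 0) -
        ∑ j : Fin n, PowerSeries.coeff (n - j) U * expandSolCoeff U q j
termination_by n => n
decreasing_by
  · exact Nat.div_lt_self (by omega) (by omega)
  · exact j.2

theorem exists_expand_eq_mul {R : Type*} [CommRing R] (U : PowerSeries R) {q : ℕ} (hq : 1 < q)
    (hU : PowerSeries.constantCoeff U = 1) :
    ∃ y : PowerSeries R, PowerSeries.constantCoeff y = 1 ∧
      PowerSeries.expand q (by omega) y = U * y := by
  have h0 : expandSolCoeff U q 0 = 1 := by
    rw [expandSolCoeff]; simp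
  refine ⟨PowerSeries.mk (expandSolCoeff U q), by simpa using h0, ?_⟩
  ext n
  rw [PowerSeries.coeff_expand, PowerSeries.coeff_mk, PowerSeries.coeff_mul,
    Finset.Nat.sum_antidiagonal_eq_sum_range_succ_mk, ← Finset.sum_range_reflect]
  simp only [PowerSeries.coeff_mk, Nat.succ_sub_one]
  rw [Finset.sum_range_succ, Nat.sub_self, Nat.sub_zero]
  rcases Nat.eq_zero_or_pos n with rfl | hn
  · simp [h0, hU]
  have hsol : expandSolCoeff U q n = (if q ∣ n then expandSolCoeff U q (n / q) else 0) -
        ∑ j : Fin n, PowerSeries.coeff (n - j) U * expandSolCoeff U q j := by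
    conv_lhs => rw [expandSolCoeff]
    rw [dif_neg (by omega)]
  rw [Finset.sum_fin_eq_sum_range] at hsol
  have hs : ∀ j ∈ Finset.range n, (if h : j < n then PowerSeries.coeff (n - (⟨j, h⟩ : Fin n).1) U *
      expandSolCoeff U q (⟨j, h⟩ : Fin n).1 else 0) =
      PowerSeries.coeff (n - j) U * expandSolCoeff U q (n - (n - j)) := by
    intro j hj
    have hj' : j < n := Finset.mem_range.mp hj
    rw [dif_pos hj', Nat.sub_sub_self hj'.le]
  rw [Finset.sum_congr rfl hs] at hsol
  rw [PowerSeries.coeff_zero_eq_constantCoeff_apply, hU, one_mul, hsol]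
  ring

variable {k : Type*} [Field k] {E : Type*} [CommRing E] [Algebra k E]

/-- Applying a linear functional to the coefficients of a power series. -/
noncomputable def coeffFunctional (l : Module.Dual k E) : PowerSeries E →+ PowerSeries k where
  toFun f := PowerSeries.mk fun n => l (PowerSeries.coeff n f)
  map_zero' := by ext; simp
  map_add' f g := by ext; simp

theorem coeff_coeffFunctional (l : Module.Dual k E) (f : PowerSeries E) (n : ℕ) :
    PowerSeries.coeff n (coeffFunctional l f) = l (PowerSeries.coeff n f) := by
  simp [coeffFunctional]

theorem coeffFunctional_map_mul (l : Module.Dual k E) (D : PowerSeries k) (f : PowerSeries E) :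
    coeffFunctional l (PowerSeries.map (algebraMap k E) D * f) = D * coeffFunctional l f := by
  ext n
  rw [coeff_coeffFunctional, PowerSeries.coeff_mul, PowerSeries.coeff_mul, map_sum]
  refine Finset.sum_congr rfl fun x _ => ?_
  rw [PowerSeries.coeff_map, ← Algebra.smul_def, map_smul, coeff_coeffFunctional, smul_eq_mul]

theorem coeffFunctional_C_mul (l : Module.Dual k E) (a : E) (f : PowerSeries E) :
    coeffFunctional l (PowerSeries.C a * f) =
      coeffFunctional (l ∘ₗ LinearMap.mulLeft k a) f := by
  ext n
  rw [coeff_coeffFunctional, coeff_coeffFunctional, PowerSeries.coeff_C_mul]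
  rfl

theorem coeffFunctional_expand (l : Module.Dual k E) {q : ℕ} (hq : q ≠ 0) (f : PowerSeries E) :
    coeffFunctional l (PowerSeries.expand q hq f) =
      PowerSeries.expand q hq (coeffFunctional l f) := by
  ext n
  rw [coeff_coeffFunctional, PowerSeries.coeff_expand, PowerSeries.coeff_expand]
  split_ifs
  · rw [coeff_coeffFunctional]
  · simp

theorem coeffFunctional_poly_mul_mem_span (l : Module.Dual k E) (P : E[X]) (y : PowerSeries E) :
    coeffFunctional l ((P : PowerSeries E) * y) ∈
      Submodule.span k[X] (Set.range fun l : Module.Dual k E => coeffFunctional l y) := by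
  induction P using Polynomial.induction_on' with
  | add p q hp hq =>
    rw [Polynomial.coe_add, add_mul, map_add]
    exact Submodule.add_mem _ hp hq
  | monomial n a =>
    have h1 : ((monomial n a : E[X]) : PowerSeries E) * y =
        PowerSeries.map (algebraMap k E) (((X : k[X]) ^ n : k[X]) : PowerSeries k) *
          (PowerSeries.C a * y) := by
      rw [← mul_assoc, ← C_mul_X_pow_eq_monomial, Polynomial.coe_mul, Polynomial.coe_C,
        Polynomial.coe_pow, Polynomial.coe_X, Polynomial.coe_pow, Polynomial.coe_X, map_pow,
        PowerSeries.map_X, mul_comm (PowerSeries.C a)]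
    rw [h1, coeffFunctional_map_mul, coeffFunctional_C_mul]
    have h2 := Submodule.smul_mem (Submodule.span k[X]
      (Set.range fun l : Module.Dual k E => coeffFunctional l y)) ((X : k[X]) ^ n)
      (Submodule.subset_span ⟨l ∘ₗ LinearMap.mulLeft k a, rfl⟩)
    rwa [Algebra.smul_def] at h2

/-- An element all of whose iterated `q`-th powers lie in a Noetherian submodule is integral. -/
theorem isIntegral_of_pow_mem {R A : Type*} [CommRing R] [Nontrivial R] [IsNoetherianRing R]
    [CommRing A] [Algebra R A]
    (M : Submodule R A) (hM : M.FG) {q : ℕ} (hq : 1 < q) {x : A}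
    (h : ∀ j, x ^ q ^ j ∈ M) : IsIntegral R x := by
  have : IsNoetherian R M := isNoetherian_of_fg_of_noetherian M hM
  let N : ℕ →o Submodule R M :=
    ⟨fun m => Submodule.span R (Set.range fun j : Fin m => (⟨x ^ q ^ (j : ℕ), h j⟩ : M)), by
      intro a b hab
      apply Submodule.span_mono
      rintro _ ⟨j, rfl⟩
      exact ⟨⟨j.1, j.2.trans_le hab⟩, rfl⟩⟩
  obtain ⟨n, hn⟩ := monotone_stabilizes_iff_noetherian.mpr this N
  have h1 : (⟨x ^ q ^ n, h n⟩ : M) ∈ N (n + 1) :=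
    Submodule.subset_span ⟨⟨n, Nat.lt_succ_self n⟩, rfl⟩
  rw [← hn (n + 1) (Nat.le_succ n)] at h1
  obtain ⟨c, hc⟩ := (Submodule.mem_span_range_iff_exists_fun R).mp h1
  have hc' := congrArg Subtype.val hc
  simp only [Submodule.coe_sum, Submodule.coe_smul] at hc'
  refine ⟨X ^ q ^ n - ∑ j : Fin n, C (c j) * X ^ q ^ (j : ℕ), ?_, ?_⟩
  · apply (monic_X_pow _).sub_of_left
    rw [degree_X_pow]
    refine (degree_sum_le _ _).trans_lt ?_
    rw [Finset.sup_lt_iff]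
    · intro j _
      refine (degree_C_mul_X_pow_le _ _).trans_lt ?_
      exact_mod_cast Nat.pow_lt_pow_right hq j.2
    · exact WithBot.bot_lt_coe _
  · rw [eval₂_sub, eval₂_X_pow, eval₂_finsetSum, sub_eq_zero, ← hc']
    refine Finset.sum_congr rfl fun j _ => ?_
    rw [eval₂_mul, eval₂_C, eval₂_X_pow, Algebra.smul_def]

end PowerSeriesLemmas

section StepanovGroup

theorem pow_card_pow_eq_comp {k : Type*} [Field k] [Fintype k] (c : k[X]) (m : ℕ) :
    c ^ Fintype.card k ^ m = c.comp (X ^ Fintype.card k ^ m) := by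
  induction m with
  | zero => simp
  | succ m ih =>
    rw [pow_succ, pow_mul, ih, ← FiniteField.expand_card, expand_eq_comp_X_pow, comp_assoc]
    congr 1
    simp [← pow_mul, mul_comm]

theorem X_pow_card_pow_sub_X_dvd {k : Type*} [Field k] [Fintype k] (c : k[X]) (m : ℕ) :
    X ^ Fintype.card k ^ m - X ∣ c ^ Fintype.card k ^ m - c := by
  have h := sub_dvd_eval_sub (X ^ Fintype.card k ^ m : k[X]) X (c.map C)
  rwa [eval_map, eval_map, ← comp, ← comp, comp_X, ← pow_card_pow_eq_comp] at h

variable {k : Type*} [Field k] {A : Type*} [CommRing A] [Algebra k[X] A]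
  {G : Type*} [CommGroup G] {Λ : Type*} [MulAction G Λ]

/-- The group elements whose action on the generators `y` extends to an algebra endomorphism. -/
def extendSubgroup [Finite G] (y : Λ → A) : Subgroup G where
  carrier := {g | ∃ σ : A →ₐ[k[X]] A, ∀ l, σ (y l) = y (g • l)}
  one_mem' := ⟨AlgHom.id _ _, by simp⟩
  mul_mem' := by
    rintro g g' ⟨σ, hσ⟩ ⟨σ', hσ'⟩
    refine ⟨σ.comp σ', fun l => ?_⟩
    rw [AlgHom.comp_apply, hσ', hσ, mul_smul]
  inv_mem' := by
    rintro g ⟨σ, hσ⟩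
    have hpow : ∀ n : ℕ, ∃ σ : A →ₐ[k[X]] A, ∀ l, σ (y l) = y (g ^ n • l) := by
      intro n
      induction n with
      | zero => exact ⟨AlgHom.id _ _, by simp⟩
      | succ n ih =>
        obtain ⟨τ, hτ⟩ := ih
        refine ⟨σ.comp τ, fun l => ?_⟩
        rw [AlgHom.comp_apply, hτ, hσ, ← mul_smul, pow_succ']
    obtain ⟨n, hn⟩ := (mem_powers_iff_mem_zpowers (x := g) (y := g⁻¹)).mpr
      (Subgroup.inv_mem _ (Subgroup.mem_zpowers g))
    simp only at hn
    rw [← hn]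
    exact hpow n

theorem mem_extendSubgroup [Finite G] {y : Λ → A} {g : G} :
    g ∈ extendSubgroup (k := k) (G := G) y ↔ ∃ σ : A →ₐ[k[X]] A, ∀ l, σ (y l) = y (g • l) :=
  Iff.rfl

theorem exists_of_notMem_extendSubgroup [Finite G] {y : Λ → A}
    (hy : Function.Surjective (MvPolynomial.aeval (R := k[X]) y)) {g : G}
    (hg : g ∉ extendSubgroup (k := k) y) :
    ∃ p : MvPolynomial Λ k[X], MvPolynomial.aeval y p = 0 ∧
      MvPolynomial.aeval (fun l => y (g • l)) p ≠ 0 := by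
  by_contra! hcon
  apply hg
  let e := Ideal.quotientKerAlgEquivOfSurjective hy
  let σ := Ideal.Quotient.liftₐ (RingHom.ker (MvPolynomial.aeval (R := k[X]) y))
    (MvPolynomial.aeval (R := k[X]) fun l => y (g • l)) fun a ha => hcon a ha
  refine ⟨σ.comp e.symm.toAlgHom, fun l => ?_⟩
  have h1 : e (Ideal.Quotient.mk _ (MvPolynomial.X l)) = y l := by
    have : e (Ideal.Quotient.mk _ (MvPolynomial.X l)) =
      MvPolynomial.aeval (R := k[X]) y (MvPolynomial.X l) := rfl
    rw [this, MvPolynomial.aeval_X]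
  have h2 : e.symm (y l) = Ideal.Quotient.mk _ (MvPolynomial.X l) := by
    rw [← h1, AlgEquiv.symm_apply_apply]
  have h3 : (σ.comp e.symm.toAlgHom) (y l) = σ (e.symm (y l)) := rfl
  rw [h3, h2]
  have h4 : σ (Ideal.Quotient.mk _ (MvPolynomial.X l)) =
    MvPolynomial.aeval (R := k[X]) (fun l => y (g • l)) (MvPolynomial.X l) := rfl
  rw [h4, MvPolynomial.aeval_X]

theorem natDegree_le_of_dvd_X_pow_sub_X {D : k[X]} {Q : ℕ} (hQ : 1 < Q)
    (hD : D ∣ X ^ Q - X) : D.natDegree ≤ Q := by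
  refine (natDegree_le_of_dvd hD (FiniteField.X_pow_card_sub_X_ne_zero k hQ)).trans ?_
  rw [FiniteField.X_pow_card_sub_X_natDegree_eq k hQ]

variable [Fintype k]

theorem dvd_aeval_pow_sub (y z : Λ → A) {D : k[X]} {m : ℕ}
    (hD : D ∣ X ^ Fintype.card k ^ m - X)
    (h : ∀ l, algebraMap k[X] A D ∣ y l ^ Fintype.card k ^ m - z l) (p : MvPolynomial Λ k[X]) :
    algebraMap k[X] A D ∣
      MvPolynomial.aeval y p ^ Fintype.card k ^ m - MvPolynomial.aeval z p := by
  obtain ⟨Fr, hFr⟩ := exists_frobenius_ringHom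
    ((algebraMap k[X] A).comp (C : k →+* k[X])) m
  rw [← hFr]
  simp only [← hFr] at h
  induction p using MvPolynomial.induction_on with
  | C a =>
    rw [MvPolynomial.aeval_C, MvPolynomial.aeval_C, hFr, ← map_pow, ← map_sub]
    exact map_dvd _ (hD.trans (X_pow_card_pow_sub_X_dvd a m))
  | add p q hp hq =>
    have : Fr (MvPolynomial.aeval y (p + q)) - MvPolynomial.aeval z (p + q) =
      (Fr (MvPolynomial.aeval y p) - MvPolynomial.aeval z p) +
      (Fr (MvPolynomial.aeval y q) - MvPolynomial.aeval z q) := by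
      simp only [map_add]; ring
    rw [this]
    exact dvd_add hp hq
  | mul_X p l hp =>
    have : Fr (MvPolynomial.aeval y (p * MvPolynomial.X l)) -
        MvPolynomial.aeval z (p * MvPolynomial.X l) =
      (Fr (MvPolynomial.aeval y p) - MvPolynomial.aeval z p) * Fr (y l) +
      MvPolynomial.aeval z p * (Fr (y l) - z l) := by
      simp only [map_mul, MvPolynomial.aeval_X]; ring
    rw [this]
    exact dvd_add (Dvd.dvd.mul_right hp _) (Dvd.dvd.mul_left (h l) _)

theorem stepanov_group_bound [Finite G] [IsDomain A] [Module.Free k[X] A] [Module.Finite k[X] A]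
    (ι : A →ₐ[k[X]] PowerSeries k) (hι : Function.Injective ι) (y : Λ → A)
    (hy : Function.Surjective (MvPolynomial.aeval (R := k[X]) y))
    (hfaith : ∀ g g' : G, (∀ l, y (g • l) = y (g' • l)) → g = g') :
    ∃ (H : Subgroup G) (C : ℕ), ∀ μ : ℕ, 0 < μ → ∀ D : k[X],
      D ∣ X ^ Fintype.card k ^ (2 * μ) - X → ∀ g : G,
      (∀ l, algebraMap k[X] A D ∣ y l ^ Fintype.card k ^ (2 * μ) - y (g • l)) →
      (g ∈ H → D.natDegree * Nat.card H ≤ Fintype.card k ^ (2 * μ) + C * Fintype.card k ^ μ) ∧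
      (g ∉ H → D.natDegree ≤ C) := by
  classical
  have := Fintype.ofFinite G
  set H := extendSubgroup (k := k) (G := G) y with hH
  have w := Module.finBasis k[X] A
  have hcard : Nat.card H ≤ Module.finrank k[X] A := by
    refine le_trans ?_ (card_algHom_le_finrank k[X] A A)
    choose σ hσ using fun g : H => mem_extendSubgroup.mp g.2
    refine Nat.card_le_card_of_injective σ fun g g' hgg => ?_
    refine Subtype.ext (hfaith _ _ fun l => ?_)
    rw [← hσ, ← hσ, hgg]
  have hex : ∀ g : G, ∃ C : ℕ, ∀ μ : ℕ, 0 < μ → ∀ D : k[X],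
      D ∣ X ^ Fintype.card k ^ (2 * μ) - X →
      (∀ l, algebraMap k[X] A D ∣ y l ^ Fintype.card k ^ (2 * μ) - y (g • l)) →
      (g ∈ H → D.natDegree * Nat.card H ≤ Fintype.card k ^ (2 * μ) + C * Fintype.card k ^ μ) ∧
      (g ∉ H → D.natDegree ≤ C) := by
    intro g
    by_cases hg : g ∈ H
    · obtain ⟨σ, hσ⟩ := mem_extendSubgroup.mp hg
      obtain ⟨σ', hσ'⟩ := mem_extendSubgroup.mp (H.inv_mem hg)
      have hσp : ∀ p : MvPolynomial Λ k[X], σ (MvPolynomial.aeval y p) =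
          MvPolynomial.aeval (fun l => y (g • l)) p := by
        intro p
        rw [← AlgHom.comp_apply, MvPolynomial.comp_aeval]
        simp only [hσ]
      have hinv : ∀ f, σ' (σ f) = f := by
        intro f
        obtain ⟨p, rfl⟩ := hy f
        rw [hσp, ← AlgHom.comp_apply, MvPolynomial.comp_aeval]
        simp only [hσ', inv_smul_smul]
      obtain ⟨C, hC⟩ := stepanov_bound w ι hι σ σ' hinv
      refine ⟨C, fun μ hμ D hD hl => ⟨fun _ => ?_, fun h => absurd hg h⟩⟩
      refine (Nat.mul_le_mul_left _ hcard).trans (hC μ D ?_ ?_)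
      · exact natDegree_le_of_dvd_X_pow_sub_X
          (Nat.one_lt_pow (by omega) Fintype.one_lt_card) hD
      · intro f
        obtain ⟨p, rfl⟩ := hy f
        rw [hσp]
        exact dvd_aeval_pow_sub y _ hD hl p
    · obtain ⟨p, hp1, hp2⟩ := exists_of_notMem_extendSubgroup hy hg
      obtain ⟨N, hN⟩ := exists_mem_degLE w
        fun _ : Unit => MvPolynomial.aeval (R := k[X]) (fun l => y (g • l)) p
      refine ⟨N, fun μ hμ D hD hl => ⟨fun h => absurd h hg, fun _ => ?_⟩⟩
      refine natDegree_le_of_algebraMap_dvd w hp2 (hN ()) ?_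
      have h1 := dvd_aeval_pow_sub y _ hD hl p
      rw [hp1, zero_pow (pow_pos Fintype.card_pos _).ne', zero_sub, dvd_neg] at h1
      exact h1
  choose C hC using hex
  refine ⟨H, ∑ g, C g, fun μ hμ D hD g hg => ?_⟩
  have hle : C g ≤ ∑ g, C g := Finset.single_le_sum (fun _ _ => Nat.zero_le _) (Finset.mem_univ g)
  obtain ⟨h1, h2⟩ := hC g μ hμ D hD hg
  exact ⟨fun h => (h1 h).trans (Nat.add_le_add_left (Nat.mul_le_mul_right _ hle) _),
    fun h => (h2 h).trans hle⟩

end StepanovGroup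

section StepanovProduct

theorem Polynomial.coe_expand_eq {R : Type*} [CommRing R] (U : R[X]) {q : ℕ} (hq : q ≠ 0) :
    ((expand R q U : R[X]) : PowerSeries R) = PowerSeries.expand q hq (U : PowerSeries R) := by
  ext n
  rw [Polynomial.coeff_coe, coeff_expand (Nat.pos_of_ne_zero hq), PowerSeries.coeff_expand,
    Polynomial.coeff_coe]

theorem expand_pow_eq_prod_mul {R : Type*} [CommRing R] (U : R[X]) {q : ℕ} (hq : q ≠ 0)
    {y : PowerSeries R} (hy : PowerSeries.expand q hq y = (U : PowerSeries R) * y) (m : ℕ) :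
    PowerSeries.expand (q ^ m) (pow_ne_zero m hq) y =
      ((∏ l ∈ Finset.range m, expand R (q ^ l) U : R[X]) : PowerSeries R) * y := by
  induction m with
  | zero => simp
  | succ m ih =>
    have h : PowerSeries.expand (q ^ (m + 1)) (pow_ne_zero (m + 1) hq) y =
        PowerSeries.expand (q ^ m) (pow_ne_zero m hq) (PowerSeries.expand q hq y) := by
      rw [← PowerSeries.expand_mul]
      simp only [pow_succ]
    rw [h, hy, map_mul, ih, Finset.prod_range_succ, Polynomial.coe_mul,
      ← Polynomial.coe_expand_eq]
    ring

variable {k : Type*} [Field k] [Fintype k]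

theorem PowerSeries.pow_card_pow_eq_expand (f : PowerSeries k) (m : ℕ) :
    f ^ Fintype.card k ^ m =
      PowerSeries.expand (Fintype.card k ^ m) (pow_ne_zero m Fintype.card_ne_zero) f := by
  induction m with
  | zero => simp
  | succ m ih =>
    have h : PowerSeries.expand (Fintype.card k ^ (m + 1))
        (pow_ne_zero (m + 1) Fintype.card_ne_zero) f =
        PowerSeries.expand (Fintype.card k ^ m) (pow_ne_zero m Fintype.card_ne_zero)
          (PowerSeries.expand (Fintype.card k) Fintype.card_ne_zero f) := by
      rw [← PowerSeries.expand_mul]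
      simp only [pow_succ]
    rw [h, ← PowerSeries.pow_card_eq_expand, map_pow, ← ih, ← pow_mul, pow_succ]

theorem exists_subgroup_natDegree_bound {E : Type*} [CommRing E] [Algebra k E] [Finite E]
    (U : E[X]) (hU : U.coeff 0 = 1) :
    ∃ (H : Subgroup Eˣ) (c : ℕ), ∀ μ : ℕ, 0 < μ → ∀ D : k[X],
      D ∣ X ^ Fintype.card k ^ (2 * μ) - X → ∀ g : Eˣ,
      (D.map (algebraMap k E) ∣
        ∏ l ∈ Finset.range (2 * μ), expand E (Fintype.card k ^ l) U - C (g : E)) →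
      (g ∈ H → D.natDegree * Nat.card H ≤ Fintype.card k ^ (2 * μ) + c * Fintype.card k ^ μ) ∧
      (g ∉ H → D.natDegree ≤ c) := by
  classical
  have hfin : Module.Finite k E := Module.Finite.of_finite
  obtain ⟨y, hy1, hy⟩ := exists_expand_eq_mul (U : PowerSeries E)
    (q := Fintype.card k) Fintype.one_lt_card (by
      rw [← PowerSeries.coeff_zero_eq_constantCoeff_apply, Polynomial.coeff_coe, hU])
  let Y : Module.Dual k E → PowerSeries k := fun l => coeffFunctional l y
  have hdual : Finite (Module.Dual k E) :=
    Finite.of_injective (fun l : Module.Dual k E => (l : E → k)) DFunLike.coe_injective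
  set M := Submodule.span k[X] (Set.range Y) with hM
  have hMfg : M.FG := Submodule.fg_span (Set.finite_range Y)
  have hMpow : ∀ x ∈ M, x ^ Fintype.card k ∈ M := by
    intro x hx
    induction hx using Submodule.span_induction with
    | mem x hx =>
      obtain ⟨l, rfl⟩ := hx
      rw [PowerSeries.pow_card_eq_expand, ← coeffFunctional_expand, hy]
      exact coeffFunctional_poly_mul_mem_span l U y
    | zero => rw [zero_pow Fintype.card_ne_zero]; exact M.zero_mem
    | add x x' _ _ h h' =>
      rw [PowerSeries.pow_card_eq_expand] at h h' ⊢
      rw [map_add]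
      exact M.add_mem h h'
    | smul p x _ h =>
      rw [_root_.smul_pow]
      exact M.smul_mem _ h
  have hYint : ∀ x ∈ Set.range Y, IsIntegral k[X] x := by
    intro x hx
    refine isIntegral_of_pow_mem M hMfg Fintype.one_lt_card (q := Fintype.card k) fun j => ?_
    induction j with
    | zero => simpa using Submodule.subset_span hx
    | succ j ih => rw [pow_succ, pow_mul]; exact hMpow _ ih
  set A := Algebra.adjoin k[X] (Set.range Y) with hA
  have hAfin : Module.Finite k[X] A :=
    Module.Finite.iff_fg.mpr (fg_adjoin_of_finite (Set.finite_range Y) hYint)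
  have htf : Module.IsTorsionFree k[X] A := by
    have hinj : Function.Injective (algebraMap k[X] A) := by
      intro p p' h
      exact Polynomial.coe_injective k (congrArg Subtype.val h)
    have := (faithfulSMul_iff_algebraMap_injective k[X] A).mpr hinj
    infer_instance
  have hfree : Module.Free k[X] A := Module.free_of_finite_type_torsion_free'
  let y' : Module.Dual k E → A := fun l => ⟨Y l, Algebra.subset_adjoin ⟨l, rfl⟩⟩
  let act : MulAction Eˣ (Module.Dual k E) :=
    { smul := fun g l => l ∘ₗ LinearMap.mulLeft k (g : E)
      one_smul := fun l => by
        apply LinearMap.ext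
        intro a
        exact congrArg l (one_mul a)
      mul_smul := fun g g' l => by
        apply LinearMap.ext
        intro a
        refine congrArg l ?_
        change ((g * g' : Eˣ) : E) * a = (g' : E) * ((g : E) * a)
        rw [Units.val_mul]
        ring }
  have hact : ∀ (g : Eˣ) (l : Module.Dual k E), g • l = l ∘ₗ LinearMap.mulLeft k (g : E) :=
    fun _ _ => rfl
  have hsurj : Function.Surjective (MvPolynomial.aeval (R := k[X]) y') := by
    intro f
    have h1 : (f : PowerSeries k) ∈ (MvPolynomial.aeval (R := k[X]) Y).range := by
      rw [← Algebra.adjoin_range_eq_range_aeval]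
      exact f.2
    obtain ⟨p, hp⟩ := h1
    refine ⟨p, Subtype.ext ?_⟩
    rw [← hp]
    have h2 := MvPolynomial.comp_aeval_apply y' A.val p
    exact h2
  have hfaith : ∀ g g' : Eˣ, (∀ l, y' (g • l) = y' (g' • l)) → g = g' := by
    intro g g' h
    ext1
    rw [← sub_eq_zero, ← Module.forall_dual_apply_eq_zero_iff k]
    intro l
    have h1 : Y (g • l) = Y (g' • l) := congrArg Subtype.val (h l)
    have h2 := congrArg (PowerSeries.coeff 0) h1
    simp only [Y, coeff_coeffFunctional, PowerSeries.coeff_zero_eq_constantCoeff_apply, hy1,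
      hact, LinearMap.comp_apply, LinearMap.mulLeft_apply, mul_one] at h2
    rw [map_sub, h2, sub_self]
  obtain ⟨H, c, hc⟩ := stepanov_group_bound A.val Subtype.val_injective y' hsurj hfaith
  refine ⟨H, c, fun μ hμ D hD g hg => hc μ hμ D hD g fun l => ?_⟩
  obtain ⟨R, hR⟩ := hg
  have hmem : coeffFunctional l ((R : PowerSeries E) * y) ∈ A :=
    Algebra.span_le_adjoin _ _ (coeffFunctional_poly_mul_mem_span l R y)
  refine ⟨⟨_, hmem⟩, Subtype.ext ?_⟩
  change Y l ^ Fintype.card k ^ (2 * μ) - Y (g • l) =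
    (D : PowerSeries k) * coeffFunctional l ((R : PowerSeries E) * y)
  rw [PowerSeries.pow_card_pow_eq_expand, ← coeffFunctional_expand,
    expand_pow_eq_prod_mul U Fintype.card_ne_zero hy, eq_add_of_sub_eq hR, Polynomial.coe_add,
    Polynomial.coe_mul, add_mul, map_add, Polynomial.coe_C, coeffFunctional_C_mul,
    ← coeffFunctional_map_mul, mul_assoc, Polynomial.polynomial_map_coe]
  simp only [Y, hact]
  rw [add_sub_cancel_right]

end StepanovProduct

section HomogeneousEvaluation

/-- The homogenization of `P` evaluated at `(a, b)`. -/
noncomputable def homogEval {B : Type*} [CommRing B] (a b : B) (P : B[X]) : B :=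
  (P.scaleRoots b).eval a

theorem homogEval_mul {B : Type*} [CommRing B] (a b : B) {P Q : B[X]} (hP : P.Monic)
    (hQ : Q.Monic) : homogEval a b (P * Q) = homogEval a b P * homogEval a b Q := by
  cases subsingleton_or_nontrivial B
  · exact Subsingleton.elim _ _
  · rw [homogEval, mul_scaleRoots', eval_mul, homogEval, homogEval]
    simp [hP.leadingCoeff, hQ.leadingCoeff]

theorem homogEval_one {B : Type*} [CommRing B] (a b : B) : homogEval a b 1 = 1 := by
  rw [homogEval, ← C_1, scaleRoots_C, eval_C]

theorem homogEval_X_sub_C {B : Type*} [CommRing B] (a b x : B) :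
    homogEval a b (X - C x) = a - b * x := by
  rw [homogEval, X_sub_C_scaleRoots, eval_sub, eval_X, eval_C, mul_comm]

theorem homogEval_prod {B ι : Type*} [CommRing B] (a b : B) (s : Finset ι) (P : ι → B[X])
    (hP : ∀ i ∈ s, (P i).Monic) :
    homogEval a b (∏ i ∈ s, P i) = ∏ i ∈ s, homogEval a b (P i) := by
  classical
  induction s using Finset.induction_on with
  | empty => simp [homogEval_one]
  | insert i s hi ih =>
    rw [Finset.prod_insert hi, Finset.prod_insert hi, homogEval_mul,
      ih fun j hj => hP j (Finset.mem_insert_of_mem hj)]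
    · exact hP i (Finset.mem_insert_self i s)
    · exact monic_prod_of_monic _ _ fun j hj => hP j (Finset.mem_insert_of_mem hj)

theorem homogEval_map {B B' : Type*} [CommRing B] [CommRing B'] (φ : B →+* B') (a b : B)
    {P : B[X]} (hP : P.Monic) : homogEval (φ a) (φ b) (P.map φ) = φ (homogEval a b P) := by
  cases subsingleton_or_nontrivial B'
  · exact Subsingleton.elim _ _
  · rw [homogEval, ← map_scaleRoots _ _ _ (by simp [hP.leadingCoeff]), eval_map, eval₂_at_apply,
      homogEval]

theorem map_eq_prod_X_sub_C_pow {F : Type*} [Field F] [Fintype F] {K : Type*} [Field K]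
    [Algebra F K] {p : F[X]} (hp : p.Monic) (hirr : Irreducible p) {x : K} (hx : aeval x p = 0) :
    p.map (algebraMap F K) =
      ∏ i ∈ Finset.range p.natDegree, (X - C (x ^ Fintype.card F ^ i)) := by
  have hmin : p = minpoly F x := minpoly.eq_of_irreducible_of_monic hirr hx hp
  have hroot : ∀ i, aeval (x ^ Fintype.card F ^ i) p = 0 := by
    intro i
    have h := congrArg (aeval x) (pow_card_pow_eq_comp p i)
    rw [map_pow, hx, zero_pow (pow_pos Fintype.card_pos _).ne', aeval_comp] at h
    simpa using h.symm
  have hlt : ∀ i j, i < j → j < p.natDegree →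
      x ^ Fintype.card F ^ i ≠ x ^ Fintype.card F ^ j := by
    intro i j hij hj heq
    obtain ⟨Fr, hFr⟩ := exists_frobenius_ringHom (algebraMap F K) i
    have h1 : x = x ^ Fintype.card F ^ (j - i) := by
      apply Fr.injective
      rw [hFr, hFr, ← pow_mul, ← pow_add, Nat.sub_add_cancel hij.le, heq]
    have h2 : p ∣ X ^ Nat.card F ^ (j - i) - X := by
      rw [hmin]
      apply minpoly.dvd
      rw [map_sub, aeval_X_pow, aeval_X, Nat.card_eq_fintype_card, ← h1, sub_self]
    have h3 := Nat.le_of_dvd (by omega) (hirr.natDegree_dvd_iff_dvd_X_pow_card_pow_sub_X.mpr h2)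
    omega
  have hinj : Set.InjOn (fun i => x ^ Fintype.card F ^ i) (Finset.range p.natDegree) := by
    intro i hi j hj hij
    simp only [Finset.coe_range, Set.mem_Iio] at hi hj
    rcases lt_trichotomy i j with h | h | h
    · exact absurd hij (hlt i j h hj)
    · exact h
    · exact absurd hij.symm (hlt j i h hi)
  have hdvd : ∏ i ∈ Finset.range p.natDegree, (X - C (x ^ Fintype.card F ^ i)) ∣
      p.map (algebraMap F K) := by
    apply Finset.prod_dvd_of_coprime
    · intro i hi j hj hij
      exact isCoprime_X_sub_C_of_isUnit_sub
        (sub_ne_zero.mpr fun h => hij (hinj hi hj h)).isUnit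
    · intro i _
      rw [dvd_iff_isRoot, IsRoot, eval_map_algebraMap]
      exact hroot i
  refine eq_of_monic_of_dvd_of_natDegree_le
    (monic_prod_of_monic _ _ fun i _ => monic_X_sub_C _) (hp.map _) hdvd ?_
  rw [natDegree_map, natDegree_finsetProd_X_sub_C_eq_card, Finset.card_range]

variable {F : Type*} [Field F] [Fintype F] {E : Type*} [CommRing E] [Algebra F E]

theorem map_dvd_prod_sub_homogEval (a b : E) {p : F[X]} (hp : p.Monic) (hirr : Irreducible p) :
    p.map (algebraMap F E) ∣ (∏ i ∈ Finset.range p.natDegree,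
      (C a - C b * X ^ Fintype.card F ^ i)) - C (homogEval a b (p.map (algebraMap F E))) := by
  set I := Ideal.span {p.map (algebraMap F E)} with hI
  rw [← Ideal.mem_span_singleton, ← Ideal.Quotient.eq_zero_iff_mem, map_sub, sub_eq_zero]
  have := Fact.mk hirr
  set mk := Ideal.Quotient.mk I with hmk
  let φ : E →+* E[X] ⧸ I := mk.comp C
  have hx : eval₂ (φ.comp (algebraMap F E)) (mk X) p = 0 := by
    have h1 : eval₂ (φ.comp (algebraMap F E)) (mk X) p = mk (p.map (algebraMap F E)) := by
      rw [← eval₂_map, ← Polynomial.hom_eval₂ _ C mk X, eval₂_C_X]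
    rw [h1, hmk, Ideal.Quotient.eq_zero_iff_mem, hI]
    exact Ideal.mem_span_singleton_self _
  let ψ : AdjoinRoot p →+* E[X] ⧸ I := AdjoinRoot.lift _ _ hx
  have h2 : (p.map (algebraMap F E)).map φ =
      ∏ i ∈ Finset.range p.natDegree, (X - C (mk X ^ Fintype.card F ^ i)) := by
    have h3 := congrArg (Polynomial.map ψ)
      (map_eq_prod_X_sub_C_pow hp hirr (x := AdjoinRoot.root p) (by simp))
    rw [Polynomial.map_map, Polynomial.map_prod] at h3
    have h4 : ψ.comp (algebraMap F (AdjoinRoot p)) = φ.comp (algebraMap F E) := by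
      ext c
      exact AdjoinRoot.lift_of hx
    rw [h4] at h3
    rw [Polynomial.map_map, h3]
    refine Finset.prod_congr rfl fun i _ => ?_
    rw [Polynomial.map_sub, map_X, map_C, map_pow, AdjoinRoot.lift_root]
  have h5 : mk (C (homogEval a b (p.map (algebraMap F E)))) =
      homogEval (φ a) (φ b) ((p.map (algebraMap F E)).map φ) :=
    (homogEval_map φ a b (hp.map _)).symm
  rw [h5, h2, homogEval_prod _ _ _ _ fun i _ => monic_X_sub_C _, map_prod]
  refine Finset.prod_congr rfl fun i _ => ?_
  rw [homogEval_X_sub_C, map_sub, map_mul, map_pow]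
  rfl

theorem map_dvd_prod_sub_homogEval_pow (a b : E) {p : F[X]} (hp : p.Monic)
    (hirr : Irreducible p) {m : ℕ} (hm : p.natDegree ∣ m) :
    p.map (algebraMap F E) ∣ (∏ i ∈ Finset.range m, (C a - C b * X ^ Fintype.card F ^ i)) -
      C (homogEval a b (p.map (algebraMap F E)) ^ (m / p.natDegree)) := by
  obtain ⟨j, rfl⟩ := hm
  have hd : 0 < p.natDegree := hirr.natDegree_pos
  rw [Nat.mul_div_cancel_left j hd]
  induction j with
  | zero => simp
  | succ j ih =>
    rw [Nat.mul_succ, Finset.prod_range_add, pow_succ, C_mul]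
    have h1 : p.map (algebraMap F E) ∣ (∏ i ∈ Finset.range p.natDegree,
        (C a - C b * X ^ Fintype.card F ^ (p.natDegree * j + i))) -
        C (homogEval a b (p.map (algebraMap F E))) := by
      have h2 := map_dvd_prod_sub_homogEval a b hp hirr
      rw [← Ideal.mem_span_singleton, ← Ideal.Quotient.eq_zero_iff_mem, map_sub,
        sub_eq_zero] at h2 ⊢
      rw [← h2, map_prod, map_prod]
      refine Finset.prod_congr rfl fun i _ => ?_
      have h3 : p.map (algebraMap F E) ∣ X ^ Fintype.card F ^ (p.natDegree * j) - X := by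
        have h4 := Polynomial.map_dvd (algebraMap F E)
          (hirr.natDegree_dvd_iff_dvd_X_pow_card_pow_sub_X.mp (Dvd.intro j rfl))
        simpa [Nat.card_eq_fintype_card] using h4
      rw [← Ideal.mem_span_singleton, ← Ideal.Quotient.eq_zero_iff_mem, map_sub,
        sub_eq_zero, map_pow] at h3
      rw [pow_add, pow_mul, map_sub, map_mul, map_pow, map_pow, h3]
      simp
    have h6 : ∀ u v s t : E[X], u * v - s * t = (u - s) * v + s * (v - t) := by
      intros; ring
    rw [h6]
    exact dvd_add (Dvd.dvd.mul_right ih _) (Dvd.dvd.mul_left h1 _)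

end HomogeneousEvaluation

section BaseChange

theorem exists_finite_extension_aeval_ne_zero {F : Type*} [Field F] [Fintype F] {δ : F[X]}
    (hδ : δ ≠ 0) : ∃ (k : Type) (_ : Field k) (_ : Fintype k) (_ : Algebra F k) (s : k) (M : ℕ),
      0 < M ∧ Fintype.card k = Fintype.card F ^ M ∧ aeval s δ ≠ 0 := by
  classical
  obtain ⟨p, hp⟩ := CharP.exists F
  have hpp : Fact p.Prime := ⟨CharP.char_is_prime F p⟩
  let N := δ.natDegree + 1
  have : NeZero N := ⟨Nat.succ_ne_zero _⟩
  let k := FiniteField.Extension F p N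
  let _ : Fintype k := Fintype.ofFinite k
  have hcard : Fintype.card k = Fintype.card F ^ N := by
    rw [← Nat.card_eq_fintype_card, ← Nat.card_eq_fintype_card]
    exact FiniteField.natCard_extension F p N
  have hne : δ.map (algebraMap F k) ≠ 0 := by
    rwa [Ne, Polynomial.map_eq_zero]
  obtain ⟨s, hs⟩ := exists_eval_ne_zero_of_natDegree_lt_card (δ.map (algebraMap F k)) hne (by
    rw [natDegree_map, Cardinal.mk_fintype, hcard]
    have h : N < Fintype.card F ^ N := Nat.lt_pow_self Fintype.one_lt_card
    exact_mod_cast (by omega : δ.natDegree < Fintype.card F ^ N))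
  exact ⟨k, inferInstance, inferInstance, inferInstance, s, N, Nat.succ_pos _, hcard, by
    rwa [eval_map_algebraMap] at hs⟩

theorem finite_tensorProduct (F k E : Type*) [Field F] [CommRing E] [Algebra F E] [Finite E]
    [Field k] [Finite k] [Algebra F k] : Finite (TensorProduct F k E) := by
  have : Module.Finite F E := Module.Finite.of_finite
  have : Module.Finite k (TensorProduct F k E) := inferInstance
  exact Module.finite_of_finite k

theorem prod_range_mul_eq {M : Type*} [CommMonoid M] (f : ℕ → M) (m n : ℕ) :
    ∏ i ∈ Finset.range (m * n), f i =
      ∏ l ∈ Finset.range n, ∏ i ∈ Finset.range m, f (m * l + i) := by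
  induction n with
  | zero => simp
  | succ n ih => rw [Nat.mul_succ, Finset.prod_range_add, Finset.prod_range_succ, ih]

theorem expand_X_add_C_eq_pow {k A : Type*} [Field k] [Fintype k] [CommRing A] [Algebra k A]
    (s : k) (l : ℕ) : expand A (Fintype.card k ^ l) (X + C (algebraMap k A s)) =
      (X + C (algebraMap k A s)) ^ Fintype.card k ^ l := by
  obtain ⟨Fr, hFr⟩ := exists_frobenius_ringHom (algebraMap k A[X]) l
  rw [← hFr, map_add Fr, hFr, hFr, ← C_pow, ← map_pow, FiniteField.pow_card_pow]
  simp

theorem isUnit_prod_shift {F E k : Type*} [Field F] [Fintype F] [CommRing E] [Algebra F E]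
    [Field k] [Algebra F k] [Algebra k E] [IsScalarTower F k E] {a b : E} {V : E[X]} {δ : F[X]}
    (hV : (C a - C b * X) * V = δ.map (algebraMap F E)) {s : k} (hs : aeval s δ ≠ 0) (m : ℕ) :
    IsUnit (∏ i ∈ Finset.range m, (a - b * algebraMap k E s ^ Fintype.card F ^ i)) := by
  rw [IsUnit.prod_iff]
  intro i _
  have h := congrArg (eval (algebraMap k E s ^ Fintype.card F ^ i)) hV
  have h2 : aeval (algebraMap k E s ^ Fintype.card F ^ i) δ =
      algebraMap k E (aeval s δ ^ Fintype.card F ^ i) := by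
    rw [← map_pow, aeval_algebraMap_apply]
    congr 1
    rw [← map_pow, pow_card_pow_eq_comp, aeval_comp, aeval_X_pow]
  rw [eval_map_algebraMap, h2, eval_mul] at h
  have h3 : IsUnit (algebraMap k E (aeval s δ ^ Fintype.card F ^ i)) :=
    (pow_ne_zero _ hs).isUnit.map _
  rw [← h] at h3
  simpa using isUnit_of_mul_isUnit_left h3

theorem exists_subgroup_bound_of_extension {F E k : Type*} [Field F] [Fintype F] [CommRing E]
    [Finite E] [Algebra F E] [Field k] [Fintype k] [Algebra F k] [Algebra k E]
    [IsScalarTower F k E] {a b : E} {V : E[X]} {δ : F[X]}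
    (hV : (C a - C b * X) * V = δ.map (algebraMap F E)) {s : k} (hs : aeval s δ ≠ 0) {M : ℕ}
    (hM : 0 < M) (hcard : Fintype.card k = Fintype.card F ^ M) :
    ∃ (H : Subgroup Eˣ) (N c : ℕ), 0 < N ∧ ∀ n : ℕ, 0 < n → ∀ D : F[X],
      D ∣ X ^ Fintype.card F ^ (2 * N * n) - X → ∀ g : Eˣ,
      (D.map (algebraMap F E) ∣ (∏ i ∈ Finset.range (2 * N * n),
        (C a - C b * X ^ Fintype.card F ^ i)) - C (g : E)) →
      (g ∈ H → D.natDegree * Nat.card H ≤ Fintype.card F ^ (2 * N * n) +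
        c * Fintype.card F ^ (N * n)) ∧ (g ∉ H → D.natDegree ≤ c) := by
  set q := Fintype.card F with hq
  set K := Fintype.card k with hK
  set s' := algebraMap k E s with hs'
  obtain ⟨w, hw⟩ := isUnit_prod_shift hV hs M
  set U₀ : E[X] := ∏ i ∈ Finset.range M, (C a - C b * (X + C s') ^ q ^ i) with hU₀
  have hU₀c : U₀.coeff 0 = w := by
    rw [hU₀, coeff_zero_prod, hw]
    refine Finset.prod_congr rfl fun i _ => ?_
    rw [coeff_zero_eq_eval_zero]
    simp [hs', hq]
  obtain ⟨H, c, hH⟩ := exists_subgroup_natDegree_bound (k := k) (C (↑w⁻¹ : E) * U₀) (by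
    rw [coeff_C_mul, hU₀c, Units.inv_mul])
  set N₀ := Nat.card Eˣ with hN₀
  have hN₀pos : 0 < N₀ := Nat.card_pos
  refine ⟨H, M * N₀, c, by positivity, fun n hn D hD g hg => ?_⟩
  have hexp : ∏ l ∈ Finset.range (2 * (N₀ * n)), expand E (K ^ l) (C (↑w⁻¹ : E) * U₀) =
      (∏ i ∈ Finset.range (2 * (M * N₀) * n), (C a - C b * X ^ q ^ i)).comp (X + C s') := by
    have h1 : (C (↑w⁻¹ : E) : E[X]) ^ (2 * (N₀ * n)) = 1 := by
      rw [← C_pow, ← Units.val_pow_eq_pow_val]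
      have : (w⁻¹) ^ (2 * (N₀ * n)) = 1 := by
        rw [mul_left_comm, pow_mul, hN₀, pow_card_eq_one', one_pow]
      rw [this]; simp
    simp_rw [map_mul, expand_C]
    rw [Finset.prod_mul_distrib, Finset.prod_const, Finset.card_range, h1, one_mul, prod_comp,
      show 2 * (M * N₀) * n = M * (2 * (N₀ * n)) by ring,
      prod_range_mul_eq _ M (2 * (N₀ * n))]
    refine Finset.prod_congr rfl fun l _ => ?_
    rw [hU₀, map_prod]
    refine Finset.prod_congr rfl fun i _ => ?_
    rw [map_sub, map_mul, map_pow, expand_C, expand_C, expand_X_add_C_eq_pow]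
    simp only [sub_comp, mul_comp, C_comp, X_pow_comp]
    rw [← pow_mul, ← hK, hcard, ← pow_mul, ← pow_add]
  have hKμ : K ^ (2 * (N₀ * n)) = q ^ (2 * (M * N₀) * n) := by
    rw [hcard, ← pow_mul]; congr 1; ring
  have hKμ' : K ^ (N₀ * n) = q ^ (M * N₀ * n) := by
    rw [hcard, ← pow_mul]; congr 1; ring
  have hD' : (D.map (algebraMap F k)).comp (X + C s) ∣ X ^ K ^ (2 * (N₀ * n)) - X := by
    have h := map_dvd (compRingHom (X + C s)) (map_dvd (mapRingHom (algebraMap F k)) hD)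
    simp only [coe_mapRingHom, coe_compRingHom_apply, Polynomial.map_sub, Polynomial.map_pow,
      map_X, sub_comp, X_pow_comp, X_comp] at h
    have h2 := expand_X_add_C_eq_pow (A := k) s (2 * (N₀ * n))
    simp only [Algebra.algebraMap_self, RingHom.id_apply, map_add, expand_X, expand_C] at h2
    rw [← hKμ, hK, ← h2, ← hK] at h
    simpa using h
  have hmap : ((D.map (algebraMap F k)).comp (X + C s)).map (algebraMap k E) =
      (D.map (algebraMap F E)).comp (X + C s') := by
    rw [map_comp, Polynomial.map_map, ← IsScalarTower.algebraMap_eq]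
    simp [hs']
  have hdvd : ((D.map (algebraMap F k)).comp (X + C s)).map (algebraMap k E) ∣
      ∏ l ∈ Finset.range (2 * (N₀ * n)), expand E (K ^ l) (C (↑w⁻¹ : E) * U₀) - C (g : E) := by
    have h := map_dvd (compRingHom (X + C s')) hg
    simp only [coe_compRingHom_apply, sub_comp, C_comp] at h
    rwa [hmap, hexp]
  have hdeg : ((D.map (algebraMap F k)).comp (X + C s)).natDegree = D.natDegree := by
    rw [natDegree_comp, natDegree_X_add_C, mul_one, natDegree_map]
  have := hH (N₀ * n) (by positivity) _ hD' g hdvd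
  rwa [hdeg, ← hK, hKμ, hKμ'] at this

theorem exists_subgroup_bound {F E : Type*} [Field F] [Fintype F] [CommRing E]
    [Finite E] [Algebra F E] {a b : E} {V : E[X]} {δ : F[X]} (hδ : δ ≠ 0)
    (hV : (C a - C b * X) * V = δ.map (algebraMap F E)) :
    ∃ (H : Subgroup Eˣ) (N c : ℕ), 0 < N ∧ ∀ n : ℕ, 0 < n → ∀ D : F[X],
      D ∣ X ^ Fintype.card F ^ (2 * N * n) - X → ∀ g : Eˣ,
      (D.map (algebraMap F E) ∣ (∏ i ∈ Finset.range (2 * N * n),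
        (C a - C b * X ^ Fintype.card F ^ i)) - C (g : E)) →
      (g ∈ H → D.natDegree * Nat.card H ≤ Fintype.card F ^ (2 * N * n) +
        c * Fintype.card F ^ (N * n)) ∧ (g ∉ H → D.natDegree ≤ c) := by
  obtain ⟨k, _, _, _, s, M, hM, hcard, hs⟩ := exists_finite_extension_aeval_ne_zero hδ
  have := finite_tensorProduct F k E
  let j : E →ₐ[F] TensorProduct F k E := Algebra.TensorProduct.includeRight
  have hj : Function.Injective j :=
    Algebra.TensorProduct.includeRight_injective (algebraMap F k).injective
  have hjF : (j : E →+* TensorProduct F k E).comp (algebraMap F E) =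
      algebraMap F (TensorProduct F k E) := j.comp_algebraMap
  obtain ⟨H, N, c, hN, hH⟩ := exists_subgroup_bound_of_extension (a := j a) (b := j b)
    (V := V.map (j : E →+* TensorProduct F k E)) (δ := δ) (by
      have := congrArg (Polynomial.map (j : E →+* TensorProduct F k E)) hV
      rw [Polynomial.map_map, hjF] at this
      simpa using this) hs hM hcard
  refine ⟨H.comap (Units.map (j : E →* TensorProduct F k E)), N, c, hN,
    fun n hn D hD g hg => ?_⟩
  have h := hH n hn D hD (Units.map (j : E →* TensorProduct F k E) g) (by
    have := map_dvd (mapRingHom (j : E →+* TensorProduct F k E)) hg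
    simp only [coe_mapRingHom, Polynomial.map_map, hjF] at this
    simpa [Polynomial.map_prod] using this)
  refine ⟨fun hgH => le_trans ?_ (h.1 hgH), fun hgH => h.2 hgH⟩
  refine Nat.mul_le_mul_left _ ?_
  refine Nat.card_le_card_of_injective
    (fun x => ⟨Units.map (j : E →* TensorProduct F k E) x.1, x.2⟩ : _ → H) ?_
  intro x y hxy
  apply Subtype.ext
  apply Units.ext
  apply hj
  simpa using congrArg (fun z : H => ((z : (TensorProduct F k E)ˣ) : TensorProduct F k E)) hxy

end BaseChange

section MonicFinset

variable {F : Type*} [Field F]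

theorem degree_lowPoly_lt (n : ℕ) (x : Fin n → F) : (lowPoly F n x).degree < n := by
  rw [lowPoly, ← mem_degreeLT]
  refine Submodule.sum_mem _ fun i _ => ?_
  rw [mem_degreeLT]
  exact lt_of_le_of_lt (degree_C_mul_X_pow_le _ _) (by exact_mod_cast i.2)

theorem coeff_lowPoly (n : ℕ) (x : Fin n → F) (i : Fin n) : (lowPoly F n x).coeff i = x i := by
  simp [lowPoly, finsetSum_coeff, coeff_C_mul, coeff_X_pow, Fin.val_inj]

theorem lowPoly_coeff {n : ℕ} {f : F[X]} (hf : f.degree < n) :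
    lowPoly F n (fun i => f.coeff i) = f := by
  ext m
  by_cases hm : m < n
  · exact coeff_lowPoly n (fun i => f.coeff i) ⟨m, hm⟩
  · rw [coeff_eq_zero_of_degree_lt
      ((degree_lowPoly_lt n _).trans_le (by exact_mod_cast not_lt.mp hm)),
      coeff_eq_zero_of_degree_lt (hf.trans_le (by exact_mod_cast not_lt.mp hm))]

theorem lowPoly_injective (n : ℕ) : Function.Injective (lowPoly F n) := by
  intro x y h
  ext i
  rw [← coeff_lowPoly n x i, h, coeff_lowPoly]

variable [Fintype F]

open scoped Classical in
variable (F) in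
/-- The monic polynomials of degree `n`. -/
noncomputable def monicFinset (n : ℕ) : Finset F[X] :=
  Finset.univ.image fun x : Fin n → F => X ^ n + lowPoly F n x

theorem mem_monicFinset {n : ℕ} {f : F[X]} :
    f ∈ monicFinset F n ↔ f.Monic ∧ f.natDegree = n := by
  simp only [monicFinset, Finset.mem_image, Finset.mem_univ, true_and]
  constructor
  · rintro ⟨x, rfl⟩
    exact ⟨monic_X_pow_add (degree_lowPoly_lt n x), natDegree_eq_of_degree_eq_some (by
      rw [degree_add_eq_left_of_degree_lt (by rw [degree_X_pow]; exact degree_lowPoly_lt n x),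
        degree_X_pow])⟩
  · rintro ⟨hf, rfl⟩
    refine ⟨fun i => (f - X ^ f.natDegree).coeff i, ?_⟩
    rw [lowPoly_coeff]
    · ring
    · have := degree_sub_lt_left (p := f) (q := X ^ f.natDegree) (by
        rw [degree_X_pow, degree_eq_natDegree hf.ne_zero]) hf.ne_zero (by simp [hf.leadingCoeff])
      rwa [degree_eq_natDegree hf.ne_zero] at this

theorem sum_monicFinset {A : Type*} [AddCommMonoid A] (n : ℕ) (φ : F[X] → A) :
    ∑ f ∈ monicFinset F n, φ f = ∑ x : Fin n → F, φ (X ^ n + lowPoly F n x) := by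
  classical
  rw [monicFinset, Finset.sum_image]
  intro x _ y _ h
  exact lowPoly_injective n (add_left_cancel h)

theorem card_monicFinset (n : ℕ) : (monicFinset F n).card = Fintype.card F ^ n := by
  rw [Finset.card_eq_sum_ones, sum_monicFinset]
  simp

theorem monicFinset_zero : monicFinset F 0 = {1} := by
  ext f
  rw [mem_monicFinset, Finset.mem_singleton]
  constructor
  · rintro ⟨hf, h0⟩
    exact hf.natDegree_eq_zero.mp h0
  · rintro rfl
    exact ⟨monic_one, natDegree_one⟩

/-- Multiplication by a monic `p` identifies the monic polynomials of degree `n - deg p` with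
the monic multiples of `p` of degree `n`. -/
theorem sum_monicFinset_dvd {A : Type*} [AddCommMonoid A] {p : F[X]} (hp : p.Monic) {n : ℕ}
    (hn : p.natDegree ≤ n) [DecidablePred (p ∣ ·)] (φ : F[X] → A) :
    ∑ f ∈ monicFinset F n with p ∣ f, φ f =
      ∑ f ∈ monicFinset F (n - p.natDegree), φ (p * f) := by
  symm
  refine Finset.sum_bij (fun f _ => p * f) ?_ ?_ ?_ (fun _ _ => rfl)
  · intro f hf
    rw [mem_monicFinset] at hf
    rw [Finset.mem_filter, mem_monicFinset]
    refine ⟨⟨hp.mul hf.1, ?_⟩, dvd_mul_right _ _⟩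
    rw [hp.natDegree_mul hf.1, hf.2]
    omega
  · intro f _ g _ h
    exact mul_left_cancel₀ hp.ne_zero h
  · intro f hf
    rw [Finset.mem_filter, mem_monicFinset] at hf
    obtain ⟨⟨hf, hfn⟩, g, rfl⟩ := hf
    have hg : g.Monic := hp.of_mul_monic_left hf
    refine ⟨g, ?_, rfl⟩
    rw [mem_monicFinset]
    rw [hp.natDegree_mul hg] at hfn
    exact ⟨hg, by omega⟩

theorem filter_dvd_monicFinset_eq_empty {p : F[X]} {n : ℕ}
    (hn : n < p.natDegree) [DecidablePred (p ∣ ·)] : {f ∈ monicFinset F n | p ∣ f} = ∅ := by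
  rw [Finset.filter_eq_empty_iff]
  intro f hf hpf
  rw [mem_monicFinset] at hf
  have := natDegree_le_of_dvd hpf hf.1.ne_zero
  omega

variable (F) in
open scoped Classical in
/-- The monic irreducible polynomials of degree at most `n`. -/
noncomputable def primesUpTo (n : ℕ) : Finset F[X] :=
  ((Finset.range (n + 1)).biUnion (monicFinset F)).filter Irreducible

theorem mem_primesUpTo {n : ℕ} {p : F[X]} :
    p ∈ primesUpTo F n ↔ p.Monic ∧ Irreducible p ∧ p.natDegree ≤ n := by
  simp only [primesUpTo, Finset.mem_filter, Finset.mem_biUnion, Finset.mem_range, mem_monicFinset]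
  constructor
  · rintro ⟨⟨d, hd, hp, hpd⟩, hirr⟩
    exact ⟨hp, hirr, by omega⟩
  · rintro ⟨hp, hirr, hpd⟩
    exact ⟨⟨p.natDegree, by omega, hp, rfl⟩, hirr⟩

variable (F) in
/-- The monic irreducible polynomials of degree dividing `m`. -/
noncomputable def primesDvd (m : ℕ) : Finset F[X] :=
  (primesUpTo F m).filter fun p => p.natDegree ∣ m

theorem mem_primesDvd {m : ℕ} (hm : 0 < m) {p : F[X]} :
    p ∈ primesDvd F m ↔ p.Monic ∧ Irreducible p ∧ p.natDegree ∣ m := by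
  rw [primesDvd, Finset.mem_filter, mem_primesUpTo]
  constructor
  · rintro ⟨⟨h1, h2, _⟩, h4⟩
    exact ⟨h1, h2, h4⟩
  · rintro ⟨h1, h2, h4⟩
    exact ⟨⟨h1, h2, Nat.le_of_dvd hm h4⟩, h4⟩

end MonicFinset

section Moebius

open UniqueFactorizationMonoid

open scoped Classical

variable {F : Type*} [Field F]

theorem polyMu_of_squarefree {f : F[X]} (hf : Squarefree f) :
    polyMu f = (-1) ^ (normalizedFactors f).card := if_pos hf

theorem polyMu_of_not_squarefree {f : F[X]} (hf : ¬ Squarefree f) : polyMu f = 0 := if_neg hf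

theorem polyMu_zero : polyMu (0 : F[X]) = 0 := polyMu_of_not_squarefree not_squarefree_zero

theorem polyMu_one : polyMu (1 : F[X]) = 1 := by
  rw [polyMu_of_squarefree squarefree_one, normalizedFactors_one, Multiset.card_zero, pow_zero]

theorem polyMu_mul {f g : F[X]} (h : IsCoprime f g) : polyMu (f * g) = polyMu f * polyMu g := by
  by_cases hf : Squarefree f
  · by_cases hg : Squarefree g
    · rw [polyMu_of_squarefree hf, polyMu_of_squarefree hg, polyMu_of_squarefree
        ((squarefree_mul_iff).mpr ⟨h.isRelPrime, hf, hg⟩),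
        normalizedFactors_mul hf.ne_zero hg.ne_zero, Multiset.card_add, pow_add]
    · rw [polyMu_of_not_squarefree hg, mul_zero, polyMu_of_not_squarefree]
      exact fun hfg => hg (hfg.squarefree_of_dvd (dvd_mul_left _ _))
  · rw [polyMu_of_not_squarefree hf, zero_mul, polyMu_of_not_squarefree]
    exact fun hfg => hf (hfg.squarefree_of_dvd (dvd_mul_right _ _))

theorem polyMu_of_isUnit {f : F[X]} (hf : IsUnit f) : polyMu f = 1 := by
  rw [polyMu_of_squarefree hf.squarefree, normalizedFactors_of_isUnit hf, Multiset.card_zero,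
    pow_zero]

theorem polyMu_C_mul {c : F} (hc : c ≠ 0) (f : F[X]) : polyMu (C c * f) = polyMu f := by
  have hu : IsUnit (C c) := isUnit_C.mpr hc.isUnit
  rw [polyMu_mul (by simpa using (isCoprime_mul_unit_left_left hu 1 f).mpr isCoprime_one_left),
    polyMu_of_isUnit hu, one_mul]

theorem polyMu_of_irreducible {p : F[X]} (hp : Irreducible p) : polyMu p = -1 := by
  rw [polyMu_of_squarefree hp.squarefree, normalizedFactors_irreducible hp,
    Multiset.card_singleton, pow_one]

theorem polyMu_irreducible_mul {p : F[X]} (hp : Irreducible p) (f : F[X])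
    [Decidable (p ∣ f)] : polyMu (p * f) = if p ∣ f then 0 else -polyMu f := by
  split_ifs with h
  · apply polyMu_of_not_squarefree
    intro hs
    exact hp.not_isUnit (hs p (mul_dvd_mul_left p h))
  · rw [polyMu_mul ((hp.coprime_iff_not_dvd).mpr h), polyMu_of_irreducible hp, neg_one_mul]

end Moebius

section LogarithmicDerivative

theorem map_pow_of_monic {F : Type*} [Field F] {h : F[X] → ℂ}
    (hmul : ∀ f g : F[X], f.Monic → g.Monic → h (f * g) = h f * h g)
    (hone : h 1 = 1) {p : F[X]} (hp : p.Monic) (j : ℕ) :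
    h (p ^ j) = h p ^ j := by
  induction j with
  | zero => simp [hone]
  | succ j ih => rw [pow_succ, hmul _ _ (hp.pow j) hp, ih, pow_succ]

open UniqueFactorizationMonoid

open scoped Classical

variable {F : Type*} [Field F] [Fintype F]

theorem natDegree_eq_sum_primesUpTo {n : ℕ} {f : F[X]} (hf : f ∈ monicFinset F n) :
    n = ∑ p ∈ primesUpTo F n, p.natDegree * (normalizedFactors f).count p := by
  rw [mem_monicFinset] at hf
  have h1 : f.natDegree = ((normalizedFactors f).map natDegree).sum := by
    rw [← natDegree_multiset_prod _ (zero_notMem_normalizedFactors f)]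
    have h := prod_normalizedFactors hf.1.ne_zero
    exact (natDegree_eq_of_degree_eq (degree_eq_degree_of_associated h)).symm
  rw [hf.2, Finset.sum_multiset_map_count] at h1
  refine h1.trans ?_
  simp_rw [smul_eq_mul, mul_comm]
  apply Finset.sum_subset
  · intro p hp
    rw [Multiset.mem_toFinset] at hp
    rw [mem_primesUpTo]
    have hirr := irreducible_of_normalized_factor p hp
    refine ⟨?_, hirr, hf.2 ▸ natDegree_le_of_dvd (dvd_of_mem_normalizedFactors hp) hf.1.ne_zero⟩
    have := normalize_normalized_factor p hp
    rw [← this]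
    exact monic_normalize hirr.ne_zero
  · intro p _ hp
    rw [Multiset.mem_toFinset] at hp
    rw [Multiset.count_eq_zero_of_notMem hp, mul_zero]

theorem count_normalizedFactors_eq_card {n : ℕ} {f p : F[X]} (hf : f ∈ monicFinset F n)
    (hp : p ∈ primesUpTo F n) :
    (normalizedFactors f).count p = ((Finset.Icc 1 n).filter fun j => p ^ j ∣ f).card := by
  rw [mem_monicFinset] at hf
  rw [mem_primesUpTo] at hp
  have hdvd : ∀ j, p ^ j ∣ f ↔ j ≤ (normalizedFactors f).count p := by
    intro j
    rw [pow_dvd_iff_le_emultiplicity,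
      emultiplicity_eq_count_normalizedFactors hp.2.1 hf.1.ne_zero, hp.1.normalize_eq_self,
      Nat.cast_le]
  have hle : (normalizedFactors f).count p ≤ n := by
    have h1 := natDegree_le_of_dvd ((hdvd _).mpr le_rfl) hf.1.ne_zero
    rw [natDegree_pow, hf.2] at h1
    exact (Nat.le_mul_of_pos_right _ hp.2.1.natDegree_pos).trans h1
  rw [show ((Finset.Icc 1 n).filter fun j => p ^ j ∣ f) =
    Finset.Icc 1 ((normalizedFactors f).count p) from ?_, Nat.card_Icc, Nat.add_sub_cancel]
  ext j
  rw [Finset.mem_filter, hdvd, Finset.mem_Icc, Finset.mem_Icc]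
  omega

/-- The weighted sum over prime powers of degree `m`. -/
noncomputable def primePowerSum (h : F[X] → ℂ) (m : ℕ) : ℂ :=
  ∑ p ∈ primesDvd F m, (p.natDegree : ℂ) * h p ^ (m / p.natDegree)

theorem sum_primesUpTo_eq_sum_primePowerSum (h : F[X] → ℂ) (v : ℕ → ℂ) (n : ℕ) :
    ∑ p ∈ primesUpTo F n, (p.natDegree : ℂ) *
      ∑ j ∈ (Finset.Icc 1 n).filter (fun j => p.natDegree * j ≤ n),
        h p ^ j * v (n - p.natDegree * j) =
      ∑ m ∈ Finset.Icc 1 n, primePowerSum h m * v (n - m) := by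
  simp_rw [primePowerSum, Finset.sum_mul, Finset.mul_sum]
  rw [Finset.sum_sigma', Finset.sum_sigma']
  refine Finset.sum_bij' (fun x _ => ⟨x.1.natDegree * x.2, x.1⟩)
    (fun x _ => ⟨x.2, x.1 / x.2.natDegree⟩) ?_ ?_ ?_ ?_ ?_
  · rintro ⟨p, j⟩ hx
    simp only [Finset.mem_sigma, Finset.mem_filter, Finset.mem_Icc, mem_primesUpTo] at hx ⊢
    obtain ⟨⟨hp, hirr, hpn⟩, ⟨hj, _⟩, hn⟩ := hx
    have hpos : 0 < p.natDegree * j := Nat.mul_pos hirr.natDegree_pos hj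
    exact ⟨⟨hpos, hn⟩, (mem_primesDvd hpos).mpr ⟨hp, hirr, dvd_mul_right _ _⟩⟩
  · rintro ⟨m, p⟩ hx
    simp only [Finset.mem_sigma, Finset.mem_filter, Finset.mem_Icc, mem_primesUpTo] at hx ⊢
    obtain ⟨⟨hm, hmn⟩, hp⟩ := hx
    obtain ⟨hp, hirr, hd⟩ := (mem_primesDvd hm).mp hp
    have hdm := Nat.le_of_dvd hm hd
    refine ⟨⟨hp, hirr, by omega⟩, ⟨Nat.div_pos hdm hirr.natDegree_pos,
      (Nat.div_le_self _ _).trans hmn⟩, ?_⟩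
    rwa [Nat.mul_div_cancel' hd]
  · rintro ⟨p, j⟩ hx
    simp only [Finset.mem_sigma, Finset.mem_filter, Finset.mem_Icc, mem_primesUpTo] at hx
    simp [Nat.mul_div_cancel_left _ hx.1.2.1.natDegree_pos]
  · rintro ⟨m, p⟩ hx
    simp only [Finset.mem_sigma, Finset.mem_Icc] at hx
    obtain ⟨hp, hirr, hd⟩ := (mem_primesDvd hx.1.1).mp hx.2
    simp [Nat.mul_div_cancel' hd]
  · rintro ⟨p, j⟩ hx
    simp only [Finset.mem_sigma, Finset.mem_filter, Finset.mem_Icc, mem_primesUpTo] at hx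
    simp only [Nat.mul_div_cancel_left _ hx.1.2.1.natDegree_pos]
    ring

variable {h : F[X] → ℂ}

theorem nat_mul_sum_monicFinset
    (hmul : ∀ f g : F[X], f.Monic → g.Monic → h (f * g) = h f * h g)
    (hone : h 1 = 1) (n : ℕ) :
    (n : ℂ) * ∑ f ∈ monicFinset F n, h f =
      ∑ m ∈ Finset.Icc 1 n, primePowerSum h m * ∑ f ∈ monicFinset F (n - m), h f := by
  have h1 : (n : ℂ) * ∑ f ∈ monicFinset F n, h f = ∑ f ∈ monicFinset F n,
      ∑ p ∈ primesUpTo F n, (p.natDegree : ℂ) *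
        ∑ j ∈ Finset.Icc 1 n, if p ^ j ∣ f then h f else 0 := by
    rw [Finset.mul_sum]
    refine Finset.sum_congr rfl fun f hf => ?_
    conv_lhs => rw [natDegree_eq_sum_primesUpTo hf]
    rw [Nat.cast_sum, Finset.sum_mul]
    refine Finset.sum_congr rfl fun p hp => ?_
    rw [count_normalizedFactors_eq_card hf hp, ← Finset.sum_filter, Finset.sum_const,
      nsmul_eq_mul, Nat.cast_mul, mul_assoc]
  rw [h1, Finset.sum_comm, ← sum_primesUpTo_eq_sum_primePowerSum h
    (fun k => ∑ f ∈ monicFinset F k, h f) n]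
  refine Finset.sum_congr rfl fun p hp => ?_
  rw [mem_primesUpTo] at hp
  rw [← Finset.mul_sum, Finset.sum_comm, Finset.sum_filter]
  congr 1
  refine Finset.sum_congr rfl fun j hj => ?_
  rw [← Finset.sum_filter]
  have hd : (p ^ j).natDegree = p.natDegree * j := by rw [natDegree_pow, mul_comm]
  split_ifs with hle
  · rw [sum_monicFinset_dvd (hp.1.pow j) (by rwa [hd]), hd, Finset.mul_sum]
    refine Finset.sum_congr rfl fun f hf => ?_
    rw [hmul _ _ (hp.1.pow j) (mem_monicFinset.mp hf).1, map_pow_of_monic hmul hone hp.1]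
  · rw [filter_dvd_monicFinset_eq_empty (by rw [hd]; omega), Finset.sum_empty]

theorem sum_monicFinset_dvd_polyMu
    (hmul : ∀ f g : F[X], f.Monic → g.Monic → h (f * g) = h f * h g)
    {p : F[X]} (hp : p.Monic) (hirr : Irreducible p) {n : ℕ}
    (hn : p.natDegree ≤ n) :
    ∑ f ∈ monicFinset F n with p ∣ f, (polyMu f : ℂ) * h f =
      -(h p * ∑ f ∈ monicFinset F (n - p.natDegree) with ¬ p ∣ f, (polyMu f : ℂ) * h f) := by
  rw [sum_monicFinset_dvd hp hn, Finset.sum_filter, Finset.mul_sum, ← Finset.sum_neg_distrib]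
  refine Finset.sum_congr rfl fun f hf => ?_
  rw [polyMu_irreducible_mul hirr, hmul _ _ hp (mem_monicFinset.mp hf).1]
  by_cases hpf : p ∣ f
  · simp [hpf]
  · simp [hpf]; ring

theorem mul_sum_not_dvd_polyMu
    (hmul : ∀ f g : F[X], f.Monic → g.Monic → h (f * g) = h f * h g)
    {p : F[X]} (hp : p.Monic) (hirr : Irreducible p) (n : ℕ) :
    ∀ k ≤ n, p.natDegree ≤ k →
    h p * ∑ f ∈ monicFinset F (k - p.natDegree) with ¬ p ∣ f, (polyMu f : ℂ) * h f =
      ∑ j ∈ (Finset.Icc 1 n).filter (fun j => p.natDegree * j ≤ k),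
        h p ^ j * ∑ f ∈ monicFinset F (k - p.natDegree * j), (polyMu f : ℂ) * h f := by
  have hd := hirr.natDegree_pos
  set d := p.natDegree with hd_def
  intro k
  induction k using Nat.strong_induction_on with
  | _ k ih =>
    intro hkn hdk
    have hsplit := Finset.sum_filter_add_sum_filter_not (monicFinset F (k - d)) (p ∣ ·)
      (fun f => (polyMu f : ℂ) * h f)
    have hfirst : 1 ∈ (Finset.Icc 1 n).filter (fun j => d * j ≤ k) := by
      rw [Finset.mem_filter, Finset.mem_Icc]; omega
    rw [← Finset.add_sum_erase _ _ hfirst, pow_one, mul_one, ← hsplit]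
    by_cases h2 : d ≤ k - d
    · rw [sum_monicFinset_dvd_polyMu hmul hp hirr h2, ih (k - d) (by omega) (by omega) h2]
      have hbij : ∑ j ∈ (Finset.Icc 1 n).filter (fun j => d * j ≤ k - d),
          h p ^ j * ∑ f ∈ monicFinset F (k - d - d * j), (polyMu f : ℂ) * h f * h p =
          ∑ j ∈ ((Finset.Icc 1 n).filter (fun j => d * j ≤ k)).erase 1,
            h p ^ j * ∑ f ∈ monicFinset F (k - d * j), (polyMu f : ℂ) * h f := by
        refine Finset.sum_bij' (fun j _ => j + 1) (fun j _ => j - 1) ?_ ?_ ?_ ?_ ?_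
        · intro j hj
          simp only [Finset.mem_filter, Finset.mem_Icc, Finset.mem_erase] at hj ⊢
          have : d * (j + 1) = d * j + d := by ring
          have : j ≤ d * j := Nat.le_mul_of_pos_left j hd
          omega
        · intro j hj
          simp only [Finset.mem_filter, Finset.mem_Icc, Finset.mem_erase] at hj ⊢
          have : d * (j - 1) + d = d * j := by
            rw [← Nat.mul_succ]; congr 1; omega
          omega
        · intro j hj; simp
        · intro j hj
          simp only [Finset.mem_filter, Finset.mem_Icc, Finset.mem_erase] at hj
          omega
        · intro j hj
          rw [← Finset.sum_mul, show k - d * (j + 1) = k - d - d * j by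
            rw [Nat.mul_succ]; omega]
          ring
      rw [← hbij]
      simp_rw [← Finset.sum_mul, ← mul_assoc]
      rw [← Finset.sum_mul]
      ring
    · have hempty : ((Finset.Icc 1 n).filter (fun j => d * j ≤ k)).erase 1 = ∅ := by
        rw [Finset.eq_empty_iff_forall_notMem]
        intro j hj
        simp only [Finset.mem_filter, Finset.mem_Icc, Finset.mem_erase] at hj
        have : d * 2 ≤ d * j := Nat.mul_le_mul_left _ (by omega)
        omega
      rw [hempty, Finset.sum_empty, filter_dvd_monicFinset_eq_empty (by omega)]
      simp

theorem nat_mul_sum_monicFinset_polyMu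
    (hmul : ∀ f g : F[X], f.Monic → g.Monic → h (f * g) = h f * h g)
    (n : ℕ) :
    (n : ℂ) * ∑ f ∈ monicFinset F n, (polyMu f : ℂ) * h f =
      -∑ m ∈ Finset.Icc 1 n, primePowerSum h m *
        ∑ f ∈ monicFinset F (n - m), (polyMu f : ℂ) * h f := by
  have h1 : (n : ℂ) * ∑ f ∈ monicFinset F n, (polyMu f : ℂ) * h f = ∑ f ∈ monicFinset F n,
      ∑ p ∈ primesUpTo F n, (p.natDegree : ℂ) *
        if p ∣ f then (polyMu f : ℂ) * h f else 0 := by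
    rw [Finset.mul_sum]
    refine Finset.sum_congr rfl fun f hf => ?_
    by_cases hsq : Squarefree f
    · conv_lhs => rw [natDegree_eq_sum_primesUpTo hf]
      rw [Nat.cast_sum, Finset.sum_mul]
      refine Finset.sum_congr rfl fun p hp => ?_
      rw [mem_primesUpTo] at hp
      have hf0 := (mem_monicFinset.mp hf).1.ne_zero
      have hcount : (normalizedFactors f).count p = if p ∣ f then 1 else 0 := by
        rw [Multiset.count_eq_of_nodup ((squarefree_iff_nodup_normalizedFactors hf0).mp hsq)]
        refine if_congr ?_ rfl rfl
        rw [mem_normalizedFactors_iff' hf0]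
        exact ⟨fun h => h.2.2, fun h => ⟨hp.2.1, hp.1.normalize_eq_self, h⟩⟩
      rw [hcount]
      split_ifs <;> simp
    · simp [polyMu_of_not_squarefree hsq]
  rw [h1, Finset.sum_comm, ← sum_primesUpTo_eq_sum_primePowerSum h
    (fun k => ∑ f ∈ monicFinset F k, (polyMu f : ℂ) * h f) n, ← Finset.sum_neg_distrib]
  refine Finset.sum_congr rfl fun p hp => ?_
  rw [mem_primesUpTo] at hp
  rw [← Finset.mul_sum, ← Finset.sum_filter, sum_monicFinset_dvd_polyMu hmul hp.1 hp.2.1 hp.2.2,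
    mul_sum_not_dvd_polyMu hmul hp.1 hp.2.1 n n le_rfl hp.2.2, mul_neg]

theorem sum_natDegree_primesDvd (n : ℕ) (hn : 0 < n) :
    ∑ p ∈ primesDvd F n, p.natDegree = Fintype.card F ^ n := by
  suffices h : primePowerSum (fun _ : F[X] => 1) n = (Fintype.card F : ℂ) ^ n by
    simp only [primePowerSum, one_pow, mul_one] at h
    exact_mod_cast h
  induction n using Nat.strong_induction_on with
  | _ n ih =>
    have h := nat_mul_sum_monicFinset (F := F) (h := fun _ => 1) (by simp) rfl n
    obtain ⟨n, rfl⟩ : ∃ k, n = k + 1 := ⟨n - 1, by omega⟩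
    simp only [Finset.sum_const, card_monicFinset, nsmul_eq_mul, mul_one] at h
    rw [Finset.sum_Icc_succ_top (by omega), Finset.sum_congr rfl (g := fun _ =>
      (Fintype.card F : ℂ) ^ (n + 1)) (fun m hm => ?_)] at h
    · simp only [Finset.sum_const, Nat.card_Icc, nsmul_eq_mul, Nat.sub_self, pow_zero] at h
      push_cast at h
      simp only [mul_one] at h
      linear_combination -h
    · rw [Finset.mem_Icc] at hm
      rw [ih m (by omega) (by omega)]
      push_cast
      rw [← pow_add]
      congr 1
      omega

end LogarithmicDerivative

section CharacterSums

variable {F : Type*} [Field F] [Fintype F] {E : Type*} [CommRing E] [Algebra F E]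

theorem homogEval_eq_pow_mul {K : Type*} [Field K] {a b : K} (hb : b ≠ 0) (P : K[X]) :
    homogEval a b P = b ^ P.natDegree * P.eval (a / b) := by
  have h := scaleRoots_eval₂_mul (p := P) (RingHom.id K) (a / b) b
  simp only [RingHom.id_apply, mul_div_cancel₀ _ hb] at h
  exact h

theorem homogEval_zero_right {B : Type*} [CommRing B] (a : B) {P : B[X]} (hP : P.Monic) :
    homogEval a 0 P = a ^ P.natDegree := by
  rw [homogEval, scaleRoots_zero, hP.leadingCoeff, one_smul, eval_X_pow]

theorem dvd_of_not_isUnit_homogEval {F : Type*} [Field F] {E : Type*} [CommRing E] [Algebra F E]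
    {a b : E} {V : E[X]} {δ : F[X]} (hδ : δ ≠ 0)
    (hV : (C a - C b * X) * V = δ.map (algebraMap F E)) {p : F[X]} (hp : p.Monic)
    (hirr : Irreducible p) (h : ¬ IsUnit (homogEval a b (p.map (algebraMap F E)))) : p ∣ δ := by
  obtain ⟨I, hI, hmem⟩ := exists_max_ideal_of_mem_nonunits h
  let _ := Ideal.Quotient.field I
  let φ := Ideal.Quotient.mk I
  have hφ : φ.comp (algebraMap F E) = algebraMap F (E ⧸ I) := rfl
  have h0 : homogEval (φ a) (φ b) (p.map (algebraMap F (E ⧸ I))) = 0 := by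
    have := homogEval_map φ a b (hp.map (algebraMap F E))
    rwa [Polynomial.map_map, hφ, Ideal.Quotient.eq_zero_iff_mem.mpr hmem] at this
  have hV' : (C (φ a) - C (φ b) * X) * V.map φ = δ.map (algebraMap F (E ⧸ I)) := by
    have := congrArg (Polynomial.map φ) hV
    rw [Polynomial.map_map, hφ] at this
    simpa using this
  by_cases hb : φ b = 0
  · rw [hb, homogEval_zero_right _ (hp.map _)] at h0
    rw [hb, eq_zero_of_pow_eq_zero h0] at hV'
    simp only [map_zero, zero_mul, sub_zero] at hV'
    exact absurd ((Polynomial.map_eq_zero _).mp hV'.symm) hδ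
  · rw [homogEval_eq_pow_mul hb, mul_eq_zero, or_iff_right (pow_ne_zero _ hb)] at h0
    have h1 := congrArg (eval (φ a / φ b)) hV'
    rw [eval_mul] at h1
    simp only [eval_sub, eval_C, eval_mul, eval_X, mul_div_cancel₀ _ hb, sub_self, zero_mul,
      eval_map_algebraMap] at h1
    rw [eval_map_algebraMap] at h0
    rw [minpoly.eq_of_irreducible_of_monic hirr h0 hp]
    exact minpoly.dvd _ _ h1.symm

theorem isCoprime_of_monic_irreducible {F : Type*} [Field F] {p r : F[X]} (hp : p.Monic)
    (hpi : Irreducible p) (hr : r.Monic) (hri : Irreducible r) (hne : p ≠ r) : IsCoprime p r :=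
  (hpi.coprime_iff_not_dvd).mpr fun h =>
    hne (eq_of_monic_of_associated hp hr (hpi.associated_of_dvd hri h))

theorem sum_natDegree_not_isUnit_le {a b : E} {V : E[X]} {δ : F[X]} (hδ : δ ≠ 0)
    (hV : (C a - C b * X) * V = δ.map (algebraMap F E)) {m : ℕ} (hm : 0 < m)
    [DecidablePred fun p : F[X] => IsUnit (homogEval a b (p.map (algebraMap F E)))] :
    ∑ p ∈ primesDvd F m with ¬ IsUnit (homogEval a b (p.map (algebraMap F E))), p.natDegree ≤
      δ.natDegree := by
  rw [← natDegree_prod _ _ fun p hp =>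
    ((mem_primesDvd hm).mp (Finset.mem_filter.mp hp).1).1.ne_zero]
  refine natDegree_le_of_dvd (Finset.prod_dvd_of_coprime ?_ ?_) hδ
  · intro p hp r hr hne
    have hp := (mem_primesDvd hm).mp (Finset.mem_filter.mp hp).1
    have hr := (mem_primesDvd hm).mp (Finset.mem_filter.mp hr).1
    exact isCoprime_of_monic_irreducible hp.1 hp.2.1 hr.1 hr.2.1 hne
  · intro p hp
    rw [Finset.mem_filter] at hp
    have hp' := (mem_primesDvd hm).mp hp.1
    exact dvd_of_not_isUnit_homogEval hδ hV hp'.1 hp'.2.1 hp.2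

open scoped Classical in
/-- The weighted number of prime powers of degree `m` in the class of the unit `g`. -/
noncomputable def classCount (F : Type*) [Field F] [Fintype F] {E : Type*} [CommRing E]
    [Algebra F E] (a b : E) (m : ℕ) (g : Eˣ) : ℕ :=
  ∑ p ∈ primesDvd F m with homogEval a b (p.map (algebraMap F E)) ^ (m / p.natDegree) = g,
    p.natDegree

theorem exists_natDegree_eq_classCount (a b : E) {m : ℕ} (hm : 0 < m) (g : Eˣ) :
    ∃ D : F[X], D.natDegree = classCount F a b m g ∧ D ∣ X ^ Fintype.card F ^ m - X ∧
      D.map (algebraMap F E) ∣ (∏ i ∈ Finset.range m,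
        (C a - C b * X ^ Fintype.card F ^ i)) - C (g : E) := by
  classical
  set s := {p ∈ primesDvd F m | homogEval a b (p.map (algebraMap F E)) ^ (m / p.natDegree) = g}
    with hs
  have hmem : ∀ p ∈ s, p.Monic ∧ Irreducible p ∧ p.natDegree ∣ m := fun p hp =>
    (mem_primesDvd hm).mp (Finset.mem_filter.mp hp).1
  have hcop : ∀ p ∈ s, ∀ r ∈ s, p ≠ r → IsCoprime p r := fun p hp r hr hne =>
    isCoprime_of_monic_irreducible (hmem p hp).1 (hmem p hp).2.1 (hmem r hr).1 (hmem r hr).2.1 hne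
  refine ⟨∏ p ∈ s, p, ?_, ?_, ?_⟩
  · rw [natDegree_prod _ _ fun p hp => (hmem p hp).1.ne_zero, classCount, hs]
  · refine Finset.prod_dvd_of_coprime (fun p hp r hr hne => hcop p hp r hr hne) fun p hp => ?_
    rw [← Nat.card_eq_fintype_card]
    exact ((hmem p hp).2.1.natDegree_dvd_iff_dvd_X_pow_card_pow_sub_X).mp (hmem p hp).2.2
  · rw [Polynomial.map_prod]
    refine Finset.prod_dvd_of_coprime (fun p hp r hr hne =>
      (hcop p hp r hr hne).map (mapRingHom (algebraMap F E))) fun p hp => ?_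
    have h := map_dvd_prod_sub_homogEval_pow a b (hmem p hp).1 (hmem p hp).2.1 (hmem p hp).2.2
    rwa [(Finset.mem_filter.mp hp).2] at h

theorem sum_isUnit_eq_sum_classCount [Finite E] [Fintype Eˣ] (a b : E) {m : ℕ} (hm : 0 < m)
    [DecidablePred fun p : F[X] => IsUnit (homogEval a b (p.map (algebraMap F E)))]
    (φ : E → ℂ) :
    ∑ p ∈ primesDvd F m with IsUnit (homogEval a b (p.map (algebraMap F E))),
      (p.natDegree : ℂ) * φ (homogEval a b (p.map (algebraMap F E)) ^ (m / p.natDegree)) =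
    ∑ g : Eˣ, (classCount F a b m g : ℂ) * φ g := by
  classical
  have hpos : ∀ p ∈ primesDvd F m, m / p.natDegree ≠ 0 := fun p hp => by
    have h := (mem_primesDvd hm).mp hp
    exact (Nat.div_pos (Nat.le_of_dvd hm h.2.2) h.2.1.natDegree_pos).ne'
  have h1 : ∀ g : Eˣ, (classCount F a b m g : ℂ) * φ g = ∑ p ∈ primesDvd F m,
      if homogEval a b (p.map (algebraMap F E)) ^ (m / p.natDegree) = g then
        (p.natDegree : ℂ) * φ (homogEval a b (p.map (algebraMap F E)) ^ (m / p.natDegree))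
      else 0 := by
    intro g
    rw [classCount, Nat.cast_sum, Finset.sum_mul, Finset.sum_filter]
    refine Finset.sum_congr rfl fun p _ => ?_
    split_ifs with h
    · rw [h]
    · rfl
  simp_rw [h1]
  rw [Finset.sum_comm, Finset.sum_filter]
  refine Finset.sum_congr rfl fun p hp => ?_
  split_ifs with hu
  · obtain ⟨u, hu'⟩ := hu.pow (m / p.natDegree)
    rw [Finset.sum_eq_single u]
    · rw [if_pos hu'.symm]
    · intro g _ hg
      rw [if_neg]
      rw [← hu']
      exact fun h => hg (Units.ext h.symm)
    · simp
  · symm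
    refine Finset.sum_eq_zero fun g _ => if_neg fun h => hu ?_
    exact (isUnit_pow_iff (hpos p hp)).mp (h ▸ g.isUnit)

theorem card_pow_le_sum_classCount [Finite E] [Fintype Eˣ] {a b : E} {V : E[X]} {δ : F[X]}
    (hδ : δ ≠ 0) (hV : (C a - C b * X) * V = δ.map (algebraMap F E)) {m : ℕ} (hm : 0 < m) :
    Fintype.card F ^ m ≤ ∑ g : Eˣ, classCount F a b m g + δ.natDegree := by
  classical
  have h := sum_isUnit_eq_sum_classCount (F := F) a b hm (fun _ => 1)
  simp only [mul_one] at h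
  have h' : ∑ p ∈ primesDvd F m with IsUnit (homogEval a b (p.map (algebraMap F E))),
      p.natDegree = ∑ g : Eˣ, classCount F a b m g := by exact_mod_cast h
  rw [← sum_natDegree_primesDvd m hm, ← Finset.sum_filter_add_sum_filter_not _
    (fun p : F[X] => IsUnit (homogEval a b (p.map (algebraMap F E)))), h']
  exact Nat.add_le_add_left (sum_natDegree_not_isUnit_le hδ hV hm) _

end CharacterSums

section PrimePowerSumBound

theorem sum_abs_sub_le {ι : Type*} (s : Finset ι) (x : ι → ℝ) {A B : ℝ}
    (hx : ∀ i ∈ s, x i ≤ A) (hA : 0 ≤ A) (hB : -B ≤ ∑ i ∈ s, x i) :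
    ∑ i ∈ s, |x i| ≤ 2 * (s.card * A) + B := by
  have h : ∀ i ∈ s, |x i| ≤ 2 * A - x i := fun i hi => by
    have := hx i hi
    rw [abs_le]; constructor <;> linarith
  calc ∑ i ∈ s, |x i| ≤ ∑ i ∈ s, (2 * A - x i) := Finset.sum_le_sum h
    _ = 2 * (s.card * A) - ∑ i ∈ s, x i := by
      rw [Finset.sum_sub_distrib, Finset.sum_const, nsmul_eq_mul]; ring
    _ ≤ _ := by linarith

open scoped Classical in
/-- If the weights `N g` are close to equidistributed on a subgroup `H`, then so are their
character sums. -/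
theorem norm_sum_character_sub_le {G : Type*} [CommGroup G] [Fintype G] (H : Subgroup G)
    (N : G → ℕ) {Q R c d : ℝ} (hR : 1 ≤ R) (hc : 0 ≤ c) (hd : 0 ≤ d)
    (h1 : ∀ g ∈ H, (N g : ℝ) * Nat.card H ≤ Q + c * R) (h2 : ∀ g ∉ H, (N g : ℝ) ≤ c)
    (h3 : Q ≤ ∑ g, (N g : ℝ) + d) (χ : G →* ℂ) :
    ‖∑ g, (N g : ℂ) * χ g - (if ∀ g ∈ H, χ g = 1 then (Q : ℂ) else 0)‖ ≤
      (2 * c + 2 * Fintype.card G * c + d) * R := by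
  classical
  have hnorm : ∀ g, ‖χ g‖ = 1 := fun g =>
    Complex.norm_eq_one_of_pow_eq_one (n := Fintype.card G) (by
      rw [← map_pow, pow_card_eq_one, map_one]) Fintype.card_ne_zero
  set K : Finset G := {g | g ∈ H} with hK
  have hKc : (K.card : ℝ) = Nat.card H := by
    rw [hK, Nat.card_eq_fintype_card, Fintype.card_subtype]
  have hpos : (0 : ℝ) < Nat.card H := by exact_mod_cast Nat.card_pos
  have hmain : (if ∀ g ∈ H, χ g = 1 then (Q : ℂ) else 0) =
      ∑ g ∈ K, ((Q / Nat.card H : ℝ) : ℂ) * χ g := by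
    rw [← Finset.mul_sum]
    split_ifs with htriv
    · rw [Finset.sum_congr rfl (g := fun _ => 1) fun g hg => htriv g (by simpa [hK] using hg),
        Finset.sum_const, nsmul_eq_mul, mul_one]
      rw [← Complex.ofReal_natCast, hKc, ← Complex.ofReal_mul, div_mul_cancel₀ _ hpos.ne']
    · push Not at htriv
      obtain ⟨g₀, hg₀, hne⟩ := htriv
      have : ∑ g ∈ K, χ g = 0 := by
        have h : χ g₀ * ∑ g ∈ K, χ g = ∑ g ∈ K, χ g := by
          rw [Finset.mul_sum]
          refine Finset.sum_bij (fun g _ => g₀ * g) ?_ ?_ ?_ ?_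
          · intro g hg
            simp only [hK, Finset.mem_filter, Finset.mem_univ, true_and] at hg ⊢
            exact H.mul_mem hg₀ hg
          · intro g _ g' _ h; exact mul_left_cancel h
          · intro g hg
            simp only [hK, Finset.mem_filter, Finset.mem_univ, true_and] at hg ⊢
            exact ⟨g₀⁻¹ * g, H.mul_mem (H.inv_mem hg₀) hg, by simp⟩
          · intro g _; rw [map_mul]
        have h' : (χ g₀ - 1) * ∑ g ∈ K, χ g = 0 := by rw [sub_mul, h]; ring
        exact (mul_eq_zero.mp h').resolve_left (sub_ne_zero.mpr hne)
      rw [this, mul_zero]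
  have hsplit := Finset.sum_filter_add_sum_filter_not Finset.univ (· ∈ H)
    (fun g => (N g : ℂ) * χ g)
  have hsplitN := Finset.sum_filter_add_sum_filter_not Finset.univ (· ∈ H)
    (fun g => (N g : ℝ))
  have hout : ∑ g with g ∉ H, (N g : ℝ) ≤ Fintype.card G * c := by
    calc ∑ g with g ∉ H, (N g : ℝ) ≤ ∑ g with g ∉ H, c :=
          Finset.sum_le_sum fun g hg => h2 g (Finset.mem_filter.mp hg).2
      _ = ({g | g ∉ H} : Finset G).card * c := by rw [Finset.sum_const, nsmul_eq_mul]
      _ ≤ _ := by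
        refine mul_le_mul_of_nonneg_right ?_ hc
        exact_mod_cast Finset.card_le_univ _
  have hin : ∑ g ∈ K, |(N g : ℝ) - Q / Nat.card H| ≤
      2 * (K.card * (c * R / Nat.card H)) + (d + Fintype.card G * c) := by
    refine sum_abs_sub_le _ _ (fun g hg => ?_) (by positivity) ?_
    · rw [sub_le_iff_le_add, ← add_div, le_div_iff₀ hpos]
      linarith [h1 g (by simpa [hK] using hg)]
    · rw [Finset.sum_sub_distrib, Finset.sum_const, nsmul_eq_mul, hKc, mul_div_cancel₀ _ hpos.ne']
      linarith
  rw [hKc, mul_div_cancel₀ _ hpos.ne'] at hin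
  rw [hmain, ← hsplit, add_sub_right_comm, ← Finset.sum_sub_distrib]
  refine (norm_add_le _ _).trans ?_
  have hA : ‖∑ g ∈ K, ((N g : ℂ) * χ g - ((Q / Nat.card H : ℝ) : ℂ) * χ g)‖ ≤
      ∑ g ∈ K, |(N g : ℝ) - Q / Nat.card H| := by
    refine (norm_sum_le _ _).trans (Finset.sum_le_sum fun g _ => ?_)
    rw [← sub_mul, norm_mul, hnorm, mul_one, ← Complex.ofReal_natCast, ← Complex.ofReal_sub,
      Complex.norm_real, Real.norm_eq_abs]
  have hB : ‖∑ g with g ∉ H, (N g : ℂ) * χ g‖ ≤ ∑ g with g ∉ H, (N g : ℝ) := by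
    refine (norm_sum_le _ _).trans (Finset.sum_le_sum fun g _ => ?_)
    rw [norm_mul, hnorm, mul_one, Complex.norm_natCast]
  have hGc : 0 ≤ (Fintype.card G : ℝ) * c := by positivity
  calc _ ≤ 2 * (c * R) + (d + Fintype.card G * c) + Fintype.card G * c :=
        add_le_add (hA.trans hin) (hB.trans hout)
    _ ≤ _ := by nlinarith

variable {F : Type*} [Field F] [Fintype F] {E : Type*} [CommRing E] [Algebra F E]

/-- The prime power sums attached to a multiplicative character of `E` along the homogenized
evaluation at `(a, b)` satisfy the square-root bound, up to a possible pole at `1 / q`, along an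
arithmetic progression of degrees. -/
theorem exists_primePowerSum_bound [Finite E] {a b : E} {V : E[X]} {δ : F[X]}
    (hδ : δ ≠ 0) (hV : (C a - C b * X) * V = δ.map (algebraMap F E)) :
    ∃ (N : ℕ) (C₀ : ℝ), 0 < N ∧ ∀ χ : MulChar E ℂ, ∃ e : ℕ, (e = 0 ∨ e = 1) ∧ ∀ n : ℕ, 0 < n →
      ‖primePowerSum (fun f : F[X] => χ (homogEval a b (f.map (algebraMap F E)))) (2 * N * n) -
        e * (Fintype.card F : ℂ) ^ (2 * N * n)‖ ≤ C₀ * (Fintype.card F : ℝ) ^ (N * n) := by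
  classical
  let _ := Fintype.ofFinite E
  obtain ⟨H, N, c, hN, hH⟩ := exists_subgroup_bound hδ hV
  refine ⟨N, 2 * c + 2 * Fintype.card Eˣ * c + δ.natDegree, hN, fun χ => ?_⟩
  refine ⟨if ∀ g ∈ H, χ (g : E) = 1 then 1 else 0, by split_ifs <;> simp, fun n hn => ?_⟩
  have hm : 0 < 2 * N * n := by positivity
  have hsum : primePowerSum (fun f : F[X] => χ (homogEval a b (f.map (algebraMap F E))))
      (2 * N * n) = ∑ g : Eˣ, (classCount F a b (2 * N * n) g : ℂ) * χ g := by
    rw [← sum_isUnit_eq_sum_classCount a b hm χ, primePowerSum, Finset.sum_filter]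
    refine Finset.sum_congr rfl fun p hp => ?_
    have hp := (mem_primesDvd hm).mp hp
    rw [← map_pow]
    split_ifs with hu
    · rfl
    · rw [MulChar.map_nonunit, mul_zero]
      rwa [isUnit_pow_iff (Nat.div_pos (Nat.le_of_dvd hm hp.2.2) hp.2.1.natDegree_pos).ne']
  have hN1 : ∀ g ∈ H, (classCount F a b (2 * N * n) g : ℝ) * Nat.card H ≤
      (Fintype.card F : ℝ) ^ (2 * N * n) + c * (Fintype.card F : ℝ) ^ (N * n) := by
    intro g hg
    obtain ⟨D, hD, hD1, hD2⟩ := exists_natDegree_eq_classCount (F := F) a b hm g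
    rw [← hD]
    exact_mod_cast (hH n hn D hD1 g hD2).1 hg
  have hN2 : ∀ g ∉ H, (classCount F a b (2 * N * n) g : ℝ) ≤ c := by
    intro g hg
    obtain ⟨D, hD, hD1, hD2⟩ := exists_natDegree_eq_classCount (F := F) a b hm g
    rw [← hD]
    exact_mod_cast (hH n hn D hD1 g hD2).2 hg
  have hN3 : (Fintype.card F : ℝ) ^ (2 * N * n) ≤
      ∑ g : Eˣ, (classCount F a b (2 * N * n) g : ℝ) + δ.natDegree := by
    exact_mod_cast card_pow_le_sum_classCount hδ hV hm
  have h := norm_sum_character_sub_le H (fun g => classCount F a b (2 * N * n) g)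
    (one_le_pow₀ (by exact_mod_cast Fintype.one_lt_card.le)) (Nat.cast_nonneg c)
    (Nat.cast_nonneg _) hN1 hN2 hN3 ((χ : E →* ℂ).comp (Units.coeHom E))
  rw [hsum]
  convert h using 3
  · rfl
  · have : (∀ g ∈ H, ((χ : E →* ℂ).comp (Units.coeHom E)) g = 1) ↔ ∀ g ∈ H, χ (g : E) = 1 :=
      Iff.rfl
    simp only [this]
    split_ifs <;> simp

end PrimePowerSumBound

section PowerSums

/-- If weighted power sums with nonnegative integer weights are `O(R ^ j)`, then every number with
a positive weight has absolute value at most `R`. -/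
theorem norm_le_of_norm_sum_pow_le {ι : Type*} [Fintype ι] (w : ι → ℕ) (β : ι → ℂ) {C₀ R : ℝ}
    (hR : 0 < R) (h : ∀ j : ℕ, 0 < j → ‖∑ i, (w i : ℂ) * β i ^ j‖ ≤ C₀ * R ^ j) {i₀ : ι}
    (hi₀ : 0 < w i₀) : ‖β i₀‖ ≤ R := by
  classical
  set Q : ℂ[X] := ∏ γ ∈ (Finset.univ.image β).erase (β i₀), (X - C γ) with hQ
  have hQ0 : ∀ i, β i ≠ β i₀ → Q.eval (β i) = 0 := by
    intro i hi
    rw [hQ, eval_prod]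
    refine Finset.prod_eq_zero (i := β i) ?_ (by simp)
    simp [hi]
  have hQ1 : Q.eval (β i₀) ≠ 0 := by
    rw [hQ, eval_prod, Finset.prod_ne_zero_iff]
    intro γ hγ
    rw [eval_sub, eval_X, eval_C, sub_ne_zero]
    exact (Finset.ne_of_mem_erase hγ).symm
  set W : ℕ := ∑ i with β i = β i₀, w i with hW
  have hWpos : 0 < W := lt_of_lt_of_le hi₀
    (Finset.single_le_sum (fun i _ => Nat.zero_le (w i)) (by simp))
  have hkey : ∀ j : ℕ, (W : ℂ) * Q.eval (β i₀) * β i₀ ^ j =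
      ∑ k ∈ Finset.range (Q.natDegree + 1), Q.coeff k * ∑ i, (w i : ℂ) * β i ^ (j + k) := by
    intro j
    have h1 : ∑ i, (w i : ℂ) * β i ^ j * Q.eval (β i) = (W : ℂ) * Q.eval (β i₀) * β i₀ ^ j := by
      rw [hW, Nat.cast_sum, Finset.sum_mul, Finset.sum_mul, Finset.sum_filter]
      refine Finset.sum_congr rfl fun i _ => ?_
      split_ifs with hi
      · rw [hi]; ring
      · rw [hQ0 i hi, mul_zero]
    rw [← h1]
    simp_rw [eval_eq_sum_range, Finset.mul_sum]
    rw [Finset.sum_comm]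
    refine Finset.sum_congr rfl fun k _ => Finset.sum_congr rfl fun i _ => ?_
    rw [pow_add]; ring
  set B : ℝ := ∑ k ∈ Finset.range (Q.natDegree + 1), ‖Q.coeff k‖ * (C₀ * R ^ k) with hB
  have hbound : ∀ j : ℕ, 0 < j → (W : ℝ) * ‖Q.eval (β i₀)‖ * ‖β i₀‖ ^ j ≤ B * R ^ j := by
    intro j hj
    have h2 := congrArg norm (hkey j)
    rw [norm_mul, norm_mul, norm_pow, Complex.norm_natCast] at h2
    rw [h2, hB, Finset.sum_mul]
    refine (norm_sum_le _ _).trans (Finset.sum_le_sum fun k _ => ?_)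
    rw [norm_mul, mul_assoc]
    refine mul_le_mul_of_nonneg_left ((h (j + k) (by omega)).trans_eq ?_) (norm_nonneg _)
    rw [pow_add]; ring
  by_contra! hlt
  have hpos : 0 < (W : ℝ) * ‖Q.eval (β i₀)‖ :=
    mul_pos (by exact_mod_cast hWpos) (norm_pos_iff.mpr hQ1)
  have hgt : 1 < ‖β i₀‖ / R := (one_lt_div hR).mpr hlt
  obtain ⟨j, hj⟩ := pow_unbounded_of_one_lt (B / ((W : ℝ) * ‖Q.eval (β i₀)‖)) hgt
  have hj' : B / ((W : ℝ) * ‖Q.eval (β i₀)‖) < (‖β i₀‖ / R) ^ (j + 1) :=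
    hj.trans_le (pow_le_pow_right₀ hgt.le (Nat.le_succ j))
  rw [div_lt_iff₀ hpos, div_pow, div_mul_eq_mul_div, lt_div_iff₀ (by positivity)] at hj'
  have := hbound (j + 1) (Nat.succ_pos j)
  linarith [mul_comm (‖β i₀‖ ^ (j + 1)) ((W : ℝ) * ‖Q.eval (β i₀)‖)]

theorem exists_map_univ_val_eq {α : Type*} (s : Multiset α) {d : ℕ} (hs : s.card = d) :
    ∃ f : Fin d → α, Finset.univ.val.map f = s := by
  obtain ⟨l, rfl⟩ : ∃ l : List α, (l : Multiset α) = s := ⟨s.toList, s.coe_toList⟩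
  rw [Multiset.coe_card] at hs
  subst hs
  exact ⟨l.get, by rw [Fin.univ_val_map]; simp⟩

/-- A sequence with finite support and logarithmic derivative `S` has `S` equal to minus a power
sum of the inverse roots of its generating polynomial. -/
theorem exists_eq_neg_sum_pow {a S : ℕ → ℂ} {d : ℕ} (ha0 : a 0 = 1) (had : ∀ n, d < n → a n = 0)
    (hrec : ∀ n : ℕ, (n : ℂ) * a n = ∑ m ∈ Finset.Icc 1 n, S m * a (n - m)) :
    ∃ α : Fin d → ℂ, ∀ m, 0 < m → S m = -∑ i, α i ^ m := by
  set P : ℂ[X] := ∑ n ∈ Finset.range (d + 1), C (a n) * X ^ (d - n) with hP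
  have hcoeff : ∀ k ≤ d, P.coeff (d - k) = a k := by
    intro k hk
    rw [hP, finsetSum_coeff, Finset.sum_eq_single k]
    · simp
    · intro n hn hne
      rw [Finset.mem_range] at hn
      rw [coeff_C_mul_X_pow, if_neg (by omega)]
    · intro h; exact absurd (Finset.mem_range.mpr (by omega)) h
  have hdeg : P.natDegree = d := by
    refine natDegree_eq_of_le_of_coeff_ne_zero ?_ (n := d) ?_
    · refine natDegree_sum_le_of_forall_le _ _ fun n _ => ?_
      exact (natDegree_C_mul_X_pow_le _ _).trans (Nat.sub_le _ _)
    · rw [← Nat.sub_zero d, hcoeff 0 (Nat.zero_le d), ha0]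
      exact one_ne_zero
  have hlead : P.leadingCoeff = 1 := by
    rw [leadingCoeff, hdeg, ← Nat.sub_zero d, hcoeff 0 (Nat.zero_le d), ha0]
  have hcard : P.roots.card = P.natDegree := (IsAlgClosed.splits P).natDegree_eq_card_roots.symm
  obtain ⟨α, hα⟩ := exists_map_univ_val_eq P.roots (hcard.trans hdeg)
  have hesymm : ∀ k, (-1) ^ k * MvPolynomial.aeval α (MvPolynomial.esymm (Fin d) ℂ k) = a k := by
    intro k
    rw [MvPolynomial.aeval_esymm_eq_multiset_esymm, hα]
    rcases le_or_gt k d with hk | hk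
    · have h := coeff_eq_esymm_roots_of_card hcard (k := d - k) (by omega)
      rw [hcoeff k hk, hlead, hdeg, one_mul, Nat.sub_sub_self hk] at h
      exact h.symm
    · rw [had k hk, Multiset.esymm, Multiset.powersetCard_eq_empty]
      · simp
      · rw [hcard, hdeg]; exact hk
  have hpsum : ∀ k, MvPolynomial.aeval α (MvPolynomial.psum (Fin d) ℂ k) = ∑ i, α i ^ k := by
    intro k
    simp [MvPolynomial.psum]
  have hnewton : ∀ n : ℕ, (n : ℂ) * a n =
      ∑ m ∈ Finset.Icc 1 n, (-∑ i, α i ^ m) * a (n - m) := by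
    intro n
    have h := congrArg (MvPolynomial.aeval α) (MvPolynomial.mul_esymm_eq_sum (Fin d) ℂ n)
    simp only [map_mul, map_natCast, map_pow, map_neg, map_one, map_sum, hpsum] at h
    have h2 : (n : ℂ) * a n = -∑ x ∈ Finset.HasAntidiagonal.antidiagonal n with x.1 < n,
        a x.1 * ∑ i, α i ^ x.2 := by
      rw [← hesymm n, mul_left_comm, h, ← mul_assoc, pow_succ, ← mul_assoc, ← mul_pow]
      simp only [mul_neg, neg_mul, one_mul, neg_neg, one_pow, mul_one]
      congr 1
      refine Finset.sum_congr rfl fun x _ => ?_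
      rw [← hesymm x.1]
    rw [h2, ← Finset.sum_neg_distrib]
    refine Finset.sum_bij' (fun x _ => x.2) (fun m _ => (n - m, m)) ?_ ?_ ?_ ?_ ?_
    · intro x hx
      simp only [Finset.mem_filter, Finset.HasAntidiagonal.mem_antidiagonal, Finset.mem_Icc] at hx ⊢
      omega
    · intro m hm
      simp only [Finset.mem_filter, Finset.HasAntidiagonal.mem_antidiagonal, Finset.mem_Icc] at hm ⊢
      omega
    · intro x hx
      simp only [Finset.mem_filter, Finset.HasAntidiagonal.mem_antidiagonal] at hx
      ext <;> simp; omega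
    · intro m _; rfl
    · intro x hx
      simp only [Finset.mem_filter, Finset.HasAntidiagonal.mem_antidiagonal] at hx
      rw [show n - x.2 = x.1 by omega]
      ring
  refine ⟨α, fun m hm => ?_⟩
  induction m using Nat.strong_induction_on with
  | _ m ih =>
    obtain ⟨k, rfl⟩ : ∃ k, m = k + 1 := ⟨m - 1, by omega⟩
    have h := (hrec (k + 1)).symm.trans (hnewton (k + 1))
    rw [Finset.sum_Icc_succ_top (by omega), Finset.sum_Icc_succ_top (by omega),
      Finset.sum_congr rfl (g := fun m => (-∑ i, α i ^ m) * a (k + 1 - m)) (fun m hm => by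
        rw [Finset.mem_Icc] at hm
        rw [ih m (by omega) (by omega)])] at h
    simpa [ha0] using h

end PowerSums

section Majorant

theorem prod_max_one_div_le_exp {T : ℝ} (hT : 0 ≤ T) (n : ℕ) :
    ∏ k ∈ Finset.range n, max 1 (T / (k + 1 : ℕ)) ≤ Real.exp T := by
  have h1 : ∀ n : ℕ, (n : ℝ) ≤ T →
      ∏ k ∈ Finset.range n, max 1 (T / (k + 1 : ℕ)) = T ^ n / n.factorial := by
    intro n
    induction n with
    | zero => simp
    | succ n ih =>
      intro hn
      rw [Finset.prod_range_succ, ih (le_trans (by push_cast; linarith) hn), max_eq_right,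
        pow_succ, Nat.factorial_succ]
      · push_cast
        field_simp
      · rw [le_div_iff₀ (by positivity)]; linarith
  induction n with
  | zero => simpa using Real.one_le_exp hT
  | succ n ih =>
    rcases le_or_gt ((n + 1 : ℕ) : ℝ) T with h | h
    · rw [h1 _ h]
      exact Real.pow_div_factorial_le_exp T hT _
    · rw [Finset.prod_range_succ, max_eq_left, mul_one]
      · exact ih
      · rw [div_le_one (by positivity)]
        exact h.le

theorem le_exp_of_mul_le_sum {x σ : ℕ → ℝ} {T : ℝ} (hx : x 0 ≤ 1)
    (hσ : ∀ m, 0 ≤ σ m) (hT : ∀ n, ∑ m ∈ Finset.Icc 1 n, σ m ≤ T)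
    (hrec : ∀ n : ℕ, (n : ℝ) * x n ≤ ∑ m ∈ Finset.Icc 1 n, σ m * x (n - m)) (n : ℕ) :
    x n ≤ Real.exp T := by
  have hT0 : 0 ≤ T := by simpa using hT 0
  refine le_trans ?_ (prod_max_one_div_le_exp hT0 n)
  have hmono : Monotone fun n => ∏ k ∈ Finset.range n, max 1 (T / (k + 1 : ℕ)) := by
    refine monotone_nat_of_le_succ fun n => ?_
    rw [Finset.prod_range_succ]
    exact le_mul_of_one_le_right (Finset.prod_nonneg fun k _ => by positivity) (le_max_left _ _)
  induction n using Nat.strong_induction_on with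
  | _ n ih =>
    rcases n with _ | n
    · simpa using hx
    · have hpos : (0 : ℝ) < (n + 1 : ℕ) := by positivity
      have h1 : ((n + 1 : ℕ) : ℝ) * x (n + 1) ≤
          T * ∏ k ∈ Finset.range n, max 1 (T / (k + 1 : ℕ)) := by
        refine (hrec (n + 1)).trans (le_trans ?_ (mul_le_mul_of_nonneg_right (hT (n + 1))
          (Finset.prod_nonneg fun k _ => by positivity)))
        rw [Finset.sum_mul]
        refine Finset.sum_le_sum fun m hm => ?_
        rw [Finset.mem_Icc] at hm
        exact mul_le_mul_of_nonneg_left ((ih (n + 1 - m) (by omega)).trans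
          (hmono (by omega))) (hσ m)
      rw [Finset.prod_range_succ]
      have h2 : x (n + 1) ≤ (T / (n + 1 : ℕ)) *
          ∏ k ∈ Finset.range n, max 1 (T / (k + 1 : ℕ)) := by
        rw [div_mul_eq_mul_div, le_div_iff₀ hpos]
        linarith
      rw [mul_comm]
      exact h2.trans (mul_le_mul_of_nonneg_right (le_max_right _ _)
        (Finset.prod_nonneg fun k _ => by positivity))

/-- Coefficients of a power series whose logarithmic derivative satisfies a square-root bound
of conductor `D`. -/
theorem exists_norm_le_of_logDeriv_bound {q ε : ℝ} (hq : 1 < q) (hε : 0 < ε) :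
    ∃ C₀ : ℝ, 0 < C₀ ∧ ∀ (D : ℕ) (s d : ℕ → ℂ), d 0 = 1 →
      (∀ n : ℕ, (n : ℂ) * d n = ∑ m ∈ Finset.Icc 1 n, s m * d (n - m)) →
      (∀ m, 0 < m → ‖s m‖ ≤ q ^ m) → (∀ m, 0 < m → ‖s m‖ ≤ D * q ^ ((1 / 2 : ℝ) * m)) →
      ∀ n, ‖d n‖ ≤ C₀ * q ^ ((1 / 2 + ε) * n + ε * D) := by
  have hq0 : 0 < q := by linarith
  set r : ℝ := q ^ (-ε) with hr
  have hr0 : 0 < r := Real.rpow_pos_of_pos hq0 _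
  have hr1 : r < 1 := Real.rpow_lt_one_of_one_lt_of_neg hq (by linarith)
  have hη : 0 < ε * Real.log q := mul_pos hε (Real.log_pos hq)
  obtain ⟨M, hM⟩ := exists_pow_lt_of_lt_one (mul_pos hη (sub_pos.mpr hr1)) hr1
  set R : ℝ := q ^ (-(1 / 2 + ε)) with hR
  have hR0 : 0 < R := Real.rpow_pos_of_pos hq0 _
  refine ⟨Real.exp (∑ m ∈ Finset.range M, (q * R) ^ m), Real.exp_pos _,
    fun D s d hd0 hrec hs1 hs2 n => ?_⟩
  have hRpow : ∀ m : ℕ, q ^ ((1 / 2 : ℝ) * m) * R ^ m = r ^ m := by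
    intro m
    rw [hR, hr, ← Real.rpow_mul_natCast hq0.le, ← Real.rpow_mul_natCast hq0.le,
      ← Real.rpow_add hq0]
    congr 1; ring
  have hgeom : ∀ n, ∑ m ∈ Finset.Icc 1 n with M ≤ m, r ^ m ≤ ε * Real.log q := by
    intro n
    have hsub : ∑ m ∈ Finset.Icc 1 n with M ≤ m, r ^ m ≤
        ∑ i ∈ Finset.range (n + 1), r ^ (M + i) := by
      rw [← Finset.sum_image (s := Finset.range (n + 1)) (g := fun i => M + i) (f := fun m => r ^ m)
        (by intro i _ j _ h; simpa using h)]
      refine Finset.sum_le_sum_of_subset_of_nonneg ?_ fun _ _ _ => by positivity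
      intro m hm
      simp only [Finset.mem_filter, Finset.mem_Icc, Finset.mem_image, Finset.mem_range] at hm ⊢
      exact ⟨m - M, by omega, by omega⟩
    refine hsub.trans ?_
    simp_rw [pow_add]
    rw [← Finset.mul_sum, geom_sum_eq hr1.ne]
    have h1 : (r ^ (n + 1) - 1) / (r - 1) ≤ 1 / (1 - r) := by
      rw [← neg_div_neg_eq, neg_sub, neg_sub]
      exact div_le_div_of_nonneg_right (by linarith [pow_pos hr0 (n + 1)]) (by linarith)
    calc r ^ M * ((r ^ (n + 1) - 1) / (r - 1)) ≤ r ^ M * (1 / (1 - r)) :=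
          mul_le_mul_of_nonneg_left h1 (by positivity)
      _ ≤ (ε * Real.log q * (1 - r)) * (1 / (1 - r)) :=
          mul_le_mul_of_nonneg_right hM.le (by rw [one_div, inv_nonneg]; linarith)
      _ = ε * Real.log q := by
          rw [mul_assoc, mul_one_div_cancel (by linarith), mul_one]
  have hx := le_exp_of_mul_le_sum (x := fun n => ‖d n‖ * R ^ n) (σ := fun m => ‖s m‖ * R ^ m)
    (T := (∑ m ∈ Finset.range M, (q * R) ^ m) + D * (ε * Real.log q)) (by simp [hd0])
    (fun m => by positivity) ?_ ?_ n
  · have hexp : Real.exp ((∑ m ∈ Finset.range M, (q * R) ^ m) + D * (ε * Real.log q)) =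
        Real.exp (∑ m ∈ Finset.range M, (q * R) ^ m) * q ^ (ε * D) := by
      rw [Real.exp_add, Real.rpow_def_of_pos hq0]
      congr 2; ring
    rw [hexp] at hx
    have hRn : R ^ n = (q ^ ((1 / 2 + ε) * n))⁻¹ := by
      rw [hR, ← Real.rpow_mul_natCast hq0.le, ← Real.rpow_neg hq0.le]
      congr 1; ring
    rw [hRn, ← div_eq_mul_inv, div_le_iff₀ (by positivity)] at hx
    rw [Real.rpow_add hq0]
    linarith
  · intro n
    rw [← Finset.sum_filter_not_add_sum_filter (Finset.Icc 1 n) (M ≤ ·)]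
    refine add_le_add ?_ ?_
    · calc ∑ m ∈ Finset.Icc 1 n with ¬ M ≤ m, ‖s m‖ * R ^ m
          ≤ ∑ m ∈ Finset.Icc 1 n with ¬ M ≤ m, (q * R) ^ m := by
            refine Finset.sum_le_sum fun m hm => ?_
            simp only [Finset.mem_filter, Finset.mem_Icc] at hm
            rw [mul_pow]
            exact mul_le_mul_of_nonneg_right (hs1 m (by omega)) (by positivity)
        _ ≤ _ := by
            refine Finset.sum_le_sum_of_subset_of_nonneg ?_ fun _ _ _ => by positivity
            intro m hm
            simp only [Finset.mem_filter, Finset.mem_Icc, Finset.mem_range] at hm ⊢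
            omega
    · calc ∑ m ∈ Finset.Icc 1 n with M ≤ m, ‖s m‖ * R ^ m
          ≤ ∑ m ∈ Finset.Icc 1 n with M ≤ m, D * r ^ m := by
            refine Finset.sum_le_sum fun m hm => ?_
            simp only [Finset.mem_filter, Finset.mem_Icc] at hm
            rw [← hRpow, ← mul_assoc]
            exact mul_le_mul_of_nonneg_right (hs2 m (by omega)) (by positivity)
        _ ≤ _ := by
            rw [← Finset.mul_sum]
            exact mul_le_mul_of_nonneg_left (hgeom n) (Nat.cast_nonneg D)
  · intro n
    have h := congrArg norm (hrec n)
    rw [norm_mul, Complex.norm_natCast] at h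
    rw [← mul_assoc, h]
    refine (mul_le_mul_of_nonneg_right (norm_sum_le _ _) (by positivity)).trans_eq ?_
    rw [Finset.sum_mul]
    refine Finset.sum_congr rfl fun m hm => ?_
    rw [Finset.mem_Icc] at hm
    rw [norm_mul, show R ^ n = R ^ m * R ^ (n - m) by rw [← pow_add]; congr 1; omega]
    ring

end Majorant

section Combination

/-- Sums over monic polynomials against a polynomial `L`-function: the square-root bound along an
arithmetic progression propagates to all exponents. -/
theorem norm_le_of_bound_progression {q : ℝ} (hq : 1 < q) {a S : ℕ → ℂ} {D : ℕ} (ha0 : a 0 = 1)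
    (had : ∀ n, D < n → a n = 0)
    (hrec : ∀ n : ℕ, (n : ℂ) * a n = ∑ m ∈ Finset.Icc 1 n, S m * a (n - m))
    {N e : ℕ} {C₀ : ℝ} (hN : 0 < N)
    (h : ∀ n, 0 < n → ‖S (2 * N * n) - e * (q : ℂ) ^ (2 * N * n)‖ ≤ C₀ * q ^ (N * n)) (m : ℕ)
    (hm : 0 < m) : ‖S m‖ ≤ D * q ^ ((1 / 2 : ℝ) * m) := by
  have hq0 : 0 < q := by linarith
  obtain ⟨α, hα⟩ := exists_eq_neg_sum_pow ha0 had hrec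
  have hle : ∀ i, ‖α i‖ ≤ q ^ (1 / 2 : ℝ) := by
    intro i
    have h1 := norm_le_of_norm_sum_pow_le (ι := Option (Fin D)) (fun o => o.elim e fun _ => 1)
      (fun o => o.elim ((q : ℂ) ^ (2 * N)) fun i => α i ^ (2 * N)) (C₀ := C₀) (R := q ^ N)
      (pow_pos hq0 N) (fun j hj => ?_) (i₀ := some i) (by simp)
    · simp only [Option.elim_some, norm_pow] at h1
      rw [mul_comm 2 N, pow_mul', ] at h1
      have h2 := (pow_le_pow_iff_left₀ (by positivity) hq0.le hN.ne').mp h1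
      rw [← Real.sqrt_eq_rpow]
      exact Real.le_sqrt_of_sq_le h2
    · rw [Fintype.sum_option]
      simp only [Option.elim_none, Option.elim_some, Nat.cast_one, one_mul, ← pow_mul]
      have h3 := h j hj
      rw [hα _ (by positivity), ← norm_neg, neg_sub, sub_neg_eq_add] at h3
      exact h3
  rw [hα m hm, norm_neg]
  refine (norm_sum_le _ _).trans ((Finset.sum_le_sum fun i _ => ?_).trans_eq
    (by rw [Finset.sum_const, Finset.card_univ, Fintype.card_fin, nsmul_eq_mul]))
  rw [norm_pow, Real.rpow_mul_natCast hq0.le]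
  exact pow_le_pow_left₀ (norm_nonneg _) (hle i) m

/-- Dividing a power series by `1 - q u` adds `q ^ m` to its logarithmic derivative. -/
theorem nat_mul_eq_sum_pow_sub {q : ℂ} {c d S : ℕ → ℂ} (hd0 : d 0 = c 0)
    (hd : ∀ n, d (n + 1) = c (n + 1) + q * d n)
    (hrec : ∀ n : ℕ, (n : ℂ) * c n = -∑ m ∈ Finset.Icc 1 n, S m * c (n - m)) (n : ℕ) :
    (n : ℂ) * d n = ∑ m ∈ Finset.Icc 1 n, (q ^ m - S m) * d (n - m) := by
  have hq : ∀ n, ∑ m ∈ Finset.Icc 1 (n + 1), q ^ m * d (n + 1 - m) =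
      q * d n + q * ∑ m ∈ Finset.Icc 1 n, q ^ m * d (n - m) := by
    intro n
    rw [← Finset.add_sum_Ioc_eq_sum_Icc (by omega : 1 ≤ n + 1), pow_one, Nat.add_sub_cancel,
      Finset.mul_sum]
    congr 1
    symm
    refine Finset.sum_bij (fun m _ => m + 1) ?_ ?_ ?_ ?_
    · intro m hm
      simp only [Finset.mem_Icc, Finset.mem_Ioc] at hm ⊢
      omega
    · intro m _ m' _ h; omega
    · intro m hm
      simp only [Finset.mem_Ioc] at hm
      exact ⟨m - 1, by rw [Finset.mem_Icc]; omega, by omega⟩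
    · intro m _
      rw [Nat.add_sub_add_right, pow_succ]; ring
  have hS : ∀ n, ∑ m ∈ Finset.Icc 1 (n + 1), S m * d (n + 1 - m) =
      ∑ m ∈ Finset.Icc 1 (n + 1), S m * c (n + 1 - m) +
        q * ∑ m ∈ Finset.Icc 1 n, S m * d (n - m) := by
    intro n
    rw [Finset.sum_Icc_succ_top (by omega), Finset.sum_Icc_succ_top (by omega), Nat.sub_self, hd0,
      Finset.mul_sum, add_right_comm, ← Finset.sum_add_distrib]
    congr 1
    refine Finset.sum_congr rfl fun m hm => ?_
    rw [Finset.mem_Icc] at hm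
    rw [show n + 1 - m = (n - m) + 1 by omega, hd]
    ring
  simp_rw [sub_mul, Finset.sum_sub_distrib]
  induction n with
  | zero => simp
  | succ n ih =>
    rw [hq, hS, hd, mul_add, hrec (n + 1)]
    push_cast
    linear_combination q * ih

end Combination

section HomogMap

variable {F : Type*} [Field F] {E : Type*} [CommRing E] [Algebra F E]

/-- Evaluation at `(a, b)` of the degree `n - 1` homogenization of `lowPoly F n x`. -/
noncomputable def homogMap (F : Type*) [Field F] {E : Type*} [CommRing E] [Algebra F E] (a b : E)
    (n : ℕ) : (Fin n → F) →ₗ[F] E :=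
  Fintype.linearCombination F fun i : Fin n => a ^ (i : ℕ) * b ^ (n - 1 - i)

theorem homogMap_eq_sum_range (a b : E) {n : ℕ} {f : F[X]} {x : Fin n → F}
    (hx : lowPoly F n x = f) :
    homogMap F a b n x =
      ∑ i ∈ Finset.range n, algebraMap F E (f.coeff i) * (a ^ i * b ^ (n - 1 - i)) := by
  subst hx
  rw [homogMap, Fintype.linearCombination_apply, Finset.sum_range]
  refine Finset.sum_congr rfl fun i _ => ?_
  rw [coeff_lowPoly, Algebra.smul_def]

theorem homogEval_eq_sum_range {B : Type*} [CommRing B] (a b : B) (P : B[X]) :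
    homogEval a b P =
      ∑ i ∈ Finset.range (P.natDegree + 1), P.coeff i * (a ^ i * b ^ (P.natDegree - i)) := by
  rw [homogEval, eval_eq_sum_range, natDegree_scaleRoots]
  refine Finset.sum_congr rfl fun i _ => ?_
  rw [coeff_scaleRoots]; ring

theorem homogEval_map_eq_sum_range (a b : E) {f : F[X]} (hf : f.Monic) :
    homogEval a b (f.map (algebraMap F E)) = ∑ i ∈ Finset.range (f.natDegree + 1),
      algebraMap F E (f.coeff i) * (a ^ i * b ^ (f.natDegree - i)) := by
  nontriviality E
  rw [homogEval_eq_sum_range, hf.natDegree_map]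
  simp_rw [coeff_map]

theorem homogEval_X_pow_add_lowPoly (a b : E) (n : ℕ) (x : Fin n → F) :
    homogEval a b ((X ^ n + lowPoly F n x).map (algebraMap F E)) =
      a ^ n + b * homogMap F a b n x := by
  have hlt := degree_lowPoly_lt (F := F) n x
  have hmonic : (X ^ n + lowPoly F n x).Monic := monic_X_pow_add hlt
  have hdeg : (X ^ n + lowPoly F n x).natDegree = n := by
    rw [natDegree_add_eq_left_of_degree_lt (by rwa [degree_X_pow]), natDegree_X_pow]
  rw [homogEval_map_eq_sum_range a b hmonic, hdeg, Finset.sum_range_succ,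
    homogMap_eq_sum_range a b rfl, add_comm, Finset.mul_sum]
  congr 1
  · rw [coeff_add, coeff_X_pow_self, coeff_eq_zero_of_degree_lt hlt]
    simp
  · refine Finset.sum_congr rfl fun i hi => ?_
    rw [Finset.mem_range] at hi
    rw [coeff_add, coeff_X_pow, if_neg hi.ne, zero_add, show n - i = (n - 1 - i) + 1 by omega,
      pow_succ]
    ring

theorem homogMap_C_mul (a b : E) {n : ℕ} {c : F} {f : F[X]} (hf : f.Monic) (hn : f.natDegree < n)
    {x : Fin n → F} (hx : lowPoly F n x = C c * f) :
    homogMap F a b n x = algebraMap F E c * b ^ (n - 1 - f.natDegree) *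
      homogEval a b (f.map (algebraMap F E)) := by
  rw [homogMap_eq_sum_range a b hx, homogEval_map_eq_sum_range a b hf, Finset.mul_sum,
    ← Finset.sum_range_add_sum_Ico _ (by omega : f.natDegree + 1 ≤ n),
    Finset.sum_eq_zero (s := Finset.Ico _ _), add_zero]
  · refine Finset.sum_congr rfl fun i hi => ?_
    rw [Finset.mem_range] at hi
    rw [show n - 1 - i = (n - 1 - f.natDegree) + (f.natDegree - i) by omega, coeff_C_mul, map_mul,
      pow_add]
    ring
  · intro i hi
    rw [Finset.mem_Ico] at hi
    rw [coeff_C_mul, coeff_eq_zero_of_natDegree_lt (by omega)]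
    simp

theorem sum_comp_eq_card_ker_mul_sum {G H : Type*} [AddCommGroup G] [AddCommGroup H] [Fintype G]
    [Fintype H] (φ : G →+ H) (hφ : Function.Surjective φ) (u : H → ℂ) :
    ∑ x, u (φ x) = (Nat.card φ.ker : ℂ) * ∑ z, u z := by
  classical
  rw [← Finset.sum_fiberwise (s := Finset.univ) (g := φ), Finset.mul_sum]
  refine Finset.sum_congr rfl fun z _ => ?_
  rw [Finset.sum_congr rfl (g := fun _ => u z) (fun x hx => by
    rw [(Finset.mem_filter.mp hx).2]), Finset.sum_const, nsmul_eq_mul]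
  congr 2
  rw [AddMonoidHom.card_fiber_eq_of_mem_range φ (hφ z) (hφ 0), Nat.card_eq_fintype_card,
    Fintype.card_subtype]
  simp only [AddMonoidHom.mem_ker]

end HomogMap

section LFunctionBound

variable {F : Type*} [Field F] {E : Type*} [CommRing E] [Algebra F E]

theorem MulChar.norm_apply_isUnit [Finite E] (χ : MulChar E ℂ) {x : E} (hx : IsUnit x) :
    ‖χ x‖ = 1 := by
  obtain ⟨u, rfl⟩ := hx
  exact Complex.norm_eq_one_of_pow_eq_one (n := Nat.card Eˣ)
    (by rw [← map_pow, ← Units.val_pow_eq_pow_val, pow_card_eq_one', Units.val_one, map_one])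
    Nat.card_pos.ne'

theorem MulChar.norm_apply_le_one [Finite E] (χ : MulChar E ℂ) (x : E) : ‖χ x‖ ≤ 1 := by
  by_cases hx : IsUnit x
  · exact (χ.norm_apply_isUnit hx).le
  · rw [χ.map_nonunit hx, norm_zero]; exact zero_le_one

/-- If the homogenization of `δ` vanishes at `(a, b)` and `a`, `b` are coprime, then `a - b X`
divides `δ`. -/
theorem dvd_map_of_homogMap_eq_zero {a b y : E} (hab : a + b * y = 1) {n : ℕ} {x : Fin (n + 1) → F}
    {f : F[X]} (hf : lowPoly F (n + 1) x = f) (hx : homogMap F a b (n + 1) x = 0) :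
    C a - C b * X ∣ f.map (algebraMap F E) := by
  subst hf
  have hcop : IsCoprime (C a - C b * X) (C b ^ n : E[X]) := by
    refine IsCoprime.pow_right ⟨1, X + C y, ?_⟩
    rw [one_mul, ← map_one C, ← hab, map_add, map_mul]
    ring
  refine hcop.dvd_of_dvd_mul_left ?_
  have hsum : C b ^ n * (lowPoly F (n + 1) x).map (algebraMap F E) =
      ∑ i ∈ Finset.range (n + 1), C (algebraMap F E ((lowPoly F (n + 1) x).coeff i)) * C b ^ (n - i)
        * (C b * X) ^ i := by
    have hdeg : ((lowPoly F (n + 1) x).map (algebraMap F E)).natDegree < n + 1 :=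
      natDegree_map_le.trans_lt (Nat.lt_succ_of_le
        (natDegree_le_of_degree_le (Order.le_of_lt_succ (degree_lowPoly_lt _ x))))
    conv_lhs => rw [as_sum_range' _ (n + 1) hdeg, Finset.mul_sum]
    refine Finset.sum_congr rfl fun i hi => ?_
    rw [Finset.mem_range] at hi
    rw [← C_mul_X_pow_eq_monomial, coeff_map, mul_pow]
    rw [show (C b : E[X]) ^ n = C b ^ (n - i) * C b ^ i by rw [← pow_add]; congr 1; omega]
    ring
  have hzero : ∑ i ∈ Finset.range (n + 1), C (algebraMap F E ((lowPoly F (n + 1) x).coeff i)) *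
      C b ^ (n - i) * C a ^ i = 0 := by
    rw [homogMap_eq_sum_range a b rfl] at hx
    have h := congrArg C hx
    rw [map_sum, map_zero] at h
    rw [← h]
    refine Finset.sum_congr rfl fun i _ => ?_
    rw [Nat.add_sub_cancel, map_mul, map_mul, map_pow, map_pow]
    ring
  rw [hsum, ← sub_zero (∑ i ∈ Finset.range (n + 1), _), ← hzero, ← Finset.sum_sub_distrib]
  refine Finset.dvd_sum fun i _ => ?_
  rw [← mul_sub]
  refine Dvd.dvd.mul_left ?_ _
  rw [dvd_sub_comm]
  exact sub_dvd_pow_sub_pow _ _ _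

variable [Fintype F]

theorem norm_primePowerSum_le {h : F[X] → ℂ} (hh : ∀ f, ‖h f‖ ≤ 1) {m : ℕ} (hm : 0 < m) :
    ‖primePowerSum h m‖ ≤ (Fintype.card F : ℝ) ^ m := by
  refine (norm_sum_le _ _).trans ?_
  rw [← Nat.cast_pow, ← sum_natDegree_primesDvd m hm, Nat.cast_sum]
  refine Finset.sum_le_sum fun p _ => ?_
  rw [norm_mul, norm_pow, Complex.norm_natCast]
  exact mul_le_of_le_one_right (Nat.cast_nonneg _) (pow_le_one₀ (norm_nonneg _) (hh p))

theorem sum_mulChar_one_add_mul_eq_zero [Fintype E] {χ : MulChar E ℂ} {b z₀ : E}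
    (hu : IsUnit (1 + b * z₀)) (hχ : χ (1 + b * z₀) ≠ 1) : ∑ z, χ (1 + b * z) = 0 := by
  have h : χ (1 + b * z₀) * ∑ z, χ (1 + b * z) = ∑ z, χ (1 + b * z) := by
    rw [Finset.mul_sum]
    let σ : E ≃ E := (Units.mulLeft hu.unit).trans (Equiv.addLeft z₀)
    rw [← Equiv.sum_comp σ fun z => χ (1 + b * z)]
    refine Finset.sum_congr rfl fun z _ => ?_
    rw [← map_mul]
    congr 1
    simp only [σ, Equiv.trans_apply, Equiv.coe_addLeft, Units.mulLeft_apply, IsUnit.unit_spec]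
    ring
  exact (mul_left_eq_self₀.mp h).resolve_left hχ

theorem exists_pow_eq_one_add_mul {a b y : E} (hab : a + b * y = 1) (n : ℕ) :
    ∃ z, a ^ n = 1 + b * z := by
  have h : b ∣ a ^ n - 1 := by
    refine Dvd.dvd.trans ⟨-y, ?_⟩ (sub_one_dvd_pow_sub_one a n)
    rw [← hab]; ring
  obtain ⟨z, hz⟩ := h
  exact ⟨z, by rw [← hz]; ring⟩

theorem sum_monicFinset_mulChar_eq_zero [Finite E] {a b y : E} (hab : a + b * y = 1) {n : ℕ}
    (hsurj : Function.Surjective (homogMap F a b n)) {χ : MulChar E ℂ} {z₀ : E}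
    (hu : IsUnit (1 + b * z₀)) (hχ : χ (1 + b * z₀) ≠ 1) :
    ∑ f ∈ monicFinset F n, χ (homogEval a b (f.map (algebraMap F E))) = 0 := by
  let _ := Fintype.ofFinite E
  obtain ⟨z₁, hz₁⟩ := exists_pow_eq_one_add_mul hab n
  rw [sum_monicFinset]
  simp_rw [homogEval_X_pow_add_lowPoly, hz₁, add_assoc, ← mul_add]
  have h := sum_comp_eq_card_ker_mul_sum (homogMap F a b n).toAddMonoidHom hsurj
    (fun z => χ (1 + b * (z₁ + z)))
  refine h.trans ?_
  have h' := Equiv.sum_comp (Equiv.addLeft z₁) fun z => χ (1 + b * z)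
  simp only [Equiv.coe_addLeft] at h'
  rw [h', sum_mulChar_one_add_mul_eq_zero hu hχ, mul_zero]

theorem exists_norm_sum_polyMu_mulChar_le.{u, v} (F : Type u) [Field F] [Fintype F] {ε : ℝ}
    (hε : 0 < ε) :
    ∃ C₀ : ℝ, 0 < C₀ ∧ ∀ (E : Type v) [CommRing E] [Algebra F E] [Finite E] (a b y : E) (D : ℕ)
      (δ : F[X]), a + b * y = 1 → δ ≠ 0 → δ.natDegree ≤ D →
      C a - C b * X ∣ δ.map (algebraMap F E) →
      (∀ n, D < n → Function.Surjective (homogMap F a b n)) →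
      ∀ (χ : MulChar E ℂ) (n : ℕ),
        ‖∑ f ∈ monicFinset F n, (polyMu f : ℂ) * χ (homogEval a b (f.map (algebraMap F E)))‖ ≤
          C₀ * (Fintype.card F : ℝ) ^ ((1 / 2 + ε) * n + ε * D) := by
  classical
  set q : ℝ := (Fintype.card F : ℝ) with hq
  have hq1 : 1 < q := by rw [hq]; exact_mod_cast Fintype.one_lt_card
  have hq0 : 0 < q := by linarith
  obtain ⟨C₀, hC₀, hbound⟩ := exists_norm_le_of_logDeriv_bound hq1 hε
  refine ⟨C₀ * (1 + q), by positivity, fun E _ _ _ a b y D δ hab hδ hδD hdvd hsurj χ n => ?_⟩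
  obtain ⟨V, hV⟩ := hdvd
  set h : F[X] → ℂ := fun f => χ (homogEval a b (f.map (algebraMap F E))) with hh
  have hmul : ∀ f g : F[X], f.Monic → g.Monic → h (f * g) = h f * h g := fun f g hf hg => by
    simp only [hh]
    rw [Polynomial.map_mul, homogEval_mul _ _ (hf.map _) (hg.map _), map_mul]
  have hone : h 1 = 1 := by
    simp only [hh]
    rw [Polynomial.map_one, homogEval_one, map_one]
  have hle : ∀ f, ‖h f‖ ≤ 1 := fun f => χ.norm_apply_le_one _
  set c : ℕ → ℂ := fun n => ∑ f ∈ monicFinset F n, (polyMu f : ℂ) * h f with hc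
  have hc0 : c 0 = 1 := by simp [hc, monicFinset_zero, polyMu_one, hone]
  have hcrec : ∀ n : ℕ, (n : ℂ) * c n =
      -∑ m ∈ Finset.Icc 1 n, primePowerSum h m * c (n - m) := nat_mul_sum_monicFinset_polyMu hmul
  by_cases hχ : ∀ z, IsUnit (1 + b * z) → χ (1 + b * z) = 1
  · have hval : ∀ f : F[X], f.Monic →
        h f = if IsUnit (homogEval a b (f.map (algebraMap F E))) then 1 else 0 := by
      intro f hf
      obtain ⟨x, hx⟩ : ∃ x, X ^ f.natDegree + lowPoly F f.natDegree x = f := by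
        refine ⟨fun i => (f - X ^ f.natDegree).coeff i, ?_⟩
        rw [lowPoly_coeff, add_sub_cancel]
        rw [← degree_eq_natDegree hf.ne_zero]
        exact degree_sub_lt_left (by rw [degree_X_pow, degree_eq_natDegree hf.ne_zero]) hf.ne_zero
          (by rw [hf.leadingCoeff, (monic_X_pow _).leadingCoeff])
      obtain ⟨z, hz⟩ := exists_pow_eq_one_add_mul hab f.natDegree
      have hθ : homogEval a b (f.map (algebraMap F E)) =
          1 + b * (z + homogMap F a b f.natDegree x) := by
        conv_lhs => rw [← hx]
        rw [homogEval_X_pow_add_lowPoly, hz]; ring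
      simp only [hh]
      split_ifs with hu
      · rw [hθ] at hu ⊢
        exact hχ _ hu
      · exact χ.map_nonunit hu
    have hdefect : ∀ m, 0 < m → (q : ℂ) ^ m - primePowerSum h m =
        ((∑ p ∈ primesDvd F m with ¬ IsUnit (homogEval a b (p.map (algebraMap F E))),
          p.natDegree : ℕ) : ℂ) := by
      intro m hm
      rw [hq, Complex.ofReal_natCast, ← Nat.cast_pow, ← sum_natDegree_primesDvd m hm, primePowerSum,
        Nat.cast_sum, Nat.cast_sum, ← Finset.sum_sub_distrib, Finset.sum_filter]
      refine Finset.sum_congr rfl fun p hp => ?_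
      have hp := (mem_primesDvd hm).mp hp
      rw [hval p hp.1]
      have hne : m / p.natDegree ≠ 0 :=
        (Nat.div_pos (Nat.le_of_dvd hm hp.2.2) hp.2.1.natDegree_pos).ne'
      split_ifs with hu
      · simp
      · rw [zero_pow hne, mul_zero, sub_zero]
    set d : ℕ → ℂ := fun n => ∑ i ∈ Finset.range (n + 1), (q : ℂ) ^ (n - i) * c i with hd
    have hd0 : d 0 = c 0 := by simp [hd]
    have hdsucc : ∀ n, d (n + 1) = c (n + 1) + q * d n := by
      intro n
      simp only [hd]
      rw [Finset.sum_range_succ, Nat.sub_self, pow_zero, one_mul, add_comm, Finset.mul_sum]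
      congr 1
      refine Finset.sum_congr rfl fun i hi => ?_
      rw [Finset.mem_range] at hi
      rw [show n + 1 - i = (n - i) + 1 by omega, pow_succ]; ring
    have hdn := hbound D (fun m => (q : ℂ) ^ m - primePowerSum h m) d (hd0.trans hc0)
      (nat_mul_eq_sum_pow_sub hd0 hdsucc hcrec) (fun m hm => ?_) (fun m hm => ?_)
    · have hdn' : ‖c n‖ ≤ ‖d n‖ + q * (C₀ * q ^ ((1 / 2 + ε) * n + ε * D)) := by
        rcases n with _ | n
        · rw [hd0]
          exact le_add_of_nonneg_right (by positivity)
        · rw [show c (n + 1) = d (n + 1) - q * d n by rw [hdsucc]; ring]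
          refine (norm_sub_le _ _).trans (add_le_add le_rfl ?_)
          rw [norm_mul, Complex.norm_real, Real.norm_of_nonneg hq0.le]
          refine mul_le_mul_of_nonneg_left ((hdn n).trans (mul_le_mul_of_nonneg_left
            (Real.rpow_le_rpow_of_exponent_le hq1.le ?_) hC₀.le)) hq0.le
          push_cast
          nlinarith
      calc ‖c n‖ ≤ _ := hdn'
        _ ≤ C₀ * q ^ ((1 / 2 + ε) * n + ε * D) + q * (C₀ * q ^ ((1 / 2 + ε) * n + ε * D)) :=
            add_le_add (hdn n) le_rfl
        _ = _ := by ring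
    · rw [hdefect m hm, Complex.norm_natCast, hq, ← Nat.cast_pow, ← sum_natDegree_primesDvd m hm]
      exact_mod_cast Finset.sum_le_sum_of_subset (Finset.filter_subset _ _)
    · rw [hdefect m hm, Complex.norm_natCast]
      refine le_trans (Nat.cast_le.mpr ((sum_natDegree_not_isUnit_le hδ hV.symm hm).trans hδD)) ?_
      exact le_mul_of_one_le_right (Nat.cast_nonneg D)
        (Real.one_le_rpow hq1.le (by positivity))
  · push Not at hχ
    obtain ⟨z₀, hu, hz₀⟩ := hχ
    obtain ⟨N, K, hN, hprog⟩ := exists_primePowerSum_bound hδ hV.symm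
    obtain ⟨e, -, he⟩ := hprog χ
    have hS := norm_le_of_bound_progression hq1 (a := fun n => ∑ f ∈ monicFinset F n, h f)
      (S := primePowerSum h) (D := D) (by simp [monicFinset_zero, hone])
      (fun n hn => sum_monicFinset_mulChar_eq_zero hab (hsurj n hn) hu hz₀)
      (nat_mul_sum_monicFinset hmul hone) (e := e) (C₀ := K) hN
      (fun n hn => by rw [hq, Complex.ofReal_natCast]; exact he n hn)
    refine (hbound D (fun m => -primePowerSum h m) c hc0 (fun n => ?_) (fun m hm => ?_)
      (fun m hm => ?_) n).trans ?_
    · rw [hcrec, ← Finset.sum_neg_distrib]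
      exact Finset.sum_congr rfl fun m _ => (neg_mul _ _).symm
    · rw [norm_neg]; exact norm_primePowerSum_le hle hm
    · rw [norm_neg]; exact hS m hm
    · refine mul_le_mul_of_nonneg_right ?_ (by positivity)
      nlinarith

end LFunctionBound

section ConductorRing

variable {F : Type*} [Field F]

theorem map_homogMap {E E' : Type*} [CommRing E] [Algebra F E] [CommRing E'] [Algebra F E']
    (φ : E →ₐ[F] E') (a b : E) (n : ℕ) (x : Fin n → F) :
    φ (homogMap F a b n x) = homogMap F (φ a) (φ b) n x := by
  simp only [homogMap, Fintype.linearCombination_apply, map_sum, map_smul, map_mul, map_pow]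

theorem homogMap_root_one (g : F[X]) (n : ℕ) (x : Fin n → F) :
    homogMap F (AdjoinRoot.root g) 1 n x = AdjoinRoot.mk g (lowPoly F n x) := by
  simp only [homogMap, Fintype.linearCombination_apply, lowPoly, map_sum, map_mul, map_pow,
    AdjoinRoot.mk_X, AdjoinRoot.mk_C, one_pow, mul_one, Algebra.smul_def,
    AdjoinRoot.algebraMap_eq]

theorem homogMap_one_root (g : F[X]) (n : ℕ) (x : Fin n → F) :
    homogMap F 1 (AdjoinRoot.root g) n x =
      AdjoinRoot.mk g (∑ i, C (x i) * X ^ (n - 1 - (i : ℕ))) := by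
  simp only [homogMap, Fintype.linearCombination_apply, map_sum, map_mul, map_pow,
    AdjoinRoot.mk_X, AdjoinRoot.mk_C, one_pow, one_mul, Algebra.smul_def,
    AdjoinRoot.algebraMap_eq]

theorem X_pow_dvd_sum_reverse_iff {n k : ℕ} (hk : k ≤ n) (x : Fin n → F) :
    X ^ k ∣ ∑ i, C (x i) * X ^ (n - 1 - (i : ℕ)) ↔ ∀ i : Fin n, n - k ≤ i → x i = 0 := by
  have hcoeff : ∀ i : Fin n, (∑ i, C (x i) * X ^ (n - 1 - (i : ℕ))).coeff (n - 1 - i) = x i := by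
    intro i
    rw [finsetSum_coeff, Finset.sum_eq_single i]
    · simp
    · intro j _ hj
      rw [coeff_C_mul_X_pow, if_neg]
      have := Fin.val_ne_of_ne hj
      omega
    · simp
  rw [X_pow_dvd_iff]
  constructor
  · intro h i hi
    rw [← hcoeff i]
    exact h _ (by omega)
  · intro h d hd
    have := h ⟨n - 1 - d, by omega⟩ (by simp only; omega)
    rw [← hcoeff] at this
    simp only at this
    rwa [show n - 1 - (n - 1 - d) = d by omega] at this

/-- A homogeneous evaluation map whose kernel consists of multiples of a fixed polynomial is
surjective as soon as the dimensions allow it. -/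
theorem homogMap_surjective {E : Type*} [CommRing E] [Algebra F E] [Module.Finite F E] {a b : E}
    {g : F[X]} {n : ℕ} (hn : Module.finrank F E ≤ n)
    (hker : ∀ x, homogMap F a b n x = 0 →
      ∃ h : F[X], h.degree < (n - Module.finrank F E : ℕ) ∧ lowPoly F n x = g * h) :
    Function.Surjective (homogMap F a b n) := by
  set D := Module.finrank F E with hD
  rw [← LinearMap.range_eq_top]
  refine Submodule.eq_top_of_finrank_eq (le_antisymm (Submodule.finrank_le _) ?_)
  let ψ : (Fin (n - D) → F) →ₗ[F] (Fin n → F) := LinearMap.pi fun i =>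
    lcoeff F i ∘ₗ LinearMap.mulLeft F g ∘ₗ
      Fintype.linearCombination F fun j : Fin (n - D) => (X ^ (j : ℕ) : F[X])
  have hle : LinearMap.ker (homogMap F a b n) ≤ LinearMap.range ψ := by
    intro x hx
    obtain ⟨h, hdeg, hh⟩ := hker x hx
    refine ⟨fun j => h.coeff j, funext fun i => ?_⟩
    have hlow := lowPoly_coeff hdeg
    rw [← coeff_lowPoly n x i, hh]
    simp only [ψ, LinearMap.pi_apply, LinearMap.comp_apply, lcoeff_apply,
      LinearMap.mulLeft_apply, Fintype.linearCombination_apply]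
    conv_rhs => rw [← hlow]
    simp only [lowPoly, smul_eq_C_mul]
  have h1 := (homogMap F a b n).finrank_range_add_finrank_ker
  have h2 := Submodule.finrank_mono hle
  have h3 := LinearMap.finrank_range_le ψ
  rw [Module.finrank_fin_fun] at h1 h3
  omega

theorem homogMap_prod {E₁ E₂ : Type*} [CommRing E₁] [Algebra F E₁] [CommRing E₂] [Algebra F E₂]
    (a₁ b₁ : E₁) (a₂ b₂ : E₂) (n : ℕ) (x : Fin n → F) :
    homogMap F (a₁, a₂) (b₁, b₂) n x = (homogMap F a₁ b₁ n x, homogMap F a₂ b₂ n x) :=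
  Prod.ext (map_homogMap (AlgHom.fst F E₁ E₂) _ _ n x) (map_homogMap (AlgHom.snd F E₁ E₂) _ _ n x)

theorem homogMap_prod_eq_zero_iff (g : F[X]) {k n : ℕ} (hk : k ≤ n) (x : Fin n → F) :
    homogMap F (E := AdjoinRoot g × AdjoinRoot (X ^ k : F[X])) (AdjoinRoot.root g, 1)
      (1, AdjoinRoot.root (X ^ k)) n x = 0 ↔
      g ∣ lowPoly F n x ∧ ∀ i : Fin n, n - k ≤ i → x i = 0 := by
  rw [homogMap_prod, homogMap_root_one, homogMap_one_root, Prod.mk_eq_zero,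
    AdjoinRoot.mk_eq_zero, AdjoinRoot.mk_eq_zero, X_pow_dvd_sum_reverse_iff hk]

theorem exists_eq_mul_of_dvd_lowPoly {g : F[X]} (hg : g ≠ 0) {k n : ℕ} {x : Fin n → F}
    (hx : g ∣ lowPoly F n x) (h2 : ∀ i : Fin n, n - k ≤ i → x i = 0) (hn : g.natDegree + k ≤ n) :
    ∃ h : F[X], h.degree < (n - (g.natDegree + k) : ℕ) ∧ lowPoly F n x = g * h := by
  obtain ⟨h, hh⟩ := hx
  refine ⟨h, ?_, hh⟩
  have hdeg : (lowPoly F n x).degree < (n - k : ℕ) := by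
    rw [degree_lt_iff_coeff_zero]
    intro m hm
    rcases lt_or_ge m n with hmn | hmn
    · exact (coeff_lowPoly n x ⟨m, hmn⟩).trans (h2 _ hm)
    · exact coeff_eq_zero_of_degree_lt ((degree_lowPoly_lt n x).trans_le (by exact_mod_cast hmn))
  rw [hh, degree_mul, degree_eq_natDegree hg] at hdeg
  by_cases hz : h = 0
  · rw [hz, degree_zero]; exact WithBot.bot_lt_coe _
  · rw [degree_eq_natDegree hz] at hdeg ⊢
    have : g.natDegree + h.natDegree < n - k := by exact_mod_cast hdeg
    exact_mod_cast (by omega : h.natDegree < n - (g.natDegree + k))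

/-- The finite ring through which the residue of a polynomial modulo `g` and its `k` leading
coefficients both factor. -/
theorem exists_conductor_ring.{u} (F : Type u) [Field F] [Fintype F] {g : F[X]} (hg : g ≠ 0)
    {k D : ℕ} (hD : g.natDegree + k = D) :
    ∃ (E : Type u) (_ : CommRing E) (_ : Algebra F E) (_ : Finite E) (a b y : E),
      a + b * y = 1 ∧ Nat.card E = Fintype.card F ^ D ∧
      C a - C b * X ∣ g.map (algebraMap F E) ∧
      ∀ n, D ≤ n → Function.Surjective (homogMap F a b n) ∧
        ∀ x, homogMap F a b n x = 0 → ∃ h : F[X], h.degree < (n - D : ℕ) ∧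
          lowPoly F n x = g * h := by
  have hk0 : (X ^ k : F[X]) ≠ 0 := pow_ne_zero _ X_ne_zero
  have _ : Module.Finite F (AdjoinRoot g) := (AdjoinRoot.powerBasis hg).finite
  have _ : Module.Finite F (AdjoinRoot (X ^ k : F[X])) := (AdjoinRoot.powerBasis hk0).finite
  have hrank : Module.finrank F (AdjoinRoot g × AdjoinRoot (X ^ k : F[X])) = D := by
    rw [Module.finrank_prod, (AdjoinRoot.powerBasis hg).finrank,
      (AdjoinRoot.powerBasis hk0).finrank, AdjoinRoot.powerBasis_dim,
      AdjoinRoot.powerBasis_dim, natDegree_X_pow, hD]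
  have hab : ((AdjoinRoot.root g, 1) : AdjoinRoot g × AdjoinRoot (X ^ k : F[X])) +
      (1, AdjoinRoot.root (X ^ k)) * (1 - AdjoinRoot.root g, 0) = 1 := by
    ext <;> simp
  have hker : ∀ n, D ≤ n → ∀ x, homogMap F (E := AdjoinRoot g × AdjoinRoot (X ^ k : F[X]))
      (AdjoinRoot.root g, 1) (1, AdjoinRoot.root (X ^ k)) n x = 0 →
      ∃ h : F[X], h.degree < (n - D : ℕ) ∧ lowPoly F n x = g * h := by
    intro n hn x hx
    rw [homogMap_prod_eq_zero_iff g (by omega)] at hx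
    rw [← hD]
    exact exists_eq_mul_of_dvd_lowPoly hg hx.1 hx.2 (by omega)
  refine ⟨AdjoinRoot g × AdjoinRoot (X ^ k : F[X]), inferInstance, inferInstance,
    Module.finite_of_finite F, _, _, _, hab, ?_, ?_,
    fun n hn => ⟨homogMap_surjective (g := g) (hrank.trans_le hn) ?_, hker n hn⟩⟩
  · rw [Module.natCard_eq_pow_finrank (K := F), hrank, Nat.card_eq_fintype_card]
  · have hlow : lowPoly F (D + 1) (fun i => g.coeff i) = g := lowPoly_coeff
      (degree_le_natDegree.trans_lt (by exact_mod_cast (by omega : g.natDegree < D + 1)))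
    refine dvd_map_of_homogMap_eq_zero hab hlow ?_
    rw [homogMap_prod_eq_zero_iff g (by omega), hlow]
    exact ⟨dvd_rfl, fun i hi => coeff_eq_zero_of_natDegree_lt (by omega)⟩
  · rw [hrank]
    exact hker n hn

end ConductorRing

section BadPrimes

variable {F : Type*} [Field F] {E : Type*} [CommRing E] [Algebra F E]

theorem isUnit_homogEval_iff {a b : E} {B : Finset F[X]}
    (hB : ∀ p, p ∈ B ↔ p.Monic ∧ Irreducible p ∧
      ¬ IsUnit (homogEval a b (p.map (algebraMap F E)))) {f : F[X]} (hf : f.Monic) :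
    IsUnit (homogEval a b (f.map (algebraMap F E))) ↔ ∀ p ∈ B, ¬ p ∣ f := by
  have hmul : ∀ p r : F[X], p.Monic → r.Monic → homogEval a b ((p * r).map (algebraMap F E)) =
      homogEval a b (p.map (algebraMap F E)) * homogEval a b (r.map (algebraMap F E)) :=
    fun p r hp hr => by rw [Polynomial.map_mul, homogEval_mul _ _ (hp.map _) (hr.map _)]
  constructor
  · rintro hu p hp ⟨r, rfl⟩
    have hp := (hB p).mp hp
    rw [hmul p r hp.1 (hp.1.of_mul_monic_left hf)] at hu
    exact hp.2.2 (isUnit_of_mul_isUnit_left hu)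
  · intro h
    induction hn : f.natDegree using Nat.strong_induction_on generalizing f with
    | _ n ih =>
      by_cases hfu : IsUnit f
      · rw [hf.eq_one_of_isUnit hfu, Polynomial.map_one, homogEval_one]
        exact isUnit_one
      · obtain ⟨p, hpi, hp, r, rfl⟩ : ∃ p : F[X], Irreducible p ∧ p.Monic ∧ p ∣ f := by
          obtain ⟨p, h1, h2, h3⟩ := exists_monic_irreducible_factor f hfu
          exact ⟨p, by tauto, by tauto, h3⟩
        have hr := hp.of_mul_monic_left hf
        rw [hmul p r hp hr]
        refine IsUnit.mul ?_ (ih r.natDegree ?_ hr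
          (fun t ht htr => h t ht (htr.mul_left p)) rfl)
        · by_contra hu
          exact h p ((hB p).mpr ⟨hp, hpi, hu⟩) (dvd_mul_right _ _)
        · rw [← hn, hp.natDegree_mul hr]
          have := hpi.natDegree_pos
          omega

end BadPrimes

section SieveBadPrimes

variable {F : Type*} [Field F] [Fintype F]

theorem exists_two_pow_card_le (F : Type*) [Field F] [Fintype F] {ε : ℝ} (hε : 0 < ε) :
    ∃ C₀ : ℝ, 0 < C₀ ∧ ∀ (B : Finset F[X]) (D : ℕ), (∀ p ∈ B, p.Monic ∧ Irreducible p) →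
      ∑ p ∈ B, p.natDegree ≤ D → (2 : ℝ) ^ B.card ≤ C₀ * (Fintype.card F : ℝ) ^ (ε * D) := by
  classical
  set q : ℝ := (Fintype.card F : ℝ) with hq
  have hq1 : 1 < q := by rw [hq]; exact_mod_cast Fintype.one_lt_card
  have hq0 : 0 < q := by linarith
  obtain ⟨M, hM⟩ := pow_unbounded_of_one_lt 2 (Real.one_lt_rpow hq1 hε)
  refine ⟨2 ^ (primesUpTo F M).card, by positivity, fun B D hB hD => ?_⟩
  rw [← Finset.card_filter_add_card_filter_not (fun p : F[X] => p.natDegree ≤ M), pow_add]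
  refine mul_le_mul (pow_le_pow_right₀ one_le_two (Finset.card_le_card fun p hp => ?_)) ?_
    (by positivity) (by positivity)
  · rw [Finset.mem_filter] at hp
    exact mem_primesUpTo.mpr ⟨(hB p hp.1).1, (hB p hp.1).2, hp.2⟩
  · have hcard : M * (B.filter fun p : F[X] => ¬ p.natDegree ≤ M).card ≤ D := by
      refine le_trans ?_ ((Finset.sum_le_sum_of_subset (Finset.filter_subset
        (fun p : F[X] => ¬ p.natDegree ≤ M) B)).trans hD)
      rw [mul_comm, ← smul_eq_mul]
      refine Finset.card_nsmul_le_sum _ _ _ fun p hp => ?_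
      exact (not_le.mp (Finset.mem_filter.mp hp).2).le
    refine (pow_le_pow_left₀ zero_le_two hM.le _).trans ?_
    rw [← pow_mul, ← Real.rpow_mul_natCast hq0.le]
    refine Real.rpow_le_rpow_of_exponent_le hq1.le (mul_le_mul_of_nonneg_left ?_ hε.le)
    exact_mod_cast hcard

open scoped Classical in
/-- Sieving out a finite set of primes from a Möbius sum loses at most a factor `2` per prime. -/
theorem norm_sum_polyMu_le_two_pow_mul {B : Finset F[X]} (hB : ∀ p ∈ B, p.Monic ∧ Irreducible p)
    {P : (F[X] → ℂ) → Prop} (hP : ∀ φ, P φ → ∀ p ∈ B, P fun f => φ (p * f)) {M : ℝ} {n : ℕ}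
    (hM0 : 0 ≤ M)
    (hM : ∀ m ≤ n, ∀ φ, P φ →
      ‖∑ f ∈ monicFinset F m with ∀ p ∈ B, ¬ p ∣ f, (polyMu f : ℂ) * φ f‖ ≤ M)
    {φ : F[X] → ℂ} (hφ : P φ) :
    ‖∑ f ∈ monicFinset F n, (polyMu f : ℂ) * φ f‖ ≤ 2 ^ B.card * M := by
  suffices h : ∀ A ⊆ B, ∀ m ≤ n, ∀ φ, P φ →
      ‖∑ f ∈ monicFinset F m with ∀ p ∈ B, p ∉ A → ¬ p ∣ f, (polyMu f : ℂ) * φ f‖ ≤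
        2 ^ A.card * M by
    have h1 := h B subset_rfl n le_rfl φ hφ
    rwa [Finset.filter_true_of_mem fun f _ p hp hp' => absurd hp hp'] at h1
  intro A
  induction A using Finset.induction_on with
  | empty => intro _ m hm φ hφ; simpa using hM m hm φ hφ
  | insert p A hpA ih =>
    intro hsub m hm φ hφ
    rw [Finset.insert_subset_iff] at hsub
    obtain ⟨hp, hpi⟩ := hB p hsub.1
    rw [← Finset.sum_filter_add_sum_filter_not _ (p ∣ ·), Finset.card_insert_of_notMem hpA,
      pow_succ, mul_assoc, mul_left_comm, two_mul]
    refine (norm_add_le _ _).trans (add_le_add ?_ ?_)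
    · rw [Finset.filter_comm]
      rcases le_or_gt p.natDegree m with hle | hlt
      · rw [Finset.sum_filter, sum_monicFinset_dvd hp hle (fun f =>
          if ∀ r ∈ B, r ∉ insert p A → ¬ r ∣ f then (polyMu f : ℂ) * φ f else 0), ← norm_neg]
        have h1 := ih hsub.2 (m - p.natDegree) ((Nat.sub_le _ _).trans hm) _ (hP φ hφ p hsub.1)
        refine le_of_eq_of_le (congrArg norm ?_) h1
        rw [← Finset.sum_neg_distrib, Finset.sum_filter]
        refine Finset.sum_congr rfl fun f _ => ?_
        by_cases hpf : p ∣ f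
        · rw [if_neg (fun h : ∀ r ∈ B, r ∉ A → ¬ r ∣ f => h p hsub.1 hpA hpf),
            polyMu_irreducible_mul hpi, if_pos hpf]
          simp
        · have hiff : (∀ r ∈ B, r ∉ insert p A → ¬ r ∣ p * f) ↔ ∀ r ∈ B, r ∉ A → ¬ r ∣ f := by
            constructor
            · intro h r hr hrA hrf
              by_cases hrp : r = p
              · exact hpf (hrp ▸ hrf)
              · exact h r hr (by simp [hrp, hrA]) (hrf.mul_left p)
            · intro h r hr hrA hrf
              rw [Finset.mem_insert, not_or] at hrA
              exact h r hr hrA.2 ((isCoprime_of_monic_irreducible (hB r hr).1 (hB r hr).2 hp hpi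
                hrA.1).dvd_of_dvd_mul_left hrf)
          simp only [hiff]
          split_ifs
          · rw [polyMu_irreducible_mul hpi, if_neg hpf]
            push_cast; ring
          · simp
      · rw [filter_dvd_monicFinset_eq_empty hlt]
        simpa using by positivity
    · rw [Finset.filter_filter]
      refine le_of_eq_of_le (congrArg norm (Finset.sum_congr (Finset.filter_congr fun f _ => ?_)
        fun _ _ => rfl)) (ih hsub.2 m hm φ hφ)
      constructor
      · rintro ⟨h, hpf⟩ r hr hrA
        by_cases hrp : r = p
        · exact hrp ▸ hpf
        · exact h r hr (by simp [hrp, hrA])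
      · intro h
        refine ⟨fun r hr hrA => h r hr ?_, h p hsub.1 hpA⟩
        rw [Finset.mem_insert, not_or] at hrA
        exact hrA.2

variable {E : Type*} [CommRing E] [Algebra F E]

theorem exists_finset_not_isUnit_homogEval {a b : E} {V : E[X]} {δ : F[X]} (hδ : δ ≠ 0)
    (hV : (C a - C b * X) * V = δ.map (algebraMap F E)) :
    ∃ B : Finset F[X], (∀ p, p ∈ B ↔ p.Monic ∧ Irreducible p ∧
      ¬ IsUnit (homogEval a b (p.map (algebraMap F E)))) ∧ ∑ p ∈ B, p.natDegree ≤ δ.natDegree := by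
  classical
  set B := {p ∈ primesUpTo F δ.natDegree | ¬ IsUnit (homogEval a b (p.map (algebraMap F E)))}
  have hB : ∀ p, p ∈ B ↔ p.Monic ∧ Irreducible p ∧
      ¬ IsUnit (homogEval a b (p.map (algebraMap F E))) := by
    intro p
    rw [Finset.mem_filter, mem_primesUpTo]
    constructor
    · tauto
    · rintro ⟨h1, h2, h3⟩
      exact ⟨⟨h1, h2, natDegree_le_of_dvd (dvd_of_not_isUnit_homogEval hδ hV h1 h2 h3) hδ⟩, h3⟩
  refine ⟨B, hB, ?_⟩
  rw [← natDegree_prod _ _ fun p hp => ((hB p).mp hp).1.ne_zero]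
  refine natDegree_le_of_dvd (Finset.prod_dvd_of_coprime ?_ ?_) hδ
  · intro p hp r hr hne
    have hp := (hB p).mp hp
    have hr := (hB r).mp hr
    exact isCoprime_of_monic_irreducible hp.1 hp.2.1 hr.1 hr.2.1 hne
  · intro p hp
    have hp := (hB p).mp hp
    exact dvd_of_not_isUnit_homogEval hδ hV hp.1 hp.2.1 hp.2.2

end SieveBadPrimes

section Parseval

open scoped ComplexConjugate in
/-- A weighted sum of a bounded function over units is controlled by its twists by multiplicative
characters. -/
theorem norm_sum_isUnit_le {E : Type*} [CommRing E] [Finite E] {ι : Type*} (s : Finset ι)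
    (w : ι → ℂ) (θ : ι → E) {M : ℝ} (hM : 0 ≤ M)
    (h : ∀ χ : MulChar E ℂ, ‖∑ i ∈ s, w i * χ (θ i)‖ ≤ M)
    [DecidablePred fun i => IsUnit (θ i)] {u : E → ℂ} (hu : ∀ z, ‖u z‖ ≤ 1) :
    ‖∑ i ∈ s with IsUnit (θ i), w i * u (θ i)‖ ≤ √(Nat.card E) * M := by
  classical
  let _ := Fintype.ofFinite E
  let _ := Fintype.ofFinite (MulChar E ℂ)
  set W : Eˣ → ℂ := fun v => ∑ i ∈ s with θ i = v, w i with hW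
  have hsum : ∀ φ : E → ℂ, ∑ i ∈ s with IsUnit (θ i), w i * φ (θ i) = ∑ v, W v * φ v := by
    intro φ
    simp_rw [hW, Finset.sum_mul, Finset.sum_filter]
    rw [Finset.sum_comm]
    refine Finset.sum_congr rfl fun i _ => ?_
    split_ifs with hi
    · rw [Finset.sum_eq_single hi.unit]
      · simp
      · intro v _ hv
        rw [if_neg]
        intro h'
        exact hv (Units.ext (by rw [IsUnit.unit_spec, h']))
      · simp
    · symm
      exact Finset.sum_eq_zero fun v _ =>
        if_neg fun hv : θ i = v => hi (by rw [hv]; exact v.isUnit)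
  have hcard : Fintype.card (MulChar E ℂ) = Fintype.card Eˣ := by
    rw [← Nat.card_eq_fintype_card, ← Nat.card_eq_fintype_card,
      MulChar.card_eq_card_units_of_hasEnoughRootsOfUnity]
  have horth : ∀ v v' : Eˣ, ∑ χ : MulChar E ℂ, χ v * conj (χ v') =
      if v = v' then (Fintype.card Eˣ : ℂ) else 0 := by
    intro v v'
    have hconj : ∀ χ : MulChar E ℂ, χ v * conj (χ v') = χ ((v * v'⁻¹ : Eˣ) : E) := by
      intro χ
      rw [Units.val_mul, map_mul]
      congr 1
      have h1 : χ (v' : E) * χ ((v'⁻¹ : Eˣ) : E) = 1 := by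
        rw [← map_mul, Units.mul_inv, map_one]
      rw [← Complex.inv_eq_conj (χ.norm_apply_isUnit v'.isUnit)]
      exact inv_eq_of_mul_eq_one_right h1
    simp_rw [hconj]
    split_ifs with hv
    · simp [hv, hcard]
    · have hne : ((v * v'⁻¹ : Eˣ) : E) ≠ 1 := by
        rw [Ne, Units.val_eq_one, mul_inv_eq_one]; exact hv
      obtain ⟨χ₀, hχ₀⟩ := MulChar.exists_apply_ne_one_of_hasEnoughRootsOfUnity E ℂ hne
      have h2 : χ₀ ((v * v'⁻¹ : Eˣ) : E) * ∑ χ : MulChar E ℂ, χ ((v * v'⁻¹ : Eˣ) : E) =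
          ∑ χ : MulChar E ℂ, χ ((v * v'⁻¹ : Eˣ) : E) := by
        rw [Finset.mul_sum, ← Equiv.sum_comp (Equiv.mulLeft χ₀)
          fun χ : MulChar E ℂ => χ ((v * v'⁻¹ : Eˣ) : E)]
        rfl
      exact (mul_left_eq_self₀.mp h2).resolve_left hχ₀
  have hc : ∀ χ : MulChar E ℂ, ‖∑ v, W v * χ v‖ ≤ M := by
    intro χ
    rw [← hsum, Finset.sum_filter]
    refine le_of_eq_of_le (congrArg norm (Finset.sum_congr rfl fun i _ => ?_)) (h χ)
    split_ifs with hi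
    · rfl
    · rw [χ.map_nonunit hi, mul_zero]
  have hpars : (∑ χ : MulChar E ℂ, ‖∑ v, W v * χ v‖ ^ 2 : ℝ) =
      Fintype.card Eˣ * ∑ v, ‖W v‖ ^ 2 := by
    have : ((∑ χ : MulChar E ℂ, ‖∑ v, W v * χ v‖ ^ 2 : ℝ) : ℂ) =
        ((Fintype.card Eˣ * ∑ v, ‖W v‖ ^ 2 : ℝ) : ℂ) := by
      push_cast
      simp_rw [← Complex.mul_conj', map_sum, map_mul, Finset.sum_mul_sum]
      rw [Finset.sum_comm, Finset.mul_sum]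
      refine Finset.sum_congr rfl fun v _ => ?_
      rw [Finset.sum_comm]
      have : ∀ v', ∑ χ : MulChar E ℂ, W v * χ v * (conj (W v') * conj (χ v')) =
          if v = v' then W v * conj (W v') * Fintype.card Eˣ else 0 := by
        intro v'
        rw [← mul_ite_zero, ← horth, Finset.mul_sum]
        exact Finset.sum_congr rfl fun χ _ => by ring
      simp_rw [this]
      rw [Finset.sum_ite_eq, if_pos (Finset.mem_univ v)]
      ring
    exact_mod_cast this
  have hL2 : ∑ v, ‖W v‖ ^ 2 ≤ M ^ 2 := by
    have hpos : (0 : ℝ) < Fintype.card Eˣ := by exact_mod_cast Fintype.card_pos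
    refine le_of_mul_le_mul_left ?_ hpos
    rw [← hpars]
    refine (Finset.sum_le_sum fun χ _ => pow_le_pow_left₀ (norm_nonneg _) (hc χ) 2).trans_eq ?_
    rw [Finset.sum_const, Finset.card_univ, hcard, nsmul_eq_mul]
  rw [hsum]
  calc ‖∑ v, W v * u v‖ ≤ ∑ v, 1 * ‖W v‖ := by
        refine (norm_sum_le _ _).trans (Finset.sum_le_sum fun v _ => ?_)
        rw [norm_mul, one_mul]
        exact mul_le_of_le_one_right (norm_nonneg _) (hu v)
    _ ≤ √(∑ _v : Eˣ, 1 ^ 2) * √(∑ v, ‖W v‖ ^ 2) := Real.sum_mul_le_sqrt_mul_sqrt _ _ _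
    _ ≤ √(Nat.card E) * M := by
        refine mul_le_mul (Real.sqrt_le_sqrt ?_) ?_ (Real.sqrt_nonneg _) (Real.sqrt_nonneg _)
        · simp only [one_pow, Finset.sum_const, Finset.card_univ, nsmul_eq_mul, mul_one]
          rw [Nat.card_eq_fintype_card]
          exact_mod_cast Fintype.card_le_of_injective _ Units.val_injective
        · exact Real.sqrt_le_iff.mpr ⟨hM, hL2⟩

end Parseval

section AddCharacters

/-- A weighted sum of a bounded function on a finite abelian group is controlled by its twists by
additive characters. -/
theorem norm_sum_le_card_mul_of_addChar {A : Type*} [AddCommGroup A] [Fintype A] {ι : Type*}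
    (s : Finset ι) (w : ι → ℂ) (T : ι → A) {M : ℝ}
    (h : ∀ ψ : AddChar A ℂ, ‖∑ i ∈ s, w i * ψ (T i)‖ ≤ M) {G : A → ℂ} (hG : ∀ a, ‖G a‖ ≤ 1) :
    ‖∑ i ∈ s, w i * G (T i)‖ ≤ Fintype.card A * M := by
  classical
  have hpos : (0 : ℝ) < Fintype.card A := by exact_mod_cast Fintype.card_pos
  have hM : 0 ≤ M := (norm_nonneg _).trans (h 0)
  have hexp : (Fintype.card A : ℂ) * ∑ i ∈ s, w i * G (T i) =
      ∑ a, ∑ ψ : AddChar A ℂ, G a * ψ (-a) * ∑ i ∈ s, w i * ψ (T i) := by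
    have h1 : ∀ i, (Fintype.card A : ℂ) * (w i * G (T i)) =
        ∑ a, ∑ ψ : AddChar A ℂ, G a * ψ (-a) * (w i * ψ (T i)) := by
      intro i
      have h2 : ∀ a, ∑ ψ : AddChar A ℂ, G a * ψ (-a) * (w i * ψ (T i)) =
          if T i = a then G a * w i * Fintype.card A else 0 := by
        intro a
        have h3 := AddChar.sum_apply_eq_ite (T i - a)
        simp_rw [sub_eq_zero] at h3
        rw [← mul_ite_zero, ← h3, Finset.mul_sum]
        refine Finset.sum_congr rfl fun ψ _ => ?_
        rw [sub_eq_add_neg, AddChar.map_add_eq_mul]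
        ring
      rw [Finset.sum_congr rfl fun a _ => h2 a, Finset.sum_ite_eq, if_pos (Finset.mem_univ _)]
      ring
    rw [Finset.mul_sum, Finset.sum_congr rfl fun i _ => h1 i, Finset.sum_comm]
    refine Finset.sum_congr rfl fun a _ => ?_
    rw [Finset.sum_comm]
    exact Finset.sum_congr rfl fun ψ _ => (Finset.mul_sum _ _ _).symm
  refine le_of_mul_le_mul_left ?_ hpos
  calc (Fintype.card A : ℝ) * ‖∑ i ∈ s, w i * G (T i)‖
      = ‖∑ a, ∑ ψ : AddChar A ℂ, G a * ψ (-a) * ∑ i ∈ s, w i * ψ (T i)‖ := by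
        rw [← hexp, norm_mul, Complex.norm_natCast]
    _ ≤ ∑ _a : A, ∑ _ψ : AddChar A ℂ, M := by
        refine (norm_sum_le _ _).trans (Finset.sum_le_sum fun a _ =>
          (norm_sum_le _ _).trans (Finset.sum_le_sum fun ψ _ => ?_))
        rw [norm_mul, norm_mul, AddChar.norm_apply, mul_one]
        exact (mul_le_of_le_one_left (norm_nonneg _) (hG a)).trans (h ψ)
    _ = Fintype.card A * (Fintype.card A * M) := by
        simp [AddChar.card_eq]

variable {F : Type*} [Field F]

theorem lowPoly_add (n : ℕ) (x y : Fin n → F) :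
    lowPoly F n (x + y) = lowPoly F n x + lowPoly F n y := by
  simp [lowPoly, add_mul, Finset.sum_add_distrib]

theorem lowPoly_smul (n : ℕ) (c : F) (x : Fin n → F) :
    lowPoly F n (c • x) = C c * lowPoly F n x := by
  simp [lowPoly, Finset.mul_sum, mul_assoc]

theorem lowPoly_snoc (n : ℕ) (x : Fin n → F) (c : F) :
    lowPoly F (n + 1) (Fin.snoc x c) = lowPoly F n x + C c * X ^ n := by
  simp [lowPoly, Fin.sum_univ_castSucc]

theorem lowPoly_sub (n : ℕ) (x y : Fin n → F) :
    lowPoly F n (x - y) = lowPoly F n x - lowPoly F n y := by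
  rw [eq_sub_iff_add_eq, ← lowPoly_add, sub_add_cancel]

variable [Fintype F]

theorem sum_lowPoly [DecidableEq F] {R : Type*} [AddCommMonoid R] (φ : F[X] → R) (n : ℕ) :
    ∑ x : Fin n → F, φ (lowPoly F n x) =
      φ 0 + ∑ j ∈ Finset.range n, ∑ c : Fˣ, ∑ f ∈ monicFinset F j, φ (C (c : F) * f) := by
  induction n with
  | zero => simp [lowPoly]
  | succ n ih =>
    rw [Finset.sum_range_succ, ← add_assoc, ← ih, ← (Fin.snocEquiv fun _ => F).sum_comp,
      Fintype.sum_prod_type, ← Finset.add_sum_erase _ _ (Finset.mem_univ (0 : F))]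
    congr 1
    · refine Finset.sum_congr rfl fun x _ => congrArg φ ?_
      exact (lowPoly_snoc n x 0).trans (by simp)
    · have h1 : ∀ g : F → R, ∑ c ∈ Finset.univ.erase (0 : F), g c = ∑ c : Fˣ, g c := by
        intro g
        refine (Finset.sum_bij (fun (c : Fˣ) _ => (c : F)) ?_ ?_ ?_ ?_).symm
        · intro c _; simp
        · intro c _ d _ h; exact Units.ext h
        · intro c hc
          exact ⟨Units.mk0 c (Finset.ne_of_mem_erase hc), Finset.mem_univ _, rfl⟩
        · intro c _; rfl
      rw [h1]
      refine Finset.sum_congr rfl fun c _ => ?_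
      rw [sum_monicFinset]
      refine Fintype.sum_equiv (MulAction.toPerm c⁻¹) _ _ fun x => congrArg φ ?_
      refine (lowPoly_snoc n x (c : F)).trans ?_
      rw [MulAction.toPerm_apply, Units.smul_def, lowPoly_smul, mul_add, ← mul_assoc, ← C_mul,
        Units.mul_inv, C_1, one_mul, add_comm]

/-- By the pigeonhole principle, an additive character of the polynomials of degree `< n` is trivial
on the multiples of some nonzero polynomial of degree at most about `n / 2`. -/
theorem exists_addChar_mul_eq_one {n D : ℕ} (hD : n - D < D + 1) (ψ : AddChar (Fin n → F) ℂ) :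
    ∃ g : F[X], g ≠ 0 ∧ g.natDegree ≤ D ∧
      ∀ h : F[X], h.degree < (n - D : ℕ) → ψ (fun i => (g * h).coeff i) = 1 := by
  classical
  set Λ : F[X] →ₗ[F] (Fin n → F) := LinearMap.pi fun i => lcoeff F i with hΛ
  have hΛ' : ∀ f, (fun i : Fin n => f.coeff i) = Λ f := fun f => rfl
  let T : (Fin (D + 1) → F) → AddChar (Fin (n - D) → F) ℂ := fun x =>
    ψ.compAddMonoidHom (AddMonoidHom.mk' (fun y => Λ (lowPoly F (D + 1) x * lowPoly F (n - D) y))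
      fun y z => by rw [lowPoly_add, mul_add, map_add])
  have hT : ∀ x y, T x y = ψ (Λ (lowPoly F (D + 1) x * lowPoly F (n - D) y)) := fun x y => rfl
  obtain ⟨x, y, hxy, hTxy⟩ := Fintype.exists_ne_map_eq_of_card_lt T (by
    rw [AddChar.card_eq, Fintype.card_fun, Fintype.card_fun, Fintype.card_fin, Fintype.card_fin]
    exact Nat.pow_lt_pow_right Fintype.one_lt_card hD)
  refine ⟨lowPoly F (D + 1) (x - y), ?_, ?_, fun h hh => ?_⟩
  · rw [lowPoly_sub, sub_ne_zero]
    exact (lowPoly_injective (D + 1)).ne hxy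
  · exact natDegree_le_of_degree_le (Order.lt_succ_iff.mp (degree_lowPoly_lt (D + 1) _))
  · have h1 := DFunLike.congr_fun hTxy fun i : Fin (n - D) => h.coeff i
    rw [hT, hT, lowPoly_coeff hh] at h1
    rw [hΛ', lowPoly_sub, sub_mul, map_sub, AddChar.map_sub_eq_div, h1, div_self]
    exact (ψ.val_isUnit _).ne_zero

end AddCharacters

section Assembly

universe u v

/-- Cancellation of the Möbius function against a bounded function of `homogEval a b`. -/
theorem exists_norm_sum_polyMu_comp_homogEval_le (F : Type u) [Field F] [Fintype F] {ε : ℝ}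
    (hε : 0 < ε) :
    ∃ C₀ : ℝ, 0 < C₀ ∧ ∀ (E : Type v) [CommRing E] [Algebra F E] [Finite E] (a b y : E) (D : ℕ)
      (δ : F[X]), a + b * y = 1 → δ ≠ 0 → δ.natDegree ≤ D →
      C a - C b * X ∣ δ.map (algebraMap F E) →
      (∀ n, D < n → Function.Surjective (homogMap F a b n)) →
      ∀ (u : E → ℂ), (∀ z, ‖u z‖ ≤ 1) → ∀ n,
        ‖∑ f ∈ monicFinset F n, (polyMu f : ℂ) * u (homogEval a b (f.map (algebraMap F E)))‖ ≤
          C₀ * √(Nat.card E) * (Fintype.card F : ℝ) ^ ((1 / 2 + ε) * n + 2 * ε * D) := by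
  classical
  obtain ⟨C₁, hC₁, h₁⟩ := exists_two_pow_card_le F hε
  obtain ⟨C₂, hC₂, h₂⟩ := exists_norm_sum_polyMu_mulChar_le.{u, v} F hε
  refine ⟨C₁ * C₂, by positivity, fun E _ _ _ a b y D δ hy hδ hδD hdvd hsurj u hu n => ?_⟩
  obtain ⟨V, hV⟩ := hdvd
  obtain ⟨B, hB, hBδ⟩ := exists_finset_not_isUnit_homogEval hδ hV.symm
  set q : ℝ := (Fintype.card F : ℝ) with hq
  have hq1 : 1 < q := by rw [hq]; exact_mod_cast Fintype.one_lt_card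
  have hq0 : 0 < q := by linarith
  have hB' : ∀ p ∈ B, p.Monic ∧ Irreducible p := fun p hp =>
    ⟨((hB p).mp hp).1, ((hB p).mp hp).2.1⟩
  set θ : F[X] → E := fun f => homogEval a b (f.map (algebraMap F E)) with hθ
  have hmul : ∀ p r : F[X], p.Monic → r.Monic → θ (p * r) = θ p * θ r := fun p r hp hr => by
    simp only [hθ]
    rw [Polynomial.map_mul, homogEval_mul _ _ (hp.map _) (hr.map _)]
  set M : ℝ := C₂ * q ^ ((1 / 2 + ε) * n + ε * D) with hM
  have hM0 : 0 ≤ M := by positivity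
  have key := norm_sum_polyMu_le_two_pow_mul (n := n) (M := √(Nat.card E) * M) hB'
    (P := fun φ => ∃ z, ∀ f : F[X], f.Monic → φ f = u (z * θ f)) ?_ (by positivity) ?_
    (φ := fun f => u (θ f)) ⟨1, fun f _ => by rw [one_mul]⟩
  · refine key.trans ?_
    calc (2 : ℝ) ^ B.card * (√(Nat.card E) * M)
        ≤ C₁ * q ^ (ε * D) * (√(Nat.card E) * M) :=
          mul_le_mul_of_nonneg_right (h₁ B D hB' (hBδ.trans hδD)) (by positivity)
      _ = C₁ * C₂ * √(Nat.card E) * (q ^ (ε * D) * q ^ ((1 / 2 + ε) * n + ε * D)) := by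
          rw [hM]; ring
      _ = _ := by
          rw [← Real.rpow_add hq0]
          congr 2
          ring
  · rintro φ ⟨z, hz⟩ p hp
    refine ⟨z * θ p, fun f hf => ?_⟩
    show φ (p * f) = _
    rw [hz _ ((hB' p hp).1.mul hf), hmul p f (hB' p hp).1 hf, mul_assoc]
  · rintro m hm φ ⟨z, hz⟩
    have h3 := norm_sum_isUnit_le (monicFinset F m) (fun f => (polyMu f : ℂ)) θ hM0
      (fun χ => (h₂ E a b y D δ hy hδ hδD ⟨V, hV⟩ hsurj χ m).trans ?_)
      (u := fun w => u (z * w)) (fun w => hu _)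
    · refine le_of_eq_of_le (congrArg norm (Finset.sum_congr
        (Finset.filter_congr fun f hf => ?_) fun f hf => ?_)) h3
      · exact (isUnit_homogEval_iff hB (mem_monicFinset.mp hf).1).symm
      · rw [hz f (mem_monicFinset.mp (Finset.mem_filter.mp hf).1).1]
    · refine mul_le_mul_of_nonneg_left (Real.rpow_le_rpow_of_exponent_le hq1.le ?_) hC₂.le
      have : (m : ℝ) ≤ n := by exact_mod_cast hm
      gcongr

theorem exists_natCast_le_mul_rpow {q ε : ℝ} (hq : 1 < q) (hε : 0 < ε) :
    ∃ C₀ : ℝ, 0 < C₀ ∧ ∀ n : ℕ, (n : ℝ) ≤ C₀ * q ^ (ε * n) := by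
  have hlog := Real.log_pos hq
  refine ⟨(Real.log q * ε)⁻¹, by positivity, fun n => ?_⟩
  rw [inv_mul_eq_div, le_div_iff₀ (by positivity), Real.rpow_def_of_pos (by linarith)]
  have := Real.add_one_le_exp (Real.log q * (ε * n))
  linarith

/-- Cancellation of the Möbius function against additive characters. -/
theorem exists_norm_sum_polyMu_addChar_le (F : Type u) [Field F] [Fintype F] {ε : ℝ}
    (hε : 0 < ε) :
    ∃ C₀ : ℝ, 0 < C₀ ∧ ∀ n : ℕ, 1 ≤ n → ∀ ψ : AddChar (Fin n → F) ℂ,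
      ‖∑ x : Fin n → F, (polyMu (lowPoly F n x) : ℂ) * ψ x‖ ≤
        C₀ * (Fintype.card F : ℝ) ^ ((3 / 4 + ε) * n) := by
  classical
  set q : ℝ := (Fintype.card F : ℝ) with hq
  have hq1 : 1 < q := by rw [hq]; exact_mod_cast Fintype.one_lt_card
  have hq0 : 0 < q := by linarith
  obtain ⟨C₁, hC₁, h₁⟩ := exists_norm_sum_polyMu_comp_homogEval_le.{u, u} F
    (show 0 < ε / 4 by positivity)
  obtain ⟨C₂, hC₂, h₂⟩ := exists_natCast_le_mul_rpow hq1 (show 0 < ε / 4 by positivity)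
  refine ⟨C₁ * C₂ * q * q ^ (1 / 4 : ℝ), by positivity, fun n hn ψ => ?_⟩
  set D := (n + 1) / 2 with hD
  have hDn : D ≤ n := by omega
  obtain ⟨g, hg, hgD, hψg⟩ := exists_addChar_mul_eq_one (show n - D < D + 1 by omega) ψ
  obtain ⟨E, _, _, _, a, b, y, hy, hcard, hdvd, hE⟩ := exists_conductor_ring F hg
    (Nat.add_sub_cancel' hgD)
  have hsurj := (hE n hDn).1
  set σ := Function.surjInv hsurj with hσ
  have hψσ : ∀ x, ψ x = ψ (σ (homogMap F a b n x)) := by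
    intro x
    have h0 : homogMap F a b n (x - σ (homogMap F a b n x)) = 0 := by
      rw [map_sub, hσ, Function.surjInv_eq hsurj, sub_self]
    obtain ⟨h, hh, hx⟩ := (hE n hDn).2 _ h0
    have h3 := hψg h hh
    rw [← hx] at h3
    simp_rw [coeff_lowPoly] at h3
    rw [AddChar.map_sub_eq_div] at h3
    exact (div_eq_one_iff_eq (ψ.val_isUnit _).ne_zero).mp h3
  set K : ℝ := C₁ * √(Nat.card E) * q ^ ((1 / 2 + ε / 4) * n + 2 * (ε / 4) * D) with hK
  have hK0 : 0 ≤ K := by positivity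
  have hinner : ∀ j ∈ Finset.range n, ∀ c : Fˣ, ‖∑ f ∈ monicFinset F j,
      (polyMu (C (c : F) * f) : ℂ) * ψ (fun i => (C (c : F) * f).coeff i)‖ ≤ K := by
    intro j hj c
    rw [Finset.mem_range] at hj
    have h4 := h₁ E a b y D g hy hg hgD hdvd (fun m hm => (hE m hm.le).1)
      (fun z => ψ (σ (algebraMap F E c * b ^ (n - 1 - j) * z))) (fun z => (ψ.norm_apply _).le) j
    refine (le_of_eq_of_le (congrArg norm (Finset.sum_congr rfl fun f hf => ?_)) h4).trans ?_
    · obtain ⟨hf, hfj⟩ := mem_monicFinset.mp hf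
      have hdeg : (C (c : F) * f).degree < n := by
        rw [degree_C_mul c.ne_zero, degree_eq_natDegree hf.ne_zero, hfj]
        exact_mod_cast hj
      rw [polyMu_C_mul c.ne_zero, hψσ, homogMap_C_mul a b hf (hfj.trans_lt hj) (lowPoly_coeff hdeg),
        hfj]
    · refine mul_le_mul_of_nonneg_left (Real.rpow_le_rpow_of_exponent_le hq1.le ?_) (by positivity)
      have : (j : ℝ) ≤ n := by exact_mod_cast hj.le
      gcongr
  have hsum : ‖∑ x : Fin n → F, (polyMu (lowPoly F n x) : ℂ) * ψ x‖ ≤ n * (q * K) := by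
    have h5 := sum_lowPoly (fun f : F[X] => (polyMu f : ℂ) * ψ fun i => f.coeff i) n
    simp_rw [coeff_lowPoly] at h5
    rw [h5, polyMu_zero, Int.cast_zero, zero_mul, zero_add]
    calc _ ≤ ∑ j ∈ Finset.range n, ∑ _c : Fˣ, K :=
          (norm_sum_le _ _).trans (Finset.sum_le_sum fun j hj =>
            (norm_sum_le _ _).trans (Finset.sum_le_sum fun c _ => hinner j hj c))
      _ = n * (Fintype.card Fˣ * K) := by simp
      _ ≤ n * (q * K) := by
          have : (Fintype.card Fˣ : ℝ) ≤ q := by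
            rw [hq]; exact_mod_cast Fintype.card_le_of_injective _ Units.val_injective
          gcongr
  have hDr : (D : ℝ) ≤ (n + 1) / 2 := by
    have : 2 * D ≤ n + 1 := by omega
    have : (2 * D : ℝ) ≤ n + 1 := by exact_mod_cast this
    linarith
  have hsqrt : √(Nat.card E) = q ^ ((D : ℝ) / 2) := by
    rw [hcard, Nat.cast_pow, ← Real.rpow_natCast, Real.sqrt_eq_rpow, ← Real.rpow_mul hq0.le]
    ring_nf
  calc _ ≤ n * (q * K) := hsum
    _ ≤ C₂ * q ^ (ε / 4 * n) * (q * K) := mul_le_mul_of_nonneg_right (h₂ n) (by positivity)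
    _ = C₁ * C₂ * q * (q ^ (ε / 4 * n) * (q ^ ((D : ℝ) / 2) *
        q ^ ((1 / 2 + ε / 4) * n + 2 * (ε / 4) * D))) := by rw [hK, hsqrt]; ring
    _ ≤ C₁ * C₂ * q * (q ^ (1 / 4 : ℝ) * q ^ ((3 / 4 + ε) * n)) := by
        refine mul_le_mul_of_nonneg_left ?_ (by positivity)
        rw [← Real.rpow_add hq0, ← Real.rpow_add hq0, ← Real.rpow_add hq0]
        refine Real.rpow_le_rpow_of_exponent_le hq1.le ?_
        have : (D : ℝ) ≤ n := by exact_mod_cast hDn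
        have := mul_le_mul_of_nonneg_left this hε.le
        linarith
    _ = _ := by ring

end Assembly

/-- Let `c > 0` be a constant. For every `ε > 0` there is a constant `C = C(ε,q)` such
that for every `n ≥ 1`, every `r ≤ cn`, every `1`-bounded `G : F_q^r → ℂ` and all
`F_q`-linear forms `ℓ_1, …, ℓ_r` on `F_q^n`,
`|∑_{deg f < n} μ(f) G(ℓ_1(f), …, ℓ_r(f))| ≤ C q^((3/4+c+ε)n)`. -/
theorem moebius_few_linear_forms_bound {F : Type*} [Field F] [Fintype F] (q : ℕ)
    (hq : Fintype.card F = q) (c : ℝ) (hc : 0 < c) (ε : ℝ) (hε : 0 < ε) :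
    ∃ C : ℝ, ∀ n : ℕ, 1 ≤ n → ∀ r : ℕ, (r : ℝ) ≤ c * n →
      ∀ G : (Fin r → F) → ℂ, (∀ a, ‖G a‖ ≤ 1) →
        ∀ L : Fin r → ((Fin n → F) →ₗ[F] F),
          ‖∑ x : Fin n → F, (polyMu (lowPoly F n x) : ℂ) * G (fun i => L i x)‖ ≤
            C * (q : ℝ) ^ ((3 / 4 + c + ε) * n) := by
  classical
  subst hq
  obtain ⟨C₀, hC₀, h₀⟩ := exists_norm_sum_polyMu_addChar_le F hε
  refine ⟨C₀, fun n hn r hr G hG L => ?_⟩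
  have hq1 : (1 : ℝ) < Fintype.card F := by exact_mod_cast Fintype.one_lt_card
  refine (norm_sum_le_card_mul_of_addChar Finset.univ
    (fun x => (polyMu (lowPoly F n x) : ℂ)) (fun x => LinearMap.pi L x)
    (fun ψ => h₀ n hn (ψ.compAddMonoidHom (LinearMap.pi L).toAddMonoidHom)) hG).trans ?_
  rw [Fintype.card_fun, Fintype.card_fin, Nat.cast_pow, ← Real.rpow_natCast, mul_left_comm,
    ← Real.rpow_add (by linarith)]
  refine mul_le_mul_of_nonneg_left (Real.rpow_le_rpow_of_exponent_le hq1.le ?_) hC₀.le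
  linarith
end

section
/- Let F_q be a finite field of odd characteristic, let P ∈ F_q[x_1, …, x_N] be a polynomial of degree at most 2 whose associated symmetric matrix has rank at least r, and let χ be a nontrivial additive character of F_q. Then |(1/q^N) ∑_{x ∈ F_q^N} χ(P(x))| ≤ q^{−r/2}. -/
open Matrix

/-- Orthogonality: summing a nontrivial additive character along a linear form gives `0` unless
the form vanishes. -/
theorem AddChar.sum_dotProduct_eq_ite {F R ι : Type*} [Field F] [Fintype F] [CommRing R]
    [IsDomain R] [Fintype ι] [DecidableEq ι] [DecidableEq F] {ψ : AddChar F R} (hψ : ψ ≠ 1)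
    (v : ι → F) :
    ∑ x : ι → F, ψ (v ⬝ᵥ x) = if v = 0 then (Fintype.card F : R) ^ Fintype.card ι else 0 := by
  split_ifs with hv
  · simp [hv]
  · let φ : AddChar (ι → F) R := ψ.compAddMonoidHom (dotProductBilin F F v).toAddMonoidHom
    have hφ : φ ≠ 1 := by
      obtain ⟨a, ha⟩ := AddChar.ne_one_iff.mp hψ
      obtain ⟨i, hi⟩ := Function.ne_iff.mp hv
      intro h
      apply ha
      have h' := DFunLike.congr_fun h (Pi.single i ((v i)⁻¹ * a))
      have hi' : v i ≠ 0 := hi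
      simpa [φ, hi'] using h'
    exact AddChar.sum_eq_zero_of_ne_one hφ

theorem Matrix.card_mulVec_eq_zero {F m n : Type*} [Field F] [Fintype F] [Fintype m] [Fintype n]
    [DecidableEq F] [DecidableEq n] (M : Matrix m n F) :
    Finset.card {h : n → F | M *ᵥ h = 0} = Fintype.card F ^ (Fintype.card n - M.rank) := by
  have hrank := M.mulVecLin.finrank_range_add_finrank_ker
  rw [Module.finrank_fintype_fun_eq_card] at hrank
  have hker : Module.finrank F (LinearMap.ker M.mulVecLin) = Fintype.card n - M.rank := by
    rw [Matrix.rank]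
    omega
  rw [← hker, ← Nat.card_eq_fintype_card, ← Module.natCard_eq_pow_finrank]
  exact (Nat.subtype_card _ fun x => by simp).symm

/-- Weyl differencing for a quadratic exponential sum. -/
theorem norm_sq_sum_quadratic_le {F ι : Type*} [Field F] [Fintype F] [Fintype ι] [DecidableEq ι]
    (hchar : ringChar F ≠ 2) {M : Matrix ι ι F} (hM : Mᵀ = M) (b : ι → F) (c : F)
    {ψ : AddChar F ℂ} (hψ : ψ ≠ 1) :
    ‖∑ x : ι → F, ψ (x ⬝ᵥ M *ᵥ x + b ⬝ᵥ x + c)‖ ^ 2 ≤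
      (Fintype.card F : ℝ) ^ Fintype.card ι *
        (Fintype.card F : ℝ) ^ (Fintype.card ι - M.rank) := by
  classical
  set P : (ι → F) → F := fun x => x ⬝ᵥ M *ᵥ x + b ⬝ᵥ x + c with hP
  have hdiff (x h : ι → F) :
      P (h + x) - P x = (h ⬝ᵥ M *ᵥ h + b ⬝ᵥ h) + ((2 : F) • M *ᵥ h) ⬝ᵥ x := by
    have h1 : h ⬝ᵥ M *ᵥ x = x ⬝ᵥ M *ᵥ h := by
      rw [dotProduct_mulVec, ← mulVec_transpose, hM, dotProduct_comm]
    simp only [hP, mulVec_add, dotProduct_add, add_dotProduct, h1, smul_dotProduct, smul_eq_mul,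
      dotProduct_comm (M *ᵥ h) x]
    ring
  have hsum : (∑ x, ψ (P x)) * starRingEnd ℂ (∑ x, ψ (P x)) =
      ∑ h, ψ (h ⬝ᵥ M *ᵥ h + b ⬝ᵥ h) * ∑ x, ψ (((2 : F) • M *ᵥ h) ⬝ᵥ x) := by
    simp_rw [map_sum, Finset.sum_mul_sum, Finset.mul_sum]
    rw [Finset.sum_comm]
    conv_rhs => rw [Finset.sum_comm]
    refine Finset.sum_congr rfl fun x _ => ?_
    rw [← Equiv.sum_comp (Equiv.addRight x)]
    refine Finset.sum_congr rfl fun h _ => ?_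
    rw [← AddChar.map_neg_eq_conj, ← AddChar.map_add_eq_mul, ← AddChar.map_add_eq_mul, ← hdiff,
      Equiv.coe_addRight, sub_eq_add_neg]
  have hnorm : ‖∑ x, ψ (P x)‖ ^ 2 =
      ‖∑ h, ψ (h ⬝ᵥ M *ᵥ h + b ⬝ᵥ h) * ∑ x, ψ (((2 : F) • M *ᵥ h) ⬝ᵥ x)‖ := by
    rw [← hsum, norm_mul, RCLike.norm_conj, sq]
  have h2 : (2 : F) ≠ 0 := Ring.two_ne_zero hchar
  rw [hnorm]
  refine (norm_sum_le _ _).trans_eq ?_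
  simp_rw [norm_mul, AddChar.norm_apply, one_mul, AddChar.sum_dotProduct_eq_ite hψ,
    smul_eq_zero_iff_right h2, apply_ite norm, norm_zero, norm_pow, Complex.norm_natCast]
  rw [← Finset.sum_filter, Finset.sum_const, M.card_mulVec_eq_zero, nsmul_eq_mul, mul_comm]
  push_cast
  rfl

/-- Gauss sum bound: for a finite field `F_q` of odd characteristic, a polynomial of degree
at most `2` written as `P(x) = xᵀMx + bᵀx + c` with `M` symmetric of rank at least `r`,
and a nontrivial additive character `χ` of `F_q`,
`|(1/q^N) ∑_{x ∈ F_q^N} χ(P(x))| ≤ q^{-r/2}`. -/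
theorem gauss_sum_quadratic_bound {F : Type*} [Field F] [Fintype F]
    (hchar : ringChar F ≠ 2) (q N r : ℕ) (hq : Fintype.card F = q)
    (M : Matrix (Fin N) (Fin N) F) (hM : Mᵀ = M) (b : Fin N → F) (c : F)
    (hr : r ≤ M.rank) (χ : AddChar F Circle) (hχ : χ ≠ 1) :
    ‖(1 / (q : ℂ) ^ N) * ∑ x : Fin N → F, (χ (x ⬝ᵥ M.mulVec x + b ⬝ᵥ x + c) : ℂ)‖ ≤
      (q : ℝ) ^ (-(r : ℝ) / 2) := by
  subst hq
  have hψ : Circle.coeHom.compAddChar χ ≠ 1 := by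
    obtain ⟨a, ha⟩ := AddChar.ne_one_iff.mp hχ
    intro h
    exact ha (Circle.coe_eq_one.mp (DFunLike.congr_fun h a))
  have hS := norm_sq_sum_quadratic_le hchar hM b c hψ
  simp only [MonoidHom.compAddChar_apply, Function.comp_apply, Fintype.card_fin] at hS
  have hq : (1 : ℝ) ≤ Fintype.card F := by exact_mod_cast Fintype.card_pos
  have hq0 : (0 : ℝ) < Fintype.card F := by linarith
  have hrN : M.rank ≤ N := by simpa using M.rank_le_card_width
  refine (pow_le_pow_iff_left₀ (norm_nonneg _) (by positivity) two_ne_zero).mp ?_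
  rw [norm_mul, mul_pow, norm_div, norm_one, norm_pow, Complex.norm_natCast,
    ← Real.rpow_mul_natCast hq0.le, Nat.cast_ofNat, div_mul_cancel₀ _ two_ne_zero,
    Real.rpow_neg hq0.le, Real.rpow_natCast]
  calc _ ≤ (1 / (Fintype.card F : ℝ) ^ N) ^ 2 *
        ((Fintype.card F : ℝ) ^ N * (Fintype.card F : ℝ) ^ (N - M.rank)) := by
        gcongr
        exact hS
    _ = ((Fintype.card F : ℝ) ^ M.rank)⁻¹ := by
      rw [pow_sub₀ _ hq0.ne' hrN]
      field_simp
    _ ≤ ((Fintype.card F : ℝ) ^ r)⁻¹ := by gcongr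
end
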